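/- Let G~ be a mixed graph with underlying graph G satisfying κ(G) = c(G) − 1. Then r(G~) = 2m(G) − 2κ(G) if and only if both of the following hold: (a) any two even cycles of G (if any) share no common vertices; (b) some sequence of pendant K₂ deletion operations transforms G~ into a crucial subgraph G~₁ with κ(G₁) = κ(G) such that G~₁ is either a graph with no edges, or G~₁ has at most one connected component belonging to 𝔊₂ and every other connected component of G~₁ is either an even cycle C~_q with σ(C~_q) ≡ q (mod 4) or an isolated vertex. -/

import Mathlib

open scoped Classical

namespace MixedPaper

universe u

/-- A mixed graph: a finite simple graph together with an orientation of a subset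
of its edges.  `arc u v = true` means there is an arc from `u` to `v`. -/
structure MixedGraph (V : Type u) where
  graph : SimpleGraph V
  arc : V → V → Bool
  arc_adj : ∀ u v, arc u v → graph.Adj u v
  arc_antisymm : ∀ u v, arc u v → ¬ arc v u

variable {V : Type u}

/-- The Hermitian adjacency matrix of a mixed graph. -/
noncomputable def MixedGraph.hMatrix [Fintype V] [DecidableEq V] (M : MixedGraph V) :
    Matrix V V ℂ := fun u v =>
  if M.arc u v then Complex.I
  else if M.arc v u then -Complex.I
  else if M.graph.Adj u v then 1 else 0

/-- The H-rank of a mixed graph: the rank of its Hermitian adjacency matrix. -/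
noncomputable def MixedGraph.hRank [Fintype V] [DecidableEq V] (M : MixedGraph V) : ℕ :=
  M.hMatrix.rank

/-- The matching number of a simple graph. -/
noncomputable def matchingNumber (G : SimpleGraph V) : ℕ :=
  sSup {k | ∃ N : G.Subgraph, N.IsMatching ∧ N.edgeSet.ncard = k}

/-- A subgraph is a cycle subgraph if it is connected and every one of its vertices
has exactly two neighbours in it. -/
def IsCycleSubgraph {G : SimpleGraph V} (C : G.Subgraph) : Prop :=
  C.Connected ∧ ∀ v ∈ C.verts, {w | C.Adj v w}.ncard = 2

/-- κ(G) : the number of even cycles of G. -/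
noncomputable def evenCycleCount (G : SimpleGraph V) : ℕ :=
  {C : G.Subgraph | IsCycleSubgraph C ∧ Even C.verts.ncard}.ncard

/-- c(G) = |E(G)| - |V(G)| + ω(G), the cyclomatic number. -/
noncomputable def cyclomatic [Fintype V] (G : SimpleGraph V) : ℤ :=
  (G.edgeSet.ncard : ℤ) - (Fintype.card V : ℤ) + (Nat.card G.ConnectedComponent : ℤ)

/-- The induced mixed subgraph on a set of vertices. -/
def MixedGraph.induce (M : MixedGraph V) (S : Set V) : MixedGraph S where
  graph := M.graph.induce S
  arc := fun a b => M.arc a.1 b.1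
  arc_adj := fun a b h => M.arc_adj a.1 b.1 h
  arc_antisymm := fun a b h => M.arc_antisymm a.1 b.1 h

/-- The mixed subgraph induced by a connected component of the underlying graph. -/
def MixedGraph.comp (M : MixedGraph V) (c : M.graph.ConnectedComponent) :
    MixedGraph c.supp := M.induce c.supp

/-- The signature |f - b| of a closed walk in a mixed graph: the absolute difference
between the numbers of forward and backward arcs along the walk. -/
def walkSignature (M : MixedGraph V) {u : V} (w : M.graph.Walk u u) : ℕ :=
  ((w.darts.countP fun d => M.arc d.toProd.1 d.toProd.2 : ℤ) -
    (w.darts.countP fun d => M.arc d.toProd.2 d.toProd.1 : ℤ)).natAbs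

/-- The signature of the cycle subgraph `C` of the mixed graph `M` satisfies the
predicate `P` (expressed via a closed walk traversing `C`; the signature does not
depend on the choice of traversal). -/
def CycleSig (M : MixedGraph V) (C : M.graph.Subgraph) (P : ℕ → Prop) : Prop :=
  ∃ (u : V) (w : M.graph.Walk u u), w.IsCycle ∧
    {v | v ∈ w.support} = C.verts ∧ {e | e ∈ w.edges} = C.edgeSet ∧
    P (walkSignature M w)

/-- `C` is a pendant cycle with unique vertex `x` of degree 3. -/
def IsPendantCycle (G : SimpleGraph V) (C : G.Subgraph) (x : V) : Prop :=
  IsCycleSubgraph C ∧ x ∈ C.verts ∧ {w | G.Adj x w}.ncard = 3 ∧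
    ∀ v ∈ C.verts, v ≠ x → {w | G.Adj v w}.ncard = 2

/-- G has no pendant vertices (vertices of degree 1). -/
def NoPendantVerts (G : SimpleGraph V) : Prop := ∀ u : V, {w | G.Adj u w}.ncard ≠ 1

/-- The (distinct) cycles of G are pairwise vertex-disjoint. -/
def CyclesVertexDisjoint (G : SimpleGraph V) : Prop :=
  ∀ C₁ C₂ : G.Subgraph, IsCycleSubgraph C₁ → IsCycleSubgraph C₂ → C₁ ≠ C₂ →
    Disjoint C₁.verts C₂.verts

/-- The (distinct) even cycles of G are pairwise vertex-disjoint. -/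
def EvenCyclesVertexDisjoint (G : SimpleGraph V) : Prop :=
  ∀ C₁ C₂ : G.Subgraph, IsCycleSubgraph C₁ → IsCycleSubgraph C₂ →
    Even C₁.verts.ncard → Even C₂.verts.ncard → C₁ ≠ C₂ →
    Disjoint C₁.verts C₂.verts

/-- One pendant `K₂` deletion step, recorded on the surviving vertex sets:
`u` is pendant in the graph induced on `S` with unique neighbour `v` there,
and both are deleted. -/
def PendantStep (G : SimpleGraph V) (S T : Set V) : Prop :=
  ∃ u v, u ∈ S ∧ v ∈ S ∧ {w | w ∈ S ∧ G.Adj u w} = {v} ∧ T = S \ {u, v}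

/-- `S` is reachable from the full vertex set by a sequence of pendant K₂ deletions. -/
def PendantReaches (G : SimpleGraph V) (S : Set V) : Prop :=
  Relation.ReflTransGen (PendantStep G) Set.univ S

/-- The graph induced on `S` has no pendant vertices. -/
def NoPendantIn (G : SimpleGraph V) (S : Set V) : Prop :=
  ∀ u ∈ S, {w | w ∈ S ∧ G.Adj u w}.ncard ≠ 1

/-- `u` lies on some even cycle of `G`. -/
def OnEvenCycle (G : SimpleGraph V) (u : V) : Prop :=
  ∃ C : G.Subgraph, IsCycleSubgraph C ∧ Even C.verts.ncard ∧ u ∈ C.verts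

/-- G is the graph ∞(p,1,q): two cycles of lengths p and q sharing exactly one vertex. -/
def IsInfinityGraph (G : SimpleGraph V) (p q : ℕ) : Prop :=
  ∃ C₁ C₂ : G.Subgraph, IsCycleSubgraph C₁ ∧ IsCycleSubgraph C₂ ∧
    C₁.verts.ncard = p ∧ C₂.verts.ncard = q ∧
    (C₁.verts ∩ C₂.verts).ncard = 1 ∧ C₁ ⊔ C₂ = ⊤

/-- G is the theta graph θ(p,l,q): three internally disjoint paths with p, l, q
vertices respectively, joining two common endvertices. -/
def IsThetaGraph (G : SimpleGraph V) (p l q : ℕ) : Prop :=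
  2 ≤ p ∧ 2 ≤ l ∧ 2 ≤ q ∧ ¬(p = 2 ∧ l = 2) ∧ ¬(p = 2 ∧ q = 2) ∧ ¬(l = 2 ∧ q = 2) ∧
  ∃ (a b : V) (W₁ W₂ W₃ : G.Walk a b), W₁.IsPath ∧ W₂.IsPath ∧ W₃.IsPath ∧
    W₁.length = p - 1 ∧ W₂.length = l - 1 ∧ W₃.length = q - 1 ∧
    (∀ v : V, v ∈ W₁.support ∨ v ∈ W₂.support ∨ v ∈ W₃.support) ∧
    (∀ e ∈ G.edgeSet, e ∈ W₁.edges ∨ e ∈ W₂.edges ∨ e ∈ W₃.edges) ∧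
    {v | v ∈ W₁.support ∧ v ∈ W₂.support} = {a, b} ∧
    {v | v ∈ W₁.support ∧ v ∈ W₃.support} = {a, b} ∧
    {v | v ∈ W₂.support ∧ v ∈ W₃.support} = {a, b}

/-- Every odd cycle of `M` has signature satisfying `P`. -/
def OddCyclesSig (M : MixedGraph V) (P : ℕ → Prop) : Prop :=
  ∀ C : M.graph.Subgraph, IsCycleSubgraph C → Odd C.verts.ncard → CycleSig M C P

/-- Every even cycle of `M`, of length `n`, has signature `s` satisfying `P n s`. -/
def EvenCyclesSig (M : MixedGraph V) (P : ℕ → ℕ → Prop) : Prop :=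
  ∀ C : M.graph.Subgraph, IsCycleSubgraph C → Even C.verts.ncard →
    CycleSig M C (P C.verts.ncard)

/-- The whole mixed graph is a single cycle. -/
def IsCycleMG (M : MixedGraph V) : Prop := IsCycleSubgraph (⊤ : M.graph.Subgraph)

/-- The family 𝔊₀. -/
def MemG0 [Fintype V] [DecidableEq V] (M : MixedGraph V) : Prop :=
  M.graph.Connected ∧ 1 ≤ cyclomatic M.graph ∧ CyclesVertexDisjoint M.graph ∧
  NoPendantVerts M.graph ∧
  ∃ (C : M.graph.Subgraph) (x : V), IsPendantCycle M.graph C x ∧ Odd C.verts.ncard ∧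
    CycleSig M C Odd ∧
    ((M.induce (C.vertsᶜ ∪ {x})).hRank : ℤ) =
      2 * (matchingNumber (M.induce (C.vertsᶜ ∪ {x})).graph : ℤ) -
        2 * cyclomatic (M.induce (C.vertsᶜ ∪ {x})).graph

/-- The family 𝔛₁ : mixed ∞(p,1,q)-graphs, p even, q odd, whose odd cycle has odd
signature and whose even cycle C̃_p satisfies σ ≡ p (mod 4). -/
def MemX1 (M : MixedGraph V) : Prop :=
  ∃ p q : ℕ, Even p ∧ Odd q ∧ IsInfinityGraph M.graph p q ∧
    OddCyclesSig M Odd ∧ EvenCyclesSig M (fun n s => s % 4 = n % 4)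

/-- The family 𝔛₂ : mixed θ(p,l,q)-graphs, p even, l q odd, whose two odd cycles have odd
signatures and whose even cycle C̃_{q+l-2} satisfies q + l + σ ≡ 2 (mod 4). -/
def MemX2 (M : MixedGraph V) : Prop :=
  ∃ p l q : ℕ, Even p ∧ Odd l ∧ Odd q ∧ IsThetaGraph M.graph p l q ∧
    OddCyclesSig M Odd ∧ EvenCyclesSig M (fun _ s => (q + l + s) % 4 = 2)

/-- The family 𝔊₂ = 𝔊₀ ∪ 𝔛₁ ∪ 𝔛₂ together with the mixed odd cycles of odd signature. -/
def MemG2 [Fintype V] [DecidableEq V] (M : MixedGraph V) : Prop :=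
  MemG0 M ∨ MemX1 M ∨ MemX2 M ∨
    (IsCycleMG M ∧ Odd (Nat.card V) ∧ CycleSig M ⊤ Odd)

/-- The family 𝔜₁. -/
def MemY1 (M : MixedGraph V) : Prop :=
  ∃ p q : ℕ, Even p ∧ Odd q ∧ IsInfinityGraph M.graph p q ∧
    OddCyclesSig M Even ∧ EvenCyclesSig M (fun n s => s % 4 = n % 4)

/-- The family 𝔜₂. -/
def MemY2 (M : MixedGraph V) : Prop :=
  ∃ p l q : ℕ, Even p ∧ Odd l ∧ Odd q ∧ IsThetaGraph M.graph p l q ∧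
    OddCyclesSig M Even ∧ EvenCyclesSig M (fun _ s => (q + l + s) % 4 = 2)

/-- `M` is a disjoint union of `k` even cycles and one odd cycle with even signature. -/
def IsDisjointUnionEvenCyclesOddCycleEvenSig (M : MixedGraph V) (k : ℤ) : Prop :=
  (∀ c : M.graph.ConnectedComponent, IsCycleMG (M.comp c)) ∧
  (({c : M.graph.ConnectedComponent | Even (Nat.card c.supp)}.ncard : ℤ) = k) ∧
  (∃! c : M.graph.ConnectedComponent, Odd (Nat.card c.supp)) ∧
  (∀ c : M.graph.ConnectedComponent, Odd (Nat.card c.supp) →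
    CycleSig (M.comp c) ⊤ Even)

/-- The family 𝔉₀. -/
def MemF0 [Fintype V] [DecidableEq V] (M : MixedGraph V) : Prop :=
  M.graph.Connected ∧ 2 ≤ cyclomatic M.graph ∧ CyclesVertexDisjoint M.graph ∧
  NoPendantVerts M.graph ∧
  (∃ (C₀ : M.graph.Subgraph) (x₀ : V), IsPendantCycle M.graph C₀ x₀ ∧ Odd C₀.verts.ncard ∧
    CycleSig M C₀ Even ∧
    ∀ C : M.graph.Subgraph, IsCycleSubgraph C → C ≠ C₀ →
      Even C.verts.ncard ∧ CycleSig M C (fun s => s % 4 = C.verts.ncard % 4)) ∧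
  (∃ (Cq : M.graph.Subgraph) (x : V), IsPendantCycle M.graph Cq x ∧ Even Cq.verts.ncard ∧
    ∃ S : Set ↥(Cq.vertsᶜ ∪ {x}),
      PendantReaches (M.induce (Cq.vertsᶜ ∪ {x})).graph S ∧
      NoPendantIn (M.induce (Cq.vertsᶜ ∪ {x})).graph S ∧
      IsDisjointUnionEvenCyclesOddCycleEvenSig
        ((M.induce (Cq.vertsᶜ ∪ {x})).induce S)
        (cyclomatic (M.induce (Cq.vertsᶜ ∪ {x})).graph))

/-- The family 𝔉₂ = 𝔉₀ ∪ 𝔜₁ ∪ 𝔜₂ together with the mixed odd cycles of even signature. -/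
def MemF2 [Fintype V] [DecidableEq V] (M : MixedGraph V) : Prop :=
  MemF0 M ∨ MemY1 M ∨ MemY2 M ∨
    (IsCycleMG M ∧ Odd (Nat.card V) ∧ CycleSig M ⊤ Even)

/-- A connected component that is either an even cycle C̃_q with σ ≡ q (mod 4),
or an isolated vertex. -/
def GoodOtherComp (M : MixedGraph V) : Prop :=
  (IsCycleMG M ∧ Even (Nat.card V) ∧
    CycleSig M ⊤ (fun s => s % 4 = (Nat.card V) % 4)) ∨
  Nat.card V = 1

/-- A fractional matching of `G`, given as a weight function on `Sym2 V` vanishing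
outside the edge set. -/
def IsFracMatching [Fintype V] [DecidableEq V] (G : SimpleGraph V) (f : Sym2 V → ℝ) : Prop :=
  (∀ e ∈ G.edgeSet, 0 ≤ f e ∧ f e ≤ 1) ∧ (∀ e, e ∉ G.edgeSet → f e = 0) ∧
    ∀ v : V, ∑ e ∈ Finset.univ.filter (fun e : Sym2 V => v ∈ e), f e ≤ 1

/-- The fractional matching number m*(G). -/
noncomputable def fracMatchingNumber [Fintype V] [DecidableEq V] (G : SimpleGraph V) : ℝ :=
  sSup {x : ℝ | ∃ f : Sym2 V → ℝ, IsFracMatching G f ∧ ∑ e : Sym2 V, f e = x}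

/-- Membership in the family ℱ : fractional matchings of total weight m*(G) taking
values in {0, 1/2, 1}. -/
def InOptFamily [Fintype V] [DecidableEq V] (G : SimpleGraph V) (f : Sym2 V → ℝ) : Prop :=
  IsFracMatching G f ∧ (∑ e : Sym2 V, f e) = fracMatchingNumber G ∧
    ∀ e : Sym2 V, f e = 0 ∨ f e = 1 / 2 ∨ f e = 1

/-- An optimal fractional matching: a member of ℱ with the largest number of
edges of weight 1. -/
def IsOptFracMatching [Fintype V] [DecidableEq V] (G : SimpleGraph V) (f : Sym2 V → ℝ) : Prop :=
  InOptFamily G f ∧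
    ∀ g : Sym2 V → ℝ, InOptFamily G g →
      {e : Sym2 V | g e = 1}.ncard ≤ {e : Sym2 V | f e = 1}.ncard

/-- E₁(C) : the edges of `G` with exactly one endpoint on the cycle `C`. -/
def cutEdges (G : SimpleGraph V) (C : G.Subgraph) : Set (Sym2 V) :=
  {e | e ∈ G.edgeSet ∧ ∃ a b : V, e = s(a, b) ∧ a ∈ C.verts ∧ b ∉ C.verts}


set_option linter.all false

section LinAlg
variable [Fintype V] [DecidableEq V]

lemma rank_pivot1 (A : Matrix V V ℂ) (a b : V) (h : A a b ≠ 0) :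
    A.rank = (Matrix.of fun i j => A i j - A i b * A a j / A a b).rank + 1 := by
  set A' : Matrix V V ℂ := Matrix.of fun i j => A i j - A i b * A a j / A a b with hA'
  have hmul : ∀ v, A'.mulVec v = A.mulVec v - ((A.mulVec v) a / A a b) • A.col b := by
    intro v
    ext i
    simp only [hA', Matrix.mulVec, dotProduct, Matrix.of_apply, Pi.sub_apply, Pi.smul_apply,
      smul_eq_mul, Matrix.col_apply]
    rw [Finset.sum_div, Finset.sum_mul, ← Finset.sum_sub_distrib]
    refine Finset.sum_congr rfl fun j _ => ?_
    field_simp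
  have hcol : A.col b = A.mulVec (Pi.single b 1) := by
    simp
  have hsup : LinearMap.range A.mulVecLin
      = LinearMap.range A'.mulVecLin ⊔ Submodule.span ℂ {A.col b} := by
    apply le_antisymm
    · rintro _ ⟨v, rfl⟩
      rw [Matrix.mulVecLin_apply]
      have : A.mulVec v = A'.mulVec v + ((A.mulVec v) a / A a b) • A.col b := by
        rw [hmul]; simp
      rw [this]
      exact Submodule.add_mem_sup ⟨v, rfl⟩
        (Submodule.smul_mem _ _ (Submodule.mem_span_singleton_self _))
    · apply sup_le
      · rintro _ ⟨v, rfl⟩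
        rw [Matrix.mulVecLin_apply, hmul, hcol]
        exact Submodule.sub_mem _ ⟨v, rfl⟩ (Submodule.smul_mem _ _ ⟨_, rfl⟩)
      · rw [Submodule.span_singleton_le_iff_mem, hcol]
        exact ⟨_, rfl⟩
  have hdisj : LinearMap.range A'.mulVecLin ⊓ Submodule.span ℂ {A.col b} = ⊥ := by
    rw [eq_bot_iff]
    rintro x ⟨⟨v, hv⟩, hx⟩
    obtain ⟨c, rfl⟩ := Submodule.mem_span_singleton.1 hx
    have h1 : (A'.mulVecLin v) a = 0 := by
      rw [Matrix.mulVecLin_apply, hmul]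
      simp [Matrix.col_apply]
      field_simp
      simp
    rw [hv] at h1
    have : c = 0 := by
      simpa [Matrix.col_apply, h] using h1
    simp [this]
  have hne : A.col b ≠ 0 := by
    intro h0
    apply h
    simpa using congrFun h0 a
  have := Submodule.finrank_sup_add_finrank_inf_eq (LinearMap.range A'.mulVecLin)
    (Submodule.span ℂ {A.col b})
  rw [hdisj, finrank_bot, finrank_span_singleton hne, ← hsup] at this
  simpa [Matrix.rank] using this

lemma rank_pivot2 (A : Matrix V V ℂ) (a b : V) (h : A a b ≠ 0) (h' : A b a ≠ 0)
    (ha : A a a = 0) (hb : A b b = 0) :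
    A.rank = (Matrix.of fun i j => A i j - A i a * A b j / A b a - A i b * A a j / A a b).rank
      + 2 := by
  rw [rank_pivot1 A a b h]
  set A' : Matrix V V ℂ := Matrix.of fun i j => A i j - A i b * A a j / A a b with hA'
  have e : A' b a = A b a := by simp [hA', hb]
  rw [rank_pivot1 A' b a (by rw [e]; exact h')]
  refine congrArg (fun B : Matrix V V ℂ => B.rank + 2) ?_
  ext i j
  simp only [Matrix.of_apply]
  rw [e]
  simp only [hA', Matrix.of_apply, ha, hb]
  ring

/-- masking a matrix to a set of indices -/
noncomputable def mk (A : Matrix V V ℂ) (S : Set V) : Matrix V V ℂ :=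
  Matrix.of fun i j => if i ∈ S ∧ j ∈ S then A i j else 0

lemma mk_eq_mul (A : Matrix V V ℂ) (S : Set V) :
    mk A S = Matrix.diagonal (fun i => if i ∈ S then 1 else 0) * A *
      Matrix.diagonal (fun i => if i ∈ S then 1 else 0) := by
  ext i j
  rw [Matrix.mul_diagonal, Matrix.diagonal_mul]
  by_cases hi : i ∈ S <;> by_cases hj : j ∈ S <;> simp [mk, hi, hj]

lemma rank_mk_le (A : Matrix V V ℂ) (S : Set V) : (mk A S).rank ≤ A.rank := by
  rw [mk_eq_mul]
  exact (Matrix.rank_mul_le_left _ _).trans (Matrix.rank_mul_le_right _ _)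

lemma mk_mk (A : Matrix V V ℂ) (S T : Set V) : mk (mk A S) T = mk A (S ∩ T) := by
  ext i j
  simp only [mk, Matrix.of_apply, Set.mem_inter_iff]
  by_cases hi : i ∈ S <;> by_cases hj : j ∈ S <;> by_cases hi' : i ∈ T <;>
    by_cases hj' : j ∈ T <;> simp [*]

lemma rank_mk_mono (A : Matrix V V ℂ) {S T : Set V} (h : S ⊆ T) :
    (mk A S).rank ≤ (mk A T).rank := by
  have : mk A S = mk (mk A T) S := by rw [mk_mk, Set.inter_eq_right.2 h]
  rw [this]
  exact rank_mk_le _ _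

/-- rank of the masked matrix equals the rank of the compressed matrix -/
lemma rank_submatrix_emb {W : Type*} [Fintype W] [DecidableEq W] (A : Matrix V V ℂ) (φ : W ↪ V)
    (S : Set V) (hS : S = Set.range φ) : (A.submatrix φ φ).rank = (mk A S).rank := by
  apply le_antisymm
  · have : A.submatrix φ φ = (mk A S).submatrix φ φ := by
      ext i j
      simp [mk, hS]
    rw [this]
    exact Matrix.rank_submatrix_le _ _ _
  · let P : Matrix V W ℂ := Matrix.of fun v w => if v = φ w then 1 else 0
    have : mk A S = P * A.submatrix φ φ * P.transpose := by
      ext i j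
      simp only [mk, Matrix.of_apply, Matrix.mul_apply, P, Matrix.transpose_apply,
        Matrix.submatrix_apply]
      by_cases hi : i ∈ S
      · by_cases hj : j ∈ S
        · rw [hS] at hi hj
          obtain ⟨a, rfl⟩ := hi
          obtain ⟨b, rfl⟩ := hj
          simp [hS, φ.injective.eq_iff]
        · rw [if_neg (by tauto)]
          symm
          apply Finset.sum_eq_zero
          intro x _
          rw [if_neg, mul_zero]
          rintro rfl
          exact hj (by simp [hS])
      · rw [if_neg (by tauto)]
        symm
        apply Finset.sum_eq_zero
        intro x _
        rw [Finset.sum_eq_zero, zero_mul]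
        intro y _
        rw [if_neg, zero_mul]
        rintro rfl
        exact hi (by simp [hS])
    rw [this]
    exact (Matrix.rank_mul_le_left _ _).trans (Matrix.rank_mul_le_right _ _)

/-- rank is additive for block decompositions -/
lemma rank_mk_union (A : Matrix V V ℂ) (S T : Set V) (hd : Disjoint S T)
    (h1 : ∀ s ∈ S, ∀ t ∈ T, A s t = 0) (h2 : ∀ s ∈ S, ∀ t ∈ T, A t s = 0) :
    (mk A (S ∪ T)).rank = (mk A S).rank + (mk A T).rank := by
  have hST : ∀ i, i ∈ S → i ∉ T := fun i hi hi' => Set.disjoint_left.1 hd hi hi'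
  have hsum : mk A (S ∪ T) = mk A S + mk A T := by
    ext i j
    simp only [mk, Matrix.of_apply, Matrix.add_apply, Set.mem_union]
    by_cases hi : i ∈ S <;> by_cases hj : j ∈ S <;> by_cases hi' : i ∈ T <;>
      by_cases hj' : j ∈ T <;> simp [*] <;>
      first
      | exact absurd hi' (hST _ hi)
      | exact absurd hj' (hST _ hj)
      | exact h1 _ hi _ hj'
      | exact h2 _ hj _ hi'
  have hr : LinearMap.range (mk A (S ∪ T)).mulVecLin
      = LinearMap.range (mk A S).mulVecLin ⊔ LinearMap.range (mk A T).mulVecLin := by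
    apply le_antisymm
    · rintro _ ⟨v, rfl⟩
      rw [hsum, Matrix.mulVecLin_apply, Matrix.add_mulVec]
      exact Submodule.add_mem_sup ⟨v, rfl⟩ ⟨v, rfl⟩
    · apply sup_le
      · rintro _ ⟨v, rfl⟩
        refine ⟨fun i => if i ∈ S then v i else 0, ?_⟩
        ext i
        simp only [Matrix.mulVecLin_apply, Matrix.mulVec, dotProduct, mk, Matrix.of_apply]
        refine Finset.sum_congr rfl fun j _ => ?_
        by_cases hi : i ∈ S <;> by_cases hj : j ∈ S <;> by_cases hi' : i ∈ T <;> simp [*]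
      · rintro _ ⟨v, rfl⟩
        refine ⟨fun i => if i ∈ T then v i else 0, ?_⟩
        ext i
        simp only [Matrix.mulVecLin_apply, Matrix.mulVec, dotProduct, mk, Matrix.of_apply]
        refine Finset.sum_congr rfl fun j _ => ?_
        by_cases hi : i ∈ T <;> by_cases hj : j ∈ T <;> by_cases hi' : i ∈ S <;> simp [*]
  have hdisj : LinearMap.range (mk A S).mulVecLin ⊓ LinearMap.range (mk A T).mulVecLin = ⊥ := by
    rw [eq_bot_iff]
    rintro x ⟨⟨v, hv⟩, ⟨w, hw⟩⟩
    rw [Submodule.mem_bot]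
    ext i
    by_cases hi : i ∈ S
    · rw [← hw]
      simp [Matrix.mulVec, dotProduct, mk, hST i hi]
    · rw [← hv]
      simp [Matrix.mulVec, dotProduct, mk, hi]
  have := Submodule.finrank_sup_add_finrank_inf_eq (LinearMap.range (mk A S).mulVecLin)
    (LinearMap.range (mk A T).mulVecLin)
  rw [hdisj, finrank_bot, ← hr] at this
  simpa [Matrix.rank] using this

/-- pendant elimination -/
lemma rank_mk_pendant (A : Matrix V V ℂ) (S : Set V) (u v : V) (hu : u ∈ S) (hv : v ∈ S)
    (huv : A u v ≠ 0) (hvu : A v u ≠ 0) (hvv : A v v = 0) (hne : u ≠ v)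
    (h1 : ∀ w ∈ S, w ≠ v → A u w = 0) (h2 : ∀ w ∈ S, w ≠ v → A w u = 0) :
    (mk A S).rank = (mk A (S \ {u, v})).rank + 2 := by
  have huu : A u u = 0 := h1 u hu hne
  rw [rank_pivot2 (mk A S) u v (by simpa [mk, hu, hv] using huv)
    (by simpa [mk, hu, hv] using hvu) (by simp [mk, huu]) (by simp [mk, hvv])]
  congr 2
  ext i j
  simp only [mk, Matrix.of_apply, hu, hv, and_true, true_and, Set.mem_sdiff, Set.mem_insert_iff,
    Set.mem_singleton_iff, not_or]
  by_cases hi : i ∈ S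
  swap
  · simp [hi]
  by_cases hj : j ∈ S
  swap
  · simp [hj]
  simp only [hi, hj, if_true, true_and]
  by_cases hiv : i = v
  · subst hiv
    by_cases hju : j = u
    · subst hju
      simp [hvu, huu, hvv, hvu]
    · simp [hvu, hvv]
  · by_cases hjv : j = v
    · subst hjv
      have := h2 i hi hiv
      simp [hiv, huv, hvv, this]
    · have e1 := h2 i hi hiv
      have e2 := h1 j hj hjv
      by_cases hiu : i = u
      · subst hiu; simp [e1, e2]
      · by_cases hju : j = u
        · subst hju; simp [e1, e2]
        · simp [e1, e2, hiv, hjv, hiu, hju]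

end LinAlg


section Contract
variable [DecidableEq V]

/-- the weighted edge matrix -/
noncomputable def ed (x y : V) (w w' : ℂ) : Matrix V V ℂ :=
  Matrix.single x y w + Matrix.single y x w'

lemma ed_apply (x y : V) (w w' : ℂ) (i j : V) :
    ed x y w w' i j = (if x = i ∧ y = j then w else 0) + (if y = i ∧ x = j then w' else 0) := by
  simp [ed, Matrix.single_apply]

/-- the matrix of a walk -/
noncomputable def pm (A : Matrix V V ℂ) {G : SimpleGraph V} : {a b : V} → G.Walk a b → Matrix V V ℂ
  | _, _, .nil => 0
  | _, _, .cons (u := u) (v := v) _ p => ed u v (A u v) (A v u) + pm A p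

noncomputable def hol (A : Matrix V V ℂ) {G : SimpleGraph V} : {a b : V} → G.Walk a b → ℂ
  | _, _, .nil => 1
  | _, _, .cons (u := u) (v := v) _ p => A u v * hol A p

noncomputable def holr (A : Matrix V V ℂ) {G : SimpleGraph V} : {a b : V} → G.Walk a b → ℂ
  | _, _, .nil => 1
  | _, _, .cons (u := u) (v := v) _ p => A v u * holr A p

lemma pm_apply_of_notMem (A : Matrix V V ℂ) {G : SimpleGraph V} {a b : V} (p : G.Walk a b)
    (i j : V) (h : s(i, j) ∉ p.edges) : pm A p i j = 0 := by
  induction p with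
  | nil => simp [pm]
  | cons hh p ih =>
    simp only [SimpleGraph.Walk.edges_cons, List.mem_cons, not_or] at h
    rw [pm, Matrix.add_apply, ih h.2, ed_apply, if_neg, if_neg]
    · simp
    · rintro ⟨rfl, rfl⟩; exact h.1 Sym2.eq_swap
    · rintro ⟨rfl, rfl⟩; exact h.1 rfl

lemma pm_apply_of_mem (A : Matrix V V ℂ) {G : SimpleGraph V} {a b : V} (p : G.Walk a b)
    (hp : p.IsTrail) (i j : V) (h : s(i, j) ∈ p.edges) : pm A p i j = A i j := by
  induction p with
  | nil => simp at h
  | @cons u v w hh p ih =>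
    rw [SimpleGraph.Walk.isTrail_cons] at hp
    have huv : u ≠ v := hh.ne
    rw [pm, Matrix.add_apply, ed_apply]
    rw [SimpleGraph.Walk.edges_cons, List.mem_cons] at h
    by_cases he : s(i, j) = s(u, v)
    · have h0 : pm A p i j = 0 := pm_apply_of_notMem A p i j (by rw [he]; exact hp.2)
      rw [h0]
      rw [Sym2.eq_iff] at he
      rcases he with ⟨rfl, rfl⟩ | ⟨rfl, rfl⟩
      · rw [if_pos ⟨rfl, rfl⟩, if_neg (by rintro ⟨h, -⟩; exact huv h.symm)]; simp
      · rw [if_pos (c := i = i ∧ j = j) ⟨rfl, rfl⟩, if_neg (by rintro ⟨h, -⟩; exact huv h)]; simp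
    · rw [ih hp.1 (h.resolve_left he), if_neg, if_neg]
      · simp
      · rintro ⟨rfl, rfl⟩; exact he Sym2.eq_swap
      · rintro ⟨rfl, rfl⟩; exact he rfl

lemma pm_apply (A : Matrix V V ℂ) {G : SimpleGraph V} {a b : V} (p : G.Walk a b)
    (hp : p.IsTrail) (i j : V) : pm A p i j = if s(i, j) ∈ p.edges then A i j else 0 := by
  split_ifs with h
  · exact pm_apply_of_mem A p hp i j h
  · exact pm_apply_of_notMem A p i j h

variable [Fintype V]

lemma rank_step_aux (P Q R S : Prop) [Decidable P] [Decidable Q] [Decidable R] [Decidable S]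
    (r w0 w0' w1 w1' w2 w2' : ℂ) :
    r - (if P then w0 else 0) * (if Q then w2 else 0) * w1
      - (if R then w2' else 0) * (if S then w0' else 0) * w1' =
    r + ((if P ∧ Q then -(w0 * w1 * w2) else 0) + (if R ∧ S then -(w0' * w1' * w2') else 0)) := by
  by_cases P <;> by_cases Q <;> by_cases R <;> by_cases S <;> simp [*] <;> ring

lemma rank_step (R : Matrix V V ℂ) (x y b c : V) (w0 w0' w1 w1' w2 w2' : ℂ)
    (hbc : b ≠ c) (hxb : x ≠ b) (hxc : x ≠ c) (hyb : y ≠ b) (hyc : y ≠ c) (hw : w1 * w1' = 1)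
    (hb : ∀ j, R b j = 0 ∧ R j b = 0) (hc : ∀ j, R c j = 0 ∧ R j c = 0) :
    (R + ed x b w0 w0' + ed b c w1 w1' + ed c y w2 w2').rank =
      (R + ed x y (-(w0 * w1 * w2)) (-(w0' * w1' * w2'))).rank + 2 := by
  have h1 : w1 ≠ 0 := by rintro rfl; simp at hw
  have h1' : w1' ≠ 0 := by rintro rfl; simp at hw
  set N := R + ed x b w0 w0' + ed b c w1 w1' + ed c y w2 w2' with hN
  have Nib : ∀ i, N i b = if i = x then w0 else if i = c then w1' else 0 := by
    intro i
    simp only [hN, Matrix.add_apply, ed_apply, (hb i).2]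
    by_cases hi : i = x
    · subst hi; simp [hbc, hxb, hxc, hyb, hyc, hbc.symm, hxb.symm, hxc.symm, hyb.symm, hyc.symm]
    · by_cases hi2 : i = c
      · subst hi2; simp [hbc, hxb, hxc, hyb, hyc, hbc.symm, hxb.symm, hxc.symm, hyb.symm, hyc.symm]
      · simp [hi, hi2, Ne.symm hi, Ne.symm hi2, hbc, hxb, hxc, hyb, hyc, hbc.symm, hxb.symm, hxc.symm, hyb.symm, hyc.symm]
  have Nbj : ∀ i, N b i = if i = x then w0' else if i = c then w1 else 0 := by
    intro i
    simp only [hN, Matrix.add_apply, ed_apply, (hb i).1]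
    by_cases hi : i = x
    · subst hi; simp [hbc, hxb, hxc, hyb, hyc, hbc.symm, hxb.symm, hxc.symm, hyb.symm, hyc.symm]
    · by_cases hi2 : i = c
      · subst hi2; simp [hbc, hxb, hxc, hyb, hyc, hbc.symm, hxb.symm, hxc.symm, hyb.symm, hyc.symm]
      · simp [hi, hi2, Ne.symm hi, Ne.symm hi2, hbc, hxb, hxc, hyb, hyc, hbc.symm, hxb.symm, hxc.symm, hyb.symm, hyc.symm]
  have Nic : ∀ i, N i c = if i = y then w2' else if i = b then w1 else 0 := by
    intro i
    simp only [hN, Matrix.add_apply, ed_apply, (hc i).2]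
    by_cases hi : i = y
    · subst hi; simp [hbc, hxb, hxc, hyb, hyc, hbc.symm, hxb.symm, hxc.symm, hyb.symm, hyc.symm]
    · by_cases hi2 : i = b
      · subst hi2; simp [hbc, hxb, hxc, hyb, hyc, hbc.symm, hxb.symm, hxc.symm, hyb.symm, hyc.symm]
      · simp [hi, hi2, Ne.symm hi, Ne.symm hi2, hbc, hxb, hxc, hyb, hyc, hbc.symm, hxb.symm, hxc.symm, hyb.symm, hyc.symm]
  have Ncj : ∀ i, N c i = if i = y then w2 else if i = b then w1' else 0 := by
    intro i
    simp only [hN, Matrix.add_apply, ed_apply, (hc i).1]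
    by_cases hi : i = y
    · subst hi; simp [hbc, hxb, hxc, hyb, hyc, hbc.symm, hxb.symm, hxc.symm, hyb.symm, hyc.symm]
    · by_cases hi2 : i = b
      · subst hi2; simp [hbc, hxb, hxc, hyb, hyc, hbc.symm, hxb.symm, hxc.symm, hyb.symm, hyc.symm]
      · simp [hi, hi2, Ne.symm hi, Ne.symm hi2, hbc, hxb, hxc, hyb, hyc, hbc.symm, hxb.symm, hxc.symm, hyb.symm, hyc.symm]
  have Nbc : N b c = w1 := by rw [Nbj]; simp [hxc.symm]
  have Ncb : N c b = w1' := by rw [Ncj]; simp [hyb.symm]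
  rw [rank_pivot2 N b c (by rw [Nbc]; exact h1) (by rw [Ncb]; exact h1')
    (by rw [Nbj]; simp [hbc, hxb.symm]) (by rw [Ncj]; simp [hbc.symm, hyc.symm])]
  refine congrArg (fun B : Matrix V V ℂ => B.rank + 2) ?_
  have hinv : w1'⁻¹ = w1 := by field_simp; rw [mul_comm]; exact hw.symm
  have hinv' : w1⁻¹ = w1' := by field_simp; exact hw.symm
  ext i j
  rw [Matrix.of_apply, Nbc, Ncb, div_eq_mul_inv, div_eq_mul_inv, hinv, hinv', Nib, Ncj, Nic, Nbj]
  by_cases hib : i = b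
  · subst hib
    rw [Nbj, Matrix.add_apply, (hb j).1, ed_apply]
    simp only [hbc, hxb, hyb, hxb.symm, hyb.symm, if_false, false_and, if_true]
    by_cases hjx : j = x
    · subst hjx; simp; linear_combination -w0' * hw
    · by_cases hjc : j = c
      · subst hjc; simp [hjx]; linear_combination -w1 * hw
      · simp [hjx, hjc]
  by_cases hic : i = c
  · subst hic
    rw [Ncj, Matrix.add_apply, (hc j).1, ed_apply]
    simp only [hbc.symm, hxc, hyc, hxc.symm, hyc.symm, if_false, false_and, if_true]
    by_cases hjx : j = y
    · subst hjx; simp; linear_combination -w2 * hw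
    · by_cases hjc : j = b
      · subst hjc; simp [hjx]; linear_combination -w1' * hw
      · simp [hjx, hjc]
  by_cases hjb : j = b
  · subst hjb
    rw [Nib, Matrix.add_apply, (hb i).2, ed_apply]
    simp only [hib, hic, hbc, hxb, hyb, hxb.symm, hyb.symm, if_false, and_false, if_true]
    by_cases hjx : i = x
    · subst hjx; simp; linear_combination -w0 * hw
    · simp [hjx]
  by_cases hjc : j = c
  · subst hjc
    rw [Nic, Matrix.add_apply, (hc i).2, ed_apply]
    simp only [hib, hic, hbc.symm, hxc, hyc, hxc.symm, hyc.symm, if_false, and_false, if_true]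
    by_cases hjx : i = y
    · subst hjx; simp; linear_combination -w2' * hw
    · simp [hjx]
  have e : N i j = R i j := by
    simp [hN, Matrix.add_apply, ed_apply, hib, hic, hjb, hjc, Ne.symm hib, Ne.symm hic, Ne.symm hjb, Ne.symm hjc]
  rw [e, Matrix.add_apply, ed_apply]
  simp only [hib, hic, hjb, hjc, if_false]
  simp only [@eq_comm _ x, @eq_comm _ y]
  exact rank_step_aux (i = x) (j = y) (i = y) (j = x) _ _ _ _ _ _ _

theorem rank_contract (A : Matrix V V ℂ) (G : SimpleGraph V)
    (hA : ∀ i j, G.Adj i j → A i j * A j i = 1) :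
    ∀ (t : ℕ) {b y : V} (p : G.Walk b y), p.IsPath → p.length = 2 * t → ∀ (x : V)
      (_ : x ∈ p.support → x = y) (w0 w0' : ℂ) (R : Matrix V V ℂ)
      (_ : ∀ v ∈ p.support, v ≠ y → ∀ j, R v j = 0 ∧ R j v = 0),
      (R + ed x b w0 w0' + pm A p).rank =
        (R + ed x y ((-1) ^ t * (w0 * hol A p)) ((-1) ^ t * (w0' * holr A p))).rank + 2 * t := by
  intro t
  induction t with
  | zero =>
    intro b y p hp hl x hx w0 w0' R hR
    cases p with
    | nil => simp [pm, hol, holr]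
    | cons h p => simp at hl
  | succ t ih =>
    intro b y p hp hl x hx w0 w0' R hR
    cases p with
    | nil => simp at hl
    | @cons _ c _ h p =>
      cases p with
      | nil => simp at hl; omega
      | @cons _ d _ h' p' =>
        have hl' : p'.length = 2 * t := by simp at hl; omega
        rw [SimpleGraph.Walk.cons_isPath_iff, SimpleGraph.Walk.cons_isPath_iff] at hp
        obtain ⟨⟨hp', hc⟩, hb⟩ := hp
        simp only [SimpleGraph.Walk.support_cons, List.mem_cons, not_or] at hb hR hx
        have hby : b ≠ y := by rintro rfl; exact hb.2 p'.end_mem_support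
        have hcy : c ≠ y := by rintro rfl; exact hc p'.end_mem_support
        have hbd : b ≠ d := by rintro rfl; exact hb.2 p'.start_mem_support
        have hcd : c ≠ d := by rintro rfl; exact hc p'.start_mem_support
        have hxb : x ≠ b := by
          rintro rfl; exact hby (hx (Or.inl rfl))
        have hxc : x ≠ c := by
          rintro rfl; exact hcy (hx (Or.inr (Or.inl rfl)))
        have hpm : ∀ v, v ∉ p'.support → ∀ j, pm A p' v j = 0 ∧ pm A p' j v = 0 := by
          intro v hv j
          constructor
          · exact pm_apply_of_notMem _ _ _ _ (fun h => hv (p'.fst_mem_support_of_mem_edges h))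
          · exact pm_apply_of_notMem _ _ _ _ (fun h => hv (p'.snd_mem_support_of_mem_edges h))
        have key := rank_step (R + pm A p') x d b c w0 w0' (A b c) (A c b) (A c d) (A d c)
          hb.1 hxb hxc hbd.symm hcd.symm (hA _ _ h)
          (fun j => by
            have h1 := hR b (Or.inl rfl) hby j
            have h2 := hpm b hb.2 j
            simp [Matrix.add_apply, h1, h2])
          (fun j => by
            have h1 := hR c (Or.inr (Or.inl rfl)) hcy j
            have h2 := hpm c hc j
            simp [Matrix.add_apply, h1, h2])
        have e1 : R + ed x b w0 w0' + pm A (SimpleGraph.Walk.cons h (SimpleGraph.Walk.cons h' p'))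
            = R + pm A p' + ed x b w0 w0' + ed b c (A b c) (A c b) + ed c d (A c d) (A d c) := by
          simp only [pm]; abel
        have e2 : R + pm A p' + ed x d (-(w0 * A b c * A c d)) (-(w0' * A c b * A d c)) =
            R + ed x d (-(w0 * A b c * A c d)) (-(w0' * A c b * A d c)) + pm A p' := by abel
        rw [e1, key, e2, ih p' hp' hl' x (fun h => hx (Or.inr (Or.inr h))) _ _ R
          (fun v hv => hR v (Or.inr (Or.inr hv)))]
        have e3 : (-1 : ℂ) ^ t * (-(w0 * A b c * A c d) * hol A p') = (-1) ^ (t + 1) *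
            (w0 * hol A (SimpleGraph.Walk.cons h (SimpleGraph.Walk.cons h' p'))) := by
          simp only [hol]; ring
        have e4 : (-1 : ℂ) ^ t * (-(w0' * A c b * A d c) * holr A p') = (-1) ^ (t + 1) *
            (w0' * holr A (SimpleGraph.Walk.cons h (SimpleGraph.Walk.cons h' p'))) := by
          simp only [holr]; ring
        rw [e3, e4]
        ring
end Contract


section Cyc
open SimpleGraph

structure IsCyc (Z : SimpleGraph V) : Prop where
  edge : ∃ a b, Z.Adj a b
  conn : ∀ a b, a ∈ Z.support → b ∈ Z.support → Z.Reachable a b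
  two : Z.IsCycles

lemma mem_supp_l {Z : SimpleGraph V} {a b : V} (h : Z.Adj a b) : a ∈ Z.support := ⟨b, h⟩
lemma mem_supp_r {Z : SimpleGraph V} {a b : V} (h : Z.Adj a b) : b ∈ Z.support := ⟨a, h.symm⟩

lemma reach_ind {Z : SimpleGraph V} (P : V → Prop) (h : ∀ x y, Z.Adj x y → P x → P y)
    {a b : V} (hab : Z.Reachable a b) (ha : P a) : P b := by
  obtain ⟨w⟩ := hab
  induction w with
  | nil => exact ha
  | cons hh p ih => exact ih (h _ _ hh ha)

lemma IsCyc.ind {Z : SimpleGraph V} (hZ : IsCyc Z) (P : V → Prop)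
    (h : ∀ x y, Z.Adj x y → P x → P y) {a : V} (ha : a ∈ Z.support) (hP : P a) :
    ∀ b ∈ Z.support, P b := fun b hb => reach_ind P h (hZ.conn a b ha hb) hP

lemma IsCyc.nbrs {Z : SimpleGraph V} (hZ : IsCyc Z) {v w : V} (h : Z.Adj v w) :
    ∃ w', w' ≠ w ∧ Z.Adj v w' ∧ ∀ y, Z.Adj v y → y = w ∨ y = w' := by
  obtain ⟨w', ⟨h1, h2⟩, h3⟩ := hZ.two.existsUnique_ne_adj h
  refine ⟨w', h1.symm, h2, fun y hy => ?_⟩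
  by_cases hyw : y = w
  · exact Or.inl hyw
  · exact Or.inr (h3 y ⟨fun h => hyw h.symm, hy⟩)

lemma IsCyc.ncard_nbr {Z : SimpleGraph V} (hZ : IsCyc Z) {v : V} (h : v ∈ Z.support) :
    (Z.neighborSet v).ncard = 2 := hZ.two h

lemma cyc_le_eq {Z Z' : SimpleGraph V} (hZ : IsCyc Z) (hZ' : IsCyc Z') (h : Z ≤ Z') : Z = Z' := by
  have key : ∀ v ∈ Z.support, ∀ w, Z'.Adj v w → Z.Adj v w := by
    intro v hv w hw
    have h1 := hZ.ncard_nbr hv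
    have h2 := hZ'.ncard_nbr (mem_supp_l hw)
    have h3 : Z.neighborSet v ⊆ Z'.neighborSet v := fun x hx => h hx
    have := Set.eq_of_subset_of_ncard_le h3 (by rw [h1, h2]) (Set.finite_of_ncard_ne_zero (by rw [h2]; simp))
    have hw' : w ∈ Z'.neighborSet v := hw
    rw [← this] at hw'
    exact hw'
  obtain ⟨a, b, hab⟩ := hZ.edge
  have hs := hZ'.ind (fun v => v ∈ Z.support) (fun x y hxy hx => mem_supp_r (key x hx y hxy))
    (mem_supp_l (h hab)) (mem_supp_l hab)
  ext x y
  exact ⟨fun hxy => h hxy, fun hxy => key x (hs x (mem_supp_l hxy)) y hxy⟩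

/-- graph of the edges of a walk -/
def wg {G : SimpleGraph V} {a b : V} (w : G.Walk a b) : SimpleGraph V := w.toSubgraph.spanningCoe

lemma wg_adj {G : SimpleGraph V} {a b : V} (w : G.Walk a b) (x y : V) :
    (wg w).Adj x y ↔ s(x, y) ∈ w.edges := by
  simp [wg, Walk.adj_toSubgraph_iff_mem_edges]

lemma wg_le {G : SimpleGraph V} {a b : V} (w : G.Walk a b) : wg w ≤ G := by
  intro x y h
  rw [wg_adj] at h
  exact w.adj_of_mem_edges h

lemma wg_supp_sub {G : SimpleGraph V} {a b : V} (w : G.Walk a b) {x : V} (h : x ∈ (wg w).support) :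
    x ∈ w.support := by
  obtain ⟨y, h⟩ := h
  replace h := (wg_adj _ _ _).1 h
  exact w.fst_mem_support_of_mem_edges h

lemma wg_supp {G : SimpleGraph V} {a b : V} (w : G.Walk a b) (hn : ¬ w.Nil) (x : V) :
    x ∈ (wg w).support ↔ x ∈ w.support := by
  refine ⟨wg_supp_sub w, fun h => ?_⟩
  rw [Walk.mem_support_iff_exists_mem_edges] at h
  rcases h with rfl | ⟨e, he, hx⟩
  · refine ⟨w.penultimate, (wg_adj _ _ _).2 ?_⟩
    rw [Sym2.eq_swap]
    exact w.mk_penultimate_end_mem_edges hn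
  · obtain ⟨y, rfl⟩ := hx
    exact ⟨y, (wg_adj _ _ _).2 he⟩

lemma reach_of_sub {G Z : SimpleGraph V} {a b : V} (w : G.Walk a b)
    (h : ∀ x y, s(x, y) ∈ w.edges → Z.Adj x y) : Z.Reachable a b := by
  induction w with
  | nil => rfl
  | cons hh p ih =>
    refine (Adj.reachable (h _ _ ?_)).trans (ih fun x y hxy => h x y ?_)
    · simp
    · simp [hxy]

lemma wg_reach {G : SimpleGraph V} {a b : V} (w : G.Walk a b) : (wg w).Reachable a b :=
  reach_of_sub w fun x y h => (wg_adj _ _ _).2 h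

lemma wg_reach_of_mem {G : SimpleGraph V} {a b c : V} (w : G.Walk a b) (h : c ∈ w.support) :
    (wg w).Reachable a c := 
  reach_of_sub (w.takeUntil c h) fun x y hh => (wg_adj _ _ _).2 (w.edges_takeUntil_subset h hh)

lemma isCyc_wg {G : SimpleGraph V} {a : V} (w : G.Walk a a) (hw : w.IsCycle) : IsCyc (wg w) := by
  refine ⟨?_, fun x y hx hy => ?_, hw.isCycles_spanningCoe_toSubgraph⟩
  · cases w with
    | nil => simp at hw
    | cons h p => exact ⟨a, _, (wg_adj _ _ _).2 (by rw [Walk.edges_cons]; exact List.mem_cons_self)⟩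
  · exact (wg_reach_of_mem w (wg_supp_sub w hx)).symm.trans (wg_reach_of_mem w (wg_supp_sub w hy))

lemma exists_cyc_of_reach {H : SimpleGraph V} {a b : V} (hab : H.Adj a b)
    (hr : (H.deleteEdges {s(a, b)}).Reachable a b) : ∃ Z, IsCyc Z ∧ Z ≤ H ∧ Z.Adj a b := by
  obtain ⟨u, p, hp, he⟩ := adj_and_reachable_delete_edges_iff_exists_cycle.1 ⟨hab, hr⟩
  exact ⟨wg p, isCyc_wg p hp, wg_le p, (wg_adj _ _ _).2 he⟩

lemma deleteEdges_mono' {H K : SimpleGraph V} (h : H ≤ K) (s : Set (Sym2 V)) :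
    H.deleteEdges s ≤ K.deleteEdges s := by
  intro x y hxy
  rw [deleteEdges_adj] at hxy ⊢
  exact ⟨h hxy.1, hxy.2⟩

lemma IsCyc.reach_del [Finite V] {Z : SimpleGraph V} (hZ : IsCyc Z) {a b : V} (h : Z.Adj a b) :
    (Z.deleteEdges {s(a, b)}).Reachable a b := hZ.two.reachable_deleteEdges h

lemma IsCyc.exists_walk [Finite V] {Z : SimpleGraph V} (hZ : IsCyc Z) {u : V} (hu : u ∈ Z.support) :
    ∃ w : Z.Walk u u, w.IsCycle ∧ wg w = Z := by
  obtain ⟨v, huv⟩ := hu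
  obtain ⟨c, p, hp, he⟩ := adj_and_reachable_delete_edges_iff_exists_cycle.1 ⟨huv, hZ.reach_del huv⟩
  have hm : u ∈ p.support := p.fst_mem_support_of_mem_edges he
  refine ⟨p.rotate u hm, hp.rotate hm, ?_⟩
  exact cyc_le_eq (isCyc_wg _ (hp.rotate hm)) hZ (wg_le _)

lemma IsCyc.exists_walk' [Finite V] {Z G : SimpleGraph V} (hZ : IsCyc Z) (hle : Z ≤ G) {u : V}
    (hu : u ∈ Z.support) :
    ∃ w : G.Walk u u, w.IsCycle ∧ wg w = Z := by
  obtain ⟨w, hw, e⟩ := hZ.exists_walk hu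
  refine ⟨w.mapLe hle, (Walk.mapLe_isCycle hle).2 hw, ?_⟩
  refine Eq.trans ?_ e
  ext x y
  rw [wg_adj, wg_adj, Walk.edges_mapLe_eq_edges]

lemma cycle_ncard {G : SimpleGraph V} {a : V} (w : G.Walk a a) (hw : w.IsCycle) :
    (wg w).support.ncard = w.length := by
  have h1 : (wg w).support = (w.support.tail.toFinset : Set V) := by
    ext x
    rw [wg_supp w hw.not_nil]
    simp only [List.coe_toFinset, Set.mem_setOf_eq]
    constructor
    · intro h
      rw [Walk.mem_support_iff] at h
      rcases h with rfl | h
      · exact w.end_mem_tail_support hw.not_nil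
      · exact h
    · exact List.mem_of_mem_tail
  rw [h1, Set.ncard_coe_finset, List.toFinset_card_of_nodup hw.support_nodup]
  simp

lemma cyc_card_pos [Finite V] {Z : SimpleGraph V} (hZ : IsCyc Z) : 3 ≤ Z.support.ncard := by
  obtain ⟨a, b, h⟩ := hZ.edge
  obtain ⟨w, hw, e⟩ := hZ.exists_walk (mem_supp_l h)
  rw [← e, cycle_ncard w hw]
  exact hw.three_le_length

end Cyc


section Cyc
open SimpleGraph

/-- restriction of a graph to a set -/
def rs (G : SimpleGraph V) (S : Set V) : SimpleGraph V where
  Adj a b := G.Adj a b ∧ a ∈ S ∧ b ∈ S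
  symm := ⟨fun a b h => ⟨h.1.symm, h.2.2, h.2.1⟩⟩
  loopless := ⟨fun a h => G.loopless.irrefl a h.1⟩

lemma rs_le (G : SimpleGraph V) (S : Set V) : rs G S ≤ G := fun _ _ h => h.1
lemma rs_mono (G : SimpleGraph V) {S T : Set V} (h : S ⊆ T) : rs G S ≤ rs G T :=
  fun _ _ hh => ⟨hh.1, h hh.2.1, h hh.2.2⟩
lemma rs_mono_left {G H : SimpleGraph V} (h : G ≤ H) (S : Set V) : rs G S ≤ rs H S :=
  fun _ _ hh => ⟨h hh.1, hh.2⟩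
lemma rs_univ (G : SimpleGraph V) : rs G Set.univ = G := by ext; simp [rs]
lemma rs_supp (G : SimpleGraph V) (S : Set V) {v : V} (h : v ∈ (rs G S).support) : v ∈ S := by
  obtain ⟨y, h⟩ := h; exact h.2.1

lemma le_rs {Z G : SimpleGraph V} {S : Set V} (h : Z ≤ G) (hs : Z.support ⊆ S) : Z ≤ rs G S :=
  fun _ _ hh => ⟨h hh, hs (mem_supp_l hh), hs (mem_supp_r hh)⟩

lemma supp_mono {Z G : SimpleGraph V} (h : Z ≤ G) : Z.support ⊆ G.support :=
  fun _ ⟨y, hy⟩ => ⟨y, h hy⟩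

lemma supp_of_le_rs {Z G : SimpleGraph V} {S : Set V} (h : Z ≤ rs G S) : Z.support ⊆ S :=
  fun _ hv => rs_supp G S (supp_mono h hv)

/-- number of even cycles -/
noncomputable def kp (H : SimpleGraph V) : ℕ :=
  {Z : SimpleGraph V | IsCyc Z ∧ Z ≤ H ∧ Even Z.support.ncard}.ncard

/-- even cycle in H -/
def EC (H Z : SimpleGraph V) : Prop := IsCyc Z ∧ Z ≤ H ∧ Even Z.support.ncard
def OC (H Z : SimpleGraph V) : Prop := IsCyc Z ∧ Z ≤ H ∧ Odd Z.support.ncard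

/-- a subgraph from a smaller graph -/
def sgOf {G : SimpleGraph V} (Z : SimpleGraph V) (h : Z ≤ G) : G.Subgraph where
  verts := Z.support
  Adj := Z.Adj
  adj_sub := fun hh => h hh
  edge_vert := fun hh => mem_supp_l hh
  symm := ⟨fun a b h => h.symm⟩

lemma isCyc_of_sub {G : SimpleGraph V} {C : G.Subgraph} (h : IsCycleSubgraph C) :
    IsCyc C.spanningCoe ∧ C.spanningCoe.support = C.verts := by
  have hs : C.spanningCoe.support = C.verts := by
    ext v
    constructor
    · rintro ⟨w, hw⟩; exact C.edge_vert hw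
    · intro hv
      have := h.2 v hv
      obtain ⟨w, hw⟩ := Set.nonempty_of_ncard_ne_zero (s := {w | C.Adj v w}) (by omega)
      exact ⟨w, hw⟩
  refine ⟨⟨?_, ?_, ?_⟩, hs⟩
  · obtain ⟨v, hv⟩ := h.1.nonempty
    have hv' : v ∈ C.spanningCoe.support := hs ▸ hv
    obtain ⟨w, hw⟩ := hv'
    exact ⟨v, w, hw⟩
  · intro a b ha hb
    rw [hs] at ha hb
    have := h.1.coe.preconnected ⟨a, ha⟩ ⟨b, hb⟩
    exact this.map (⟨Subtype.val, fun {x y} hxy => hxy⟩ : C.coe →g C.spanningCoe)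
  · intro v hv
    obtain ⟨w, hw⟩ := hv
    exact h.2 v (C.edge_vert hw)

lemma sub_of_isCyc {G Z : SimpleGraph V} (h : IsCyc Z) (hle : Z ≤ G) :
    IsCycleSubgraph (sgOf Z hle) := by
  refine ⟨?_, fun v hv => h.two hv⟩
  · have := h.edge
    obtain ⟨a, b, hab⟩ := this
    haveI : Nonempty (sgOf Z hle).verts := ⟨⟨a, mem_supp_l hab⟩⟩
    refine ⟨?_⟩
    refine { preconnected := fun x y => ?_, nonempty := this }
    have key := reach_ind (Z := Z) (fun z => ∃ hz : z ∈ (sgOf Z hle).verts, (sgOf Z hle).coe.Reachable x ⟨z, hz⟩)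
      (by
        rintro u v huv ⟨hu, hr⟩
        refine ⟨mem_supp_r huv, hr.trans (Adj.reachable ?_)⟩
        exact huv) (h.conn x.1 y.1 x.2 y.2) ⟨x.2, Reachable.refl _⟩
    exact key.2

lemma sgOf_spanningCoe {G : SimpleGraph V} {C : G.Subgraph} (h : IsCycleSubgraph C) :
    sgOf C.spanningCoe (Subgraph.spanningCoe_le C) = C := by
  apply Subgraph.ext
  · exact (isCyc_of_sub h).2
  · rfl

lemma spanningCoe_sgOf {G Z : SimpleGraph V} (hle : Z ≤ G) : (sgOf Z hle).spanningCoe = Z := by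
  ext; rfl

lemma evenCycleCount_eq (G : SimpleGraph V) : evenCycleCount G = kp G := by
  unfold evenCycleCount kp
  refine Set.ncard_congr (fun C _ => C.spanningCoe) ?_ ?_ ?_
  · rintro C ⟨h, h'⟩
    refine ⟨(isCyc_of_sub h).1, Subgraph.spanningCoe_le C, ?_⟩
    rw [(isCyc_of_sub h).2]; exact h'
  · rintro C C' ⟨h, _⟩ ⟨h', _⟩ he
    rw [← sgOf_spanningCoe h, ← sgOf_spanningCoe h']
    simp only [he]
  · rintro Z ⟨h, hle, he⟩
    exact ⟨sgOf Z hle, ⟨sub_of_isCyc h hle, he⟩, spanningCoe_sgOf hle⟩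

/-- even cycles pairwise disjoint -/
def DE (H : SimpleGraph V) : Prop :=
  ∀ Z Z', EC H Z → EC H Z' → Z ≠ Z' → Disjoint Z.support Z'.support

lemma evenDisj_iff (G : SimpleGraph V) : EvenCyclesVertexDisjoint G ↔ DE G := by
  constructor
  · rintro h Z Z' ⟨h1, h2, h3⟩ ⟨h1', h2', h3'⟩ hne
    refine h (sgOf Z h2) (sgOf Z' h2') (sub_of_isCyc h1 h2) (sub_of_isCyc h1' h2') h3 h3' ?_
    intro he
    exact hne (by rw [← spanningCoe_sgOf h2, ← spanningCoe_sgOf h2', he])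
  · intro h C C' h1 h1' h3 h3' hne
    have e := isCyc_of_sub h1
    have e' := isCyc_of_sub h1'
    rw [← e.2, ← e'.2]
    refine h _ _ ⟨e.1, Subgraph.spanningCoe_le C, e.2 ▸ h3⟩ ⟨e'.1, Subgraph.spanningCoe_le C', e'.2 ▸ h3'⟩ ?_
    intro he
    apply hne
    rw [← sgOf_spanningCoe h1, ← sgOf_spanningCoe h1']
    simp only [he]

lemma DE.mono {H K : SimpleGraph V} (h : DE K) (hle : H ≤ K) : DE H :=
  fun Z Z' hZ hZ' hne => h Z Z' ⟨hZ.1, hZ.2.1.trans hle, hZ.2.2⟩ ⟨hZ'.1, hZ'.2.1.trans hle, hZ'.2.2⟩ hne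

section Transfer
variable {W : Type*} (φ : W ↪ V)

lemma map_supp (Z : SimpleGraph W) : (Z.map φ).support = φ '' Z.support := support_map φ Z

lemma map_nbr (Z : SimpleGraph W) (w : W) : (Z.map φ).neighborSet (φ w) = φ '' Z.neighborSet w := by
  ext x
  simp only [mem_neighborSet, map_adj, Set.mem_image]
  constructor
  · rintro ⟨a, b, h, h1, rfl⟩
    exact ⟨b, φ.injective h1 ▸ h, rfl⟩
  · rintro ⟨b, h, rfl⟩; exact ⟨w, b, h, rfl, rfl⟩

lemma isCyc_map {Z : SimpleGraph W} : IsCyc (Z.map φ) ↔ IsCyc Z := by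
  constructor
  · intro h
    refine ⟨?_, ?_, ?_⟩
    · obtain ⟨a, b, hab⟩ := h.edge
      rw [map_adj] at hab
      obtain ⟨a, b, hab, _⟩ := hab
      exact ⟨a, b, hab⟩
    · intro a b ha hb
      have hr := h.conn (φ a) (φ b) (by rw [map_supp]; exact ⟨a, ha, rfl⟩) (by rw [map_supp]; exact ⟨b, hb, rfl⟩)
      have := reach_ind (fun z => ∃ c, φ c = z ∧ Z.Reachable a c) (by
        rintro x y hxy ⟨c, rfl, hc⟩
        rw [map_adj] at hxy
        obtain ⟨c', d, hcd, h1, rfl⟩ := hxy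
        rw [φ.injective h1] at hcd
        exact ⟨d, rfl, hc.trans hcd.reachable⟩) hr ⟨a, rfl, Reachable.refl _⟩
      obtain ⟨c, hc, hr⟩ := this
      rwa [φ.injective hc] at hr
    · intro v hv
      have := h.two (v := φ v) (by rw [map_nbr]; exact hv.image _)
      rwa [map_nbr, Set.ncard_image_of_injective _ φ.injective] at this
  · intro h
    refine ⟨?_, ?_, ?_⟩
    · obtain ⟨a, b, hab⟩ := h.edge
      exact ⟨φ a, φ b, map_adj_apply.2 hab⟩
    · intro a b ha hb
      rw [map_supp] at ha hb
      obtain ⟨a, ha, rfl⟩ := ha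
      obtain ⟨b, hb, rfl⟩ := hb
      exact (h.conn a b ha hb).map (⟨φ, fun {x y} hxy => map_adj_apply.2 hxy⟩ : Z →g Z.map φ)
    · rintro v ⟨w, hw⟩
      rw [mem_neighborSet, map_adj] at hw
      obtain ⟨a, b, hab, rfl, rfl⟩ := hw
      rw [map_nbr, Set.ncard_image_of_injective _ φ.injective]
      exact h.two ⟨b, hab⟩

lemma map_ncard (Z : SimpleGraph W) : (Z.map φ).support.ncard = Z.support.ncard := by
  rw [map_supp, Set.ncard_image_of_injective _ φ.injective]

lemma map_le_rs {Z : SimpleGraph W} {G : SimpleGraph V} :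
    Z.map φ ≤ rs G (Set.range φ) ↔ Z ≤ G.comap φ := by
  constructor
  · intro h a b hab
    exact (h (map_adj_apply.2 hab : (Z.map φ).Adj (φ a) (φ b))).1
  · intro h a b hab
    rw [map_adj] at hab
    obtain ⟨a, b, hab, rfl, rfl⟩ := hab
    exact ⟨h hab, ⟨a, rfl⟩, ⟨b, rfl⟩⟩

lemma map_comap_of_le {Z G : SimpleGraph V} (h : Z ≤ rs G (Set.range φ)) :
    (Z.comap φ).map φ = Z := by
  ext a b
  rw [map_adj]
  constructor
  · rintro ⟨a, b, hab, rfl, rfl⟩; exact hab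
  · intro hab
    obtain ⟨_, ⟨a, rfl⟩, ⟨b, rfl⟩⟩ := h hab
    exact ⟨a, b, hab, rfl, rfl⟩

lemma EC_map {Z : SimpleGraph W} {G : SimpleGraph V} :
    EC (rs G (Set.range φ)) (Z.map φ) ↔ EC (G.comap φ) Z := by
  unfold EC; rw [isCyc_map, map_le_rs, map_ncard]

lemma OC_map {Z : SimpleGraph W} {G : SimpleGraph V} :
    OC (rs G (Set.range φ)) (Z.map φ) ↔ OC (G.comap φ) Z := by
  unfold OC; rw [isCyc_map, map_le_rs, map_ncard]

lemma kp_transfer (G : SimpleGraph V) : kp (G.comap φ) = kp (rs G (Set.range φ)) := by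
  unfold kp
  refine Set.ncard_congr (fun Z _ => Z.map φ) ?_ ?_ ?_
  · intro Z h; exact (EC_map φ).2 h
  · intro Z Z' _ _ h
    rw [← comap_map_eq φ Z, ← comap_map_eq φ Z']
    exact congrArg _ h
  · intro Z h
    refine ⟨Z.comap φ, ?_, map_comap_of_le φ h.2.1⟩
    apply (EC_map φ).1
    rw [map_comap_of_le φ h.2.1]; exact h

lemma DE_transfer {G : SimpleGraph V} (h : DE G) : DE (G.comap φ) := by
  intro Z Z' hZ hZ' hne
  have := (h.mono (rs_le G (Set.range φ))) _ _ ((EC_map φ).2 hZ) ((EC_map φ).2 hZ') (by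
    intro he
    exact hne (by rw [← comap_map_eq φ Z, ← comap_map_eq φ Z']; exact congrArg _ he))
  rw [map_supp, map_supp, Set.disjoint_image_iff φ.injective] at this
  exact this

end Transfer

/-- matchable sets -/
def Mt (H : SimpleGraph V) (T : Set V) : Prop :=
  ∃ f : V → V, ∀ v ∈ T, f v ∈ T ∧ H.Adj v (f v) ∧ f (f v) = v

lemma Mt.mono {H K : SimpleGraph V} {T : Set V} (h : Mt H T) (hle : H ≤ K) : Mt K T := by
  obtain ⟨f, hf⟩ := h
  exact ⟨f, fun v hv => ⟨(hf v hv).1, hle (hf v hv).2.1, (hf v hv).2.2⟩⟩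

lemma Mt.rs {H : SimpleGraph V} {T S : Set V} (h : Mt H T) (hs : T ⊆ S) : Mt (rs H S) T := by
  obtain ⟨f, hf⟩ := h
  exact ⟨f, fun v hv => ⟨(hf v hv).1, ⟨(hf v hv).2.1, hs hv, hs (hf v hv).1⟩, (hf v hv).2.2⟩⟩

lemma Mt.sub {H : SimpleGraph V} {T S : Set V} (h : Mt (MixedPaper.rs H S) T) : T ⊆ S := by
  obtain ⟨f, hf⟩ := h
  exact fun v hv => (hf v hv).2.1.2.1

lemma Mt.union {H : SimpleGraph V} {T S : Set V} (h : Mt H T) (h' : Mt H S) (hd : Disjoint T S) :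
    Mt H (T ∪ S) := by
  obtain ⟨f, hf⟩ := h
  obtain ⟨g, hg⟩ := h'
  refine ⟨fun v => if v ∈ T then f v else g v, ?_⟩
  rintro v (hv | hv)
  · have := hf v hv
    simp [hv, this.1, this.2.1, this.2.2]
  · have h1 : v ∉ T := fun h => Set.disjoint_left.1 hd h hv
    have := hg v hv
    have h2 : g v ∉ T := fun h => Set.disjoint_left.1 hd h this.1
    simp [h1, h2, this.1, this.2.1, this.2.2]

lemma mt_empty (H : SimpleGraph V) : Mt H ∅ := ⟨id, by simp⟩

lemma mt_edge {H : SimpleGraph V} {a b : V} (h : H.Adj a b) : Mt H {a, b} := by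
  refine ⟨fun v => if v = a then b else a, ?_⟩
  have := h.ne
  rintro v (rfl | rfl)
  · simp [h, this.symm]
  · simp [this.symm, h.symm]

section M
variable [Fintype V]

lemma matching_card {H : SimpleGraph V} (N : H.Subgraph) (hN : N.IsMatching) :
    N.verts.ncard = 2 * N.edgeSet.ncard := by
  have h := N.spanningCoe.sum_degrees_eq_twice_card_edges
  have h2 : ∀ v, N.spanningCoe.degree v = if v ∈ N.verts then 1 else 0 := by
    intro v
    split_ifs with hv
    · obtain ⟨w, hw, hu⟩ := hN hv
      rw [← card_neighborSet_eq_degree, Fintype.card_eq_one_iff]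
      exact ⟨⟨w, hw⟩, fun ⟨y, hy⟩ => Subtype.ext (hu y hy)⟩
    · rw [← card_neighborSet_eq_degree, Fintype.card_eq_zero_iff]
      exact ⟨fun ⟨y, hy⟩ => hv (N.edge_vert hy)⟩
  rw [Finset.sum_congr rfl (fun v _ => h2 v), Finset.sum_boole] at h
  rw [← Subgraph.edgeSet_spanningCoe, Set.ncard_eq_toFinset_card', Set.ncard_eq_toFinset_card']
  simp only [Nat.cast_id] at h
  convert h using 2
  · ext; simp
  · congr 1

lemma mt_iff_matching {H : SimpleGraph V} {T : Set V} :
    Mt H T ↔ ∃ N : H.Subgraph, N.IsMatching ∧ N.verts = T := by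
  constructor
  · rintro ⟨f, hf⟩
    refine ⟨⟨T, fun a b => a ∈ T ∧ b = f a, ?_, fun h => h.1, ⟨?_⟩⟩, ?_, rfl⟩
    · rintro a b ⟨ha, rfl⟩; exact (hf a ha).2.1
    · rintro a b ⟨ha, rfl⟩; exact ⟨(hf a ha).1, (hf a ha).2.2.symm⟩
    · intro v hv
      exact ⟨f v, ⟨hv, rfl⟩, fun y hy => hy.2⟩
  · rintro ⟨N, hN, rfl⟩
    choose! f hf hu using hN
    refine ⟨f, fun v hv => ?_⟩
    have h1 := hf hv
    have h2 := N.edge_vert h1.symm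
    exact ⟨h2, N.adj_sub h1, (hu h2 _ h1.symm).symm⟩

lemma mnum_bdd (H : SimpleGraph V) :
    BddAbove {k | ∃ N : H.Subgraph, N.IsMatching ∧ N.edgeSet.ncard = k} := by
  refine ⟨Fintype.card V, ?_⟩
  rintro k ⟨N, hN, rfl⟩
  have := matching_card N hN
  have h2 : N.verts.ncard ≤ Fintype.card V := by
    rw [← Nat.card_eq_fintype_card]; exact Set.ncard_le_card _
  omega

lemma mnum_ge {H : SimpleGraph V} {T : Set V} (h : Mt H T) : T.ncard ≤ 2 * matchingNumber H := by
  obtain ⟨N, hN, rfl⟩ := mt_iff_matching.1 h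
  rw [matching_card N hN]
  have := le_csSup (mnum_bdd H) ⟨N, hN, rfl⟩
  unfold matchingNumber
  omega

lemma mnum_ex (H : SimpleGraph V) : ∃ T, Mt H T ∧ T.ncard = 2 * matchingNumber H := by
  have : matchingNumber H ∈ {k | ∃ N : H.Subgraph, N.IsMatching ∧ N.edgeSet.ncard = k} := by
    refine Nat.sSup_mem ⟨0, ⊥, ?_, ?_⟩ (mnum_bdd H)
    · intro v hv; simp at hv
    · simp
  obtain ⟨N, hN, he⟩ := this
  exact ⟨N.verts, mt_iff_matching.2 ⟨N, hN, rfl⟩, by rw [matching_card N hN, he]⟩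

lemma mt_even {H : SimpleGraph V} {T : Set V} (h : Mt H T) : Even T.ncard := by
  obtain ⟨N, hN, rfl⟩ := mt_iff_matching.1 h
  rw [matching_card N hN]; simp

lemma mnum_transfer {W : Type*} [Fintype W] (φ : W ↪ V) (G : SimpleGraph V) :
    matchingNumber (G.comap φ) = matchingNumber (rs G (Set.range φ)) := by
  apply le_antisymm
  · obtain ⟨T, ⟨f, hf⟩, hT⟩ := mnum_ex (G.comap φ)
    have : Mt (rs G (Set.range φ)) (φ '' T) := by
      refine ⟨fun v => if h : ∃ w, φ w = v then φ (f h.choose) else v, ?_⟩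
      rintro _ ⟨w, hw, rfl⟩
      have key : ∀ w', (if h : ∃ x, φ x = φ w' then φ (f h.choose) else φ w') = φ (f w') := by
        intro w'
        have h : ∃ x, φ x = φ w' := ⟨w', rfl⟩
        rw [dif_pos h, φ.injective h.choose_spec]
      have := hf w hw
      simp only [key]
      exact ⟨⟨_, this.1, rfl⟩, ⟨this.2.1, ⟨_, rfl⟩, ⟨_, rfl⟩⟩, by rw [this.2.2]⟩
    have h2 := mnum_ge this
    rw [Set.ncard_image_of_injective _ φ.injective] at h2
    omega
  · obtain ⟨T, hMt, hT⟩ := mnum_ex (rs G (Set.range φ))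
    have hs := hMt.sub
    obtain ⟨f, hf⟩ := hMt
    have : Mt (G.comap φ) (φ ⁻¹' T) := by
      refine ⟨fun w => if h : ∃ x, φ x = f (φ w) then h.choose else w, ?_⟩
      intro w hw
      have h1 := hf _ hw
      have hx : ∃ x, φ x = f (φ w) := hs h1.1
      have h2 : φ hx.choose = f (φ w) := hx.choose_spec
      have hy : ∃ x, φ x = f (φ hx.choose) := ⟨w, by rw [h2, h1.2.2]⟩
      beta_reduce
      rw [dif_pos hx, dif_pos hy]
      refine ⟨by rw [Set.mem_preimage, h2]; exact h1.1, ?_, ?_⟩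
      · rw [comap_adj, h2]; exact h1.2.1.1
      · apply φ.injective
        rw [hy.choose_spec, h2, h1.2.2]
    have h2 := mnum_ge this
    rw [Set.ncard_preimage_of_injective_subset_range φ.injective hs] at h2
    omega
end M

end Cyc


section Bd
open SimpleGraph

lemma two_pm {G : SimpleGraph V} [Fintype V] (f g : V → V) (hf : ∀ v, G.Adj v (f v) ∧ f (f v) = v)
    (hg : ∀ v, G.Adj v (g v) ∧ g (g v) = v) {v : V} (hv : f v ≠ g v) : ∃ Z, EC G Z := by
  let D : SimpleGraph V :=
    { Adj := fun a b => f a ≠ g a ∧ (b = f a ∨ b = g a)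
      symm := ⟨by
        rintro a b ⟨h, rfl | rfl⟩
        · refine ⟨fun hh => h ?_, Or.inl (hf a).2.symm⟩
          rw [(hf a).2] at hh
          have := congrArg g hh
          rw [(hg _).2] at this
          exact this.symm
        · refine ⟨fun hh => h ?_, Or.inr (hg a).2.symm⟩
          rw [(hg a).2] at hh
          have := congrArg f hh
          rw [(hf _).2] at this
          exact this.symm⟩
      loopless := ⟨by
        rintro a ⟨h, h' | h'⟩
        · exact (hf a).1.ne h'
        · exact (hg a).1.ne h'⟩ }
  have hD : D ≤ G := by
    rintro a b ⟨h, rfl | rfl⟩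
    · exact (hf a).1
    · exact (hg a).1
  let R : Set V := {x | D.Reachable v x}
  have hR : ∀ x ∈ R, f x ≠ g x := by
    intro x hx
    refine reach_ind (fun x => f x ≠ g x) (fun a b (hab : D.Adj a b) _ => (D.adj_symm hab).1) hx hv
  have hcl : ∀ x ∈ R, ∀ y, D.Adj x y → y ∈ R := fun x hx y hxy => hx.trans hxy.reachable
  let Z := rs D R
  have hadj : ∀ x ∈ R, ∀ y, Z.Adj x y ↔ y = f x ∨ y = g x := by
    intro x hx y
    constructor
    · intro h; exact h.1.2
    · intro h
      have : D.Adj x y := ⟨hR x hx, h⟩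
      exact ⟨this, hx, hcl x hx y this⟩
  have hsupp : Z.support = R := by
    ext x
    constructor
    · intro h; exact rs_supp _ _ h
    · intro hx; exact ⟨f x, (hadj x hx _).2 (Or.inl rfl)⟩
  refine ⟨Z, ⟨?_, ?_, ?_⟩, (rs_le _ _).trans hD, ?_⟩
  · exact ⟨v, f v, (hadj v (Reachable.refl _) _).2 (Or.inl rfl)⟩
  · rw [hsupp]
    have key : ∀ a ∈ R, Z.Reachable v a := by
      intro a ha
      have : a ∈ R ∧ Z.Reachable v a := by
        refine reach_ind (fun a => a ∈ R ∧ Z.Reachable v a) ?_ ha ⟨Reachable.refl _, Reachable.refl _⟩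
        rintro x y hxy ⟨hx, hr⟩
        exact ⟨hcl x hx y hxy, hr.trans (Adj.reachable ⟨hxy, hx, hcl x hx y hxy⟩)⟩
      exact this.2
    intro a b ha hb
    exact (key a ha).symm.trans (key b hb)
  · intro x hx
    have hx' : x ∈ R := hsupp ▸ hx
    have : Z.neighborSet x = {f x, g x} := by
      ext y; exact hadj x hx' y
    rw [this, Set.ncard_pair (hR x hx')]
  · rw [hsupp]
    apply mt_even (H := G)
    refine ⟨f, fun x hx => ⟨?_, (hf x).1, (hf x).2⟩⟩
    exact hcl x hx _ ⟨hR x hx, Or.inl rfl⟩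

variable [Fintype V] [DecidableEq V] (M : MixedGraph V)

noncomputable def gM : Matrix V V GaussianInt := fun u v =>
  if M.arc u v then ⟨0, 1⟩ else if M.arc v u then ⟨0, -1⟩ else if M.graph.Adj u v then 1 else 0

lemma hM_eq : M.hMatrix = (gM M).map GaussianInt.toComplex := by
  ext i j
  simp only [MixedGraph.hMatrix, gM, Matrix.map_apply]
  split_ifs <;> simp [GaussianInt.toComplex_def]

noncomputable def rho : GaussianInt →+* ZMod 2 := Zsqrtd.lift ⟨1, by decide⟩

lemma gM_rho (i j : V) : rho (gM M i j) = if M.graph.Adj i j then 1 else 0 := by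
  simp only [gM]
  split_ifs with h1 h2 h3 h4 h5
  · simp [rho, Zsqrtd.lift]
  · exact absurd (M.arc_adj _ _ h1) h2
  · simp [rho, Zsqrtd.lift]
  · exact absurd (M.arc_adj _ _ h3).symm h4
  · simp
  · simp

lemma det_adj (G : SimpleGraph V) (f : V → V) (hf : ∀ v, G.Adj v (f v) ∧ f (f v) = v)
    (hno : ¬ ∃ Z, EC G Z) (B : Matrix V V (ZMod 2)) (hB : ∀ i j, B i j = if G.Adj i j then 1 else 0) :
    B.det = 1 := by
  have sgn : ∀ (s : ℤˣ) (x : ZMod 2), s • x = x := by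
    intro s x
    rcases Int.units_eq_one_or s with rfl | rfl
    · simp
    · rw [Units.neg_smul, one_smul]; revert x; decide
  rw [Matrix.det_apply]
  simp only [sgn]
  let f0 : Equiv.Perm V := ⟨f, f, fun v => (hf v).2, fun v => (hf v).2⟩
  rw [← Finset.add_sum_erase _ _ (Finset.mem_univ f0)]
  have h1 : ∏ i, B (f0 i) i = 1 := by
    apply Finset.prod_eq_one
    intro i _
    rw [hB, if_pos]
    exact (hf i).1.symm
  have h2 : ∑ σ ∈ Finset.univ.erase f0, ∏ i, B (σ i) i = 0 := by
    refine Finset.sum_involution (fun σ _ => σ⁻¹) ?_ ?_ ?_ ?_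
    · intro σ _
      have : ∏ i, B (σ⁻¹ i) i = ∏ i, B (σ i) i := by
        rw [← Equiv.prod_comp σ]
        apply Finset.prod_congr rfl
        intro i _
        rw [show σ⁻¹ (σ i) = i from σ.symm_apply_apply i, hB, hB]
        simp only [G.adj_comm]
      rw [this]
      generalize ∏ i, B (σ i) i = x
      revert x; decide
    · intro σ hσ hne he
      have hadj : ∀ i, G.Adj i (σ i) := by
        intro i
        by_contra hc
        apply hne
        apply Finset.prod_eq_zero (Finset.mem_univ i)
        rw [hB, if_neg]
        exact fun h => hc h.symm
      have hinv : ∀ i, σ (σ i) = i := by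
        intro i
        have : σ⁻¹ (σ i) = i := σ.symm_apply_apply i
        rw [he] at this; exact this
      apply hno
      have : ∃ v, f v ≠ σ v := by
        by_contra hc
        push Not at hc
        exact (Finset.mem_erase.1 hσ).1 (Equiv.ext fun v => (hc v).symm)
      obtain ⟨v, hv⟩ := this
      exact two_pm f σ hf (fun v => ⟨hadj v, hinv v⟩) hv
    · intro σ hσ
      rw [Finset.mem_erase] at hσ ⊢
      refine ⟨fun h => hσ.1 ?_, Finset.mem_univ _⟩
      have h3 : f0⁻¹ = f0 := by ext; rfl
      rw [← h3, ← h, inv_inv]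
    · intro σ _; simp
  rw [h1, h2, add_zero]

lemma rank_full_of_pm (f : V → V) (hf : ∀ v, M.graph.Adj v (f v) ∧ f (f v) = v)
    (hno : ¬ ∃ Z, EC M.graph Z) : M.hRank = Fintype.card V := by
  have h1 := det_adj M.graph f hf hno ((gM M).map rho) (fun i j => by rw [Matrix.map_apply, gM_rho])
  have h2 : (gM M).det ≠ 0 := by
    intro h
    have := RingHom.map_det rho (gM M)
    rw [h, map_zero] at this
    rw [RingHom.mapMatrix_apply, h1] at this
    exact absurd this (by decide)
  have h3 : M.hMatrix.det ≠ 0 := by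
    rw [hM_eq]
    have := RingHom.map_det GaussianInt.toComplex (gM M)
    rw [RingHom.mapMatrix_apply] at this
    rw [← this]
    intro h
    exact h2 (GaussianInt.toComplex_eq_zero.1 h)
  unfold MixedGraph.hRank
  exact Matrix.rank_of_det_ne_zero h3

/-- rank of the restriction -/
noncomputable def rk (S : Set V) : ℕ := (mk M.hMatrix S).rank

lemma hM_adj {i j : V} (h : M.graph.Adj i j) : M.hMatrix i j * M.hMatrix j i = 1 := by
  simp only [MixedGraph.hMatrix]
  have h' := M.arc_antisymm
  by_cases h1 : M.arc i j
  · have := h' _ _ h1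
    simp [h1, this]
  · by_cases h2 : M.arc j i
    · simp [h1, h2]
    · simp [h1, h2, h, h.symm]

lemma hM_ne {i j : V} (h : M.graph.Adj i j) : M.hMatrix i j ≠ 0 := by
  intro h0
  have := hM_adj M h
  rw [h0] at this; simp at this

lemma hM_zero {i j : V} (h : ¬ M.graph.Adj i j) : M.hMatrix i j = 0 := by
  have h1 : ¬ M.arc i j := fun hh => h (M.arc_adj _ _ hh)
  have h2 : ¬ M.arc j i := fun hh => h (M.arc_adj _ _ hh).symm
  simp [MixedGraph.hMatrix, h, h1, h2]

lemma hM_conj (i j : V) : M.hMatrix j i = (starRingEnd ℂ) (M.hMatrix i j) := by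
  simp only [MixedGraph.hMatrix]
  have h' := M.arc_antisymm
  by_cases h1 : M.arc i j
  · have := h' _ _ h1
    simp [h1, this]
  · by_cases h2 : M.arc j i
    · simp [h1, h2]
    · by_cases h : M.graph.Adj i j
      · simp [h1, h2, h, h.symm]
      · have : ¬ M.graph.Adj j i := fun hh => h hh.symm
        simp [h1, h2, h, this]

lemma induce_hMatrix (S : Set V) : (M.induce S).hMatrix = M.hMatrix.submatrix (Function.Embedding.subtype (· ∈ S)) (Function.Embedding.subtype (· ∈ S)) := by
  ext i j
  simp only [MixedGraph.hMatrix, MixedGraph.induce, Matrix.submatrix_apply, comap_adj, Function.Embedding.subtype_apply]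
  congr

lemma hRank_induce (S : Set V) : (M.induce S).hRank = rk M S := by
  unfold MixedGraph.hRank rk
  rw [induce_hMatrix, rank_submatrix_emb M.hMatrix (Function.Embedding.subtype (· ∈ S)) S]
  ext; simp

lemma rk_univ : rk M Set.univ = M.hRank := by
  unfold rk MixedGraph.hRank
  congr 1
  ext i j; simp [mk]

lemma rk_induce (S : Set V) (T : Set S) : rk (M.induce S) T = rk M (Subtype.val '' T) := by
  rw [← hRank_induce]
  unfold MixedGraph.hRank rk
  rw [induce_hMatrix, induce_hMatrix, Matrix.submatrix_submatrix]
  have := rank_submatrix_emb M.hMatrix ((Function.Embedding.subtype (· ∈ T)).trans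
    (Function.Embedding.subtype (· ∈ S))) (Subtype.val '' T) (by
      ext x; simp)
  rw [← this]
  rfl

lemma induce_graph (S : Set V) : (M.induce S).graph = M.graph.comap (Function.Embedding.subtype (· ∈ S)) := rfl

lemma range_sub (S : Set V) : Set.range (Function.Embedding.subtype (· ∈ S)) = S := by ext; simp

lemma kp_induce (G : SimpleGraph V) (S : Set V) : kp (G.induce S) = kp (rs G S) := by
  have := kp_transfer (Function.Embedding.subtype (· ∈ S)) G
  rw [range_sub] at this
  exact this

lemma mnum_induce (G : SimpleGraph V) (S : Set V) :
    matchingNumber (G.induce S) = matchingNumber (rs G S) := by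
  have := mnum_transfer (Function.Embedding.subtype (· ∈ S)) G
  rw [range_sub] at this
  exact this

end Bd


section Ext
open SimpleGraph

noncomputable abbrev mS (G : SimpleGraph V) (S : Set V) : ℕ := matchingNumber (rs G S)
noncomputable abbrev kS (G : SimpleGraph V) (S : Set V) : ℕ := kp (rs G S)

lemma mt_rs {G : SimpleGraph V} {S T : Set V} : Mt (rs G S) T ↔ Mt G T ∧ T ⊆ S :=
  ⟨fun h => ⟨h.mono (rs_le _ _), h.sub⟩, fun h => h.1.rs h.2⟩

variable [Fintype V]

lemma kp_mono {H K : SimpleGraph V} (h : H ≤ K) : kp H ≤ kp K := by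
  apply Set.ncard_le_ncard _ (Set.toFinite _)
  rintro Z ⟨h1, h2, h3⟩
  exact ⟨h1, h2.trans h, h3⟩

lemma kp_pos {H Z : SimpleGraph V} (h : EC H Z) : 1 ≤ kp H := by
  have : 0 < kp H := (Set.ncard_pos (Set.toFinite _)).2 ⟨Z, h⟩
  omega

lemma kp_zero {H : SimpleGraph V} (h : ¬ ∃ Z, EC H Z) : kp H = 0 := by
  unfold kp
  rw [Set.ncard_eq_zero (Set.toFinite _), Set.eq_empty_iff_forall_notMem]
  exact fun Z hZ => h ⟨Z, hZ⟩

lemma kp_one {H Z : SimpleGraph V} (h : EC H Z) (hu : ∀ Z', EC H Z' → Z' = Z) : kp H = 1 := by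
  unfold kp
  rw [Set.ncard_eq_one]
  exact ⟨Z, Set.eq_singleton_iff_unique_mem.2 ⟨h, hu⟩⟩

lemma kp_lt {H K Z : SimpleGraph V} (h : H ≤ K) (hZ : EC K Z) (hn : ¬ Z ≤ H) : kp H + 1 ≤ kp K := by
  have : kp H < kp K := by
    apply Set.ncard_lt_ncard _ (Set.toFinite _)
    refine ⟨?_, fun hh => hn (hh hZ).2.1⟩
    rintro Z ⟨h1, h2, h3⟩
    exact ⟨h1, h2.trans h, h3⟩
  omega

lemma kp_lt2 {H K Z Z' : SimpleGraph V} (h : H ≤ K) (hZ : EC K Z) (hn : ¬ Z ≤ H)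
    (hZ' : EC K Z') (hn' : ¬ Z' ≤ H) (hne : Z ≠ Z') : kp H + 2 ≤ kp K := by
  have h1 : {Z : SimpleGraph V | IsCyc Z ∧ Z ≤ H ∧ Even Z.support.ncard} ⊆
    {Z : SimpleGraph V | IsCyc Z ∧ Z ≤ K ∧ Even Z.support.ncard} \ {Z, Z'} := by
    rintro Y ⟨h1, h2, h3⟩
    refine ⟨⟨h1, h2.trans h, h3⟩, ?_⟩
    rintro (rfl | rfl)
    · exact hn h2
    · exact hn' h2
  have h2 := Set.ncard_le_ncard h1 (Set.toFinite _)
  have h3 : ({Z, Z'} : Set (SimpleGraph V)) ⊆ {Z : SimpleGraph V | IsCyc Z ∧ Z ≤ K ∧ Even Z.support.ncard} := by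
    rintro Y (rfl | rfl)
    · exact hZ
    · exact hZ'
  have h4 := Set.ncard_sdiff_add_ncard_of_subset h3 (Set.toFinite _)
  rw [Set.ncard_pair hne] at h4
  unfold kp
  omega

lemma not_le_del {G Z : SimpleGraph V} {S : Set V} {v : V} (hv : v ∈ Z.support) :
    ¬ Z ≤ rs G (S \ {v}) := by
  intro h
  have := supp_of_le_rs h hv
  exact this.2 rfl

lemma mnum_mono {H K : SimpleGraph V} (h : H ≤ K) : matchingNumber H ≤ matchingNumber K := by
  obtain ⟨T, hT, hc⟩ := mnum_ex H
  have := mnum_ge (hT.mono h)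
  omega

lemma Mt.remove {H : SimpleGraph V} {T : Set V} (h : Mt H T) (v : V) :
    ∃ T', T' ⊆ T \ {v} ∧ Mt H T' ∧ T.ncard ≤ T'.ncard + 2 := by
  obtain ⟨f, hf⟩ := h
  by_cases hv : v ∈ T
  · refine ⟨T \ {v, f v}, ?_, ⟨f, ?_⟩, ?_⟩
    · exact Set.sdiff_subset_sdiff_right (by simp)
    · rintro x ⟨hx, hx'⟩
      simp only [Set.mem_insert_iff, Set.mem_singleton_iff, not_or] at hx'
      refine ⟨⟨(hf x hx).1, ?_⟩, (hf x hx).2⟩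
      rintro (h | h)
      · exact hx'.2 (by rw [← h, (hf x hx).2.2])
      · apply hx'.1
        rw [← (hf x hx).2.2, show f x = f v from h, (hf v hv).2.2]
    · have h3 : ({v, f v} : Set V) ⊆ T := by
        rintro Y (rfl | rfl)
        · exact hv
        · exact (hf _ hv).1
      have h4 := Set.ncard_sdiff_add_ncard_of_subset h3 (Set.toFinite _)
      have := Set.ncard_insert_le v {f v}
      rw [Set.ncard_singleton] at this
      omega
  · exact ⟨T, fun x hx => ⟨hx, fun h => hv (h ▸ hx)⟩, ⟨f, hf⟩, by omega⟩

lemma mS_del (G : SimpleGraph V) (S : Set V) (v : V) : mS G S ≤ mS G (S \ {v}) + 1 := by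
  obtain ⟨T, hT, hc⟩ := mnum_ex (rs G S)
  obtain ⟨T', h1, h2, h3⟩ := hT.remove v
  have : Mt (rs G (S \ {v})) T' := mt_rs.2 ⟨(mt_rs.1 h2).1, h1.trans (Set.sdiff_subset_sdiff_left hT.sub)⟩
  have := mnum_ge this
  simp only [mS]; omega

lemma mS_le_card (G : SimpleGraph V) (S : Set V) : 2 * mS G S ≤ S.ncard := by
  obtain ⟨T, hT, hc⟩ := mnum_ex (rs G S)
  rw [mS, ← hc]
  exact Set.ncard_le_ncard hT.sub (Set.toFinite _)

variable [DecidableEq V] (M : MixedGraph V)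

lemma rk_mono {S T : Set V} (h : S ⊆ T) : rk M S ≤ rk M T := rank_mk_mono _ h

lemma rk_ge_of_mt {T : Set V} (h : Mt M.graph T) (hno : ¬ ∃ Z, EC (rs M.graph T) Z) :
    T.ncard ≤ rk M T := by
  obtain ⟨f, hf⟩ := h
  rw [← hRank_induce]
  rw [rank_full_of_pm (M.induce T) (fun x => ⟨f x, (hf x x.2).1⟩)]
  · rw [Fintype.card_eq_nat_card, Nat.card_coe_set_eq]
  · intro v
    exact ⟨(hf v v.2).2.1, Subtype.ext (hf v v.2).2.2⟩
  · rintro ⟨Z, hZ⟩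
    have := (EC_map (Function.Embedding.subtype (· ∈ T)) (Z := Z) (G := M.graph)).2 hZ
    rw [range_sub] at this
    exact hno ⟨_, this⟩

lemma bound : ∀ (n : ℕ) (S : Set V), S.ncard = n →
    2 * mS M.graph S ≤ rk M S + 2 * kS M.graph S := by
  intro n
  induction n using Nat.strong_induction_on with
  | _ n ih =>
    intro S hS
    by_cases h : ∃ Z, EC (rs M.graph S) Z
    · obtain ⟨Z, hZ⟩ := h
      obtain ⟨a, b, hab⟩ := hZ.1.edge
      have ha : a ∈ S := (hZ.2.1 hab).2.1
      have h1 : (S \ {a}).ncard < n := by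
        rw [← hS]
        exact Set.ncard_sdiff_singleton_lt_of_mem ha
      have h2 := ih _ h1 _ rfl
      have h3 := mS_del M.graph S a
      have h4 := kp_lt (rs_mono M.graph (S := S \ {a}) (T := S) Set.sdiff_subset) hZ (not_le_del (mem_supp_l hab))
      have h5 := rk_mono M (S := S \ {a}) (T := S) Set.sdiff_subset
      simp only [mS, kS] at *
      omega
    · obtain ⟨T, hT, hc⟩ := mnum_ex (rs M.graph S)
      have h1 := rk_ge_of_mt M (mt_rs.1 hT).1 (fun ⟨Z, hZ⟩ => h ⟨Z, hZ.1, hZ.2.1.trans (rs_mono _ hT.sub), hZ.2.2⟩)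
      have h2 := rk_mono M hT.sub
      simp only [mS, kS] at *
      omega

def Ext (S : Set V) : Prop := rk M S + 2 * kS M.graph S = 2 * mS M.graph S

lemma ext_del {S : Set V} (h : Ext M S) {Z : SimpleGraph V} (hZ : EC (rs M.graph S) Z) {v : V}
    (hv : v ∈ Z.support) : Ext M (S \ {v}) ∧ mS M.graph S = mS M.graph (S \ {v}) + 1 ∧
      kS M.graph S = kS M.graph (S \ {v}) + 1 := by
  have h2 := bound M _ (S \ {v}) rfl
  have h3 := mS_del M.graph S v
  have h4 := kp_lt (rs_mono M.graph (S := S \ {v}) (T := S) Set.sdiff_subset) hZ (not_le_del hv)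
  have h5 := rk_mono M (S := S \ {v}) (T := S) Set.sdiff_subset
  unfold Ext at *
  simp only [mS, kS] at *
  omega

lemma ext_DE {S : Set V} (h : Ext M S) : DE (rs M.graph S) := by
  intro Z Z' hZ hZ' hne
  rw [Set.disjoint_left]
  intro v hv hv'
  have h1 := ext_del M h hZ hv
  have h4 := kp_lt2 (rs_mono M.graph (S := S \ {v}) (T := S) Set.sdiff_subset) hZ (not_le_del hv) hZ' (not_le_del hv') hne
  simp only [mS, kS] at *
  omega

lemma pstep {S T : Set V} (h : PendantStep M.graph S T) :
    rk M S = rk M T + 2 ∧ mS M.graph S = mS M.graph T + 1 ∧ kS M.graph T ≤ kS M.graph S ∧ T ⊆ S ∧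
      T.ncard < S.ncard := by
  obtain ⟨u, v, hu, hv, he, rfl⟩ := h
  have huv : M.graph.Adj u v := by
    have : v ∈ {w | w ∈ S ∧ M.graph.Adj u w} := by rw [he]; rfl
    exact this.2
  have hno : ∀ w ∈ S, w ≠ v → ¬ M.graph.Adj u w := by
    intro w hw hne ha
    have : w ∈ ({v} : Set V) := by rw [← he]; exact ⟨hw, ha⟩
    exact hne this
  refine ⟨?_, ?_, kp_mono (rs_mono _ Set.sdiff_subset), Set.sdiff_subset, ?_⟩
  · apply rank_mk_pendant _ _ _ _ hu hv (hM_ne M huv) (hM_ne M huv.symm) (hM_zero M (M.graph.loopless.irrefl _)) huv.ne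
    · exact fun w hw hne => hM_zero M (hno w hw hne)
    · exact fun w hw hne => hM_zero M (fun h => hno w hw hne h.symm)
  · apply le_antisymm
    · obtain ⟨T, hT, hc⟩ := mnum_ex (rs M.graph S)
      obtain ⟨T', h1, h2, h3⟩ := hT.remove v
      have : Mt (rs M.graph (S \ {u, v})) T' := by
        refine mt_rs.2 ⟨(mt_rs.1 h2).1, ?_⟩
        intro x hx
        refine ⟨hT.sub (h1 hx).1, ?_⟩
        rintro (rfl | rfl)
        · obtain ⟨f, hf⟩ := h2
          have := hf x hx
          apply hno _ (this.2.1.2.2) _ this.2.1.1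
          exact (h1 this.1).2
        · exact (h1 hx).2 rfl
      have := mnum_ge this
      simp only [mS]; omega
    · obtain ⟨T, hT, hc⟩ := mnum_ex (rs M.graph (S \ {u, v}))
      have hd : Disjoint T {u, v} := by
        rw [Set.disjoint_left]
        intro x hx; exact (hT.sub hx).2
      have h1 : Mt (rs M.graph S) (T ∪ {u, v}) := by
        refine mt_rs.2 ⟨(mt_rs.1 hT).1.union (mt_edge huv) hd, ?_⟩
        rintro x (hx | rfl | rfl)
        · exact (hT.sub hx).1
        · exact hu
        · exact hv
      have := mnum_ge h1
      rw [Set.ncard_union_eq hd, Set.ncard_pair huv.ne] at this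
      simp only [mS]; omega
  · apply Set.ncard_lt_ncard _ (Set.toFinite _)
    exact ⟨Set.sdiff_subset, fun h => (h hu).2 (by simp)⟩

section additive
variable {M} {S T : Set V}

lemma rk_union (hd : Disjoint S T) (hn : ∀ s ∈ S, ∀ t ∈ T, ¬ M.graph.Adj s t) : rk M (S ∪ T) = rk M S + rk M T :=
  rank_mk_union _ _ _ hd (fun s hs t ht => hM_zero M (hn s hs t ht))
    (fun s hs t ht => hM_zero M (fun h => hn s hs t ht h.symm))

lemma mS_union (hd : Disjoint S T) (hn : ∀ s ∈ S, ∀ t ∈ T, ¬ M.graph.Adj s t) : mS M.graph (S ∪ T) = mS M.graph S + mS M.graph T := by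
  apply le_antisymm
  · obtain ⟨X, hX, hc⟩ := mnum_ex (rs M.graph (S ∪ T))
    have hsub := hX.sub
    obtain ⟨f, hf⟩ := hX
    have h1 : Mt (rs M.graph S) (X ∩ S) := by
      refine mt_rs.2 ⟨⟨f, fun v hv => ?_⟩, Set.inter_subset_right⟩
      have := hf v hv.1
      refine ⟨⟨this.1, ?_⟩, this.2.1.1, this.2.2⟩
      rcases hsub this.1 with h | h
      · exact h
      · exact absurd this.2.1.1 (hn _ hv.2 _ h)
    have h2 : Mt (rs M.graph T) (X ∩ T) := by
      refine mt_rs.2 ⟨⟨f, fun v hv => ?_⟩, Set.inter_subset_right⟩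
      have := hf v hv.1
      refine ⟨⟨this.1, ?_⟩, this.2.1.1, this.2.2⟩
      rcases hsub this.1 with h | h
      · exact absurd this.2.1.1.symm (hn _ h _ hv.2)
      · exact h
    have h3 := mnum_ge h1
    have h4 := mnum_ge h2
    have h5 : X = (X ∩ S) ∪ (X ∩ T) := by rw [← Set.inter_union_distrib_left]; exact (Set.inter_eq_left.2 hsub).symm
    have h6 : X.ncard ≤ (X ∩ S).ncard + (X ∩ T).ncard := by
      conv_lhs => rw [h5]
      exact Set.ncard_union_le _ _
    simp only [mS]; omega
  · obtain ⟨X, hX, hc⟩ := mnum_ex (rs M.graph S)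
    obtain ⟨Y, hY, hc'⟩ := mnum_ex (rs M.graph T)
    have hd' : Disjoint X Y := hd.mono hX.sub hY.sub
    have : Mt (rs M.graph (S ∪ T)) (X ∪ Y) :=
      mt_rs.2 ⟨(mt_rs.1 hX).1.union (mt_rs.1 hY).1 hd', Set.union_subset_union hX.sub hY.sub⟩
    have := mnum_ge this
    rw [Set.ncard_union_eq hd'] at this
    simp only [mS]; omega

lemma kS_union (hd : Disjoint S T) (hn : ∀ s ∈ S, ∀ t ∈ T, ¬ M.graph.Adj s t) : kS M.graph (S ∪ T) = kS M.graph S + kS M.graph T := by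
  unfold kS kp
  rw [← Set.ncard_union_eq _ (Set.toFinite _) (Set.toFinite _)]
  · congr 1
    ext Z
    constructor
    · rintro ⟨h1, h2, h3⟩
      obtain ⟨a, b, hab⟩ := h1.edge
      rcases (h2 hab).2.1 with ha | ha
      · left
        refine ⟨h1, le_rs (h2.trans (rs_le _ _)) ?_, h3⟩
        refine h1.ind (· ∈ S) ?_ (mem_supp_l hab) ha
        intro x y hxy hx
        rcases (h2 hxy).2.2 with h | h
        · exact h
        · exact absurd (h2 hxy).1 (hn _ hx _ h)
      · right
        refine ⟨h1, le_rs (h2.trans (rs_le _ _)) ?_, h3⟩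
        refine h1.ind (· ∈ T) ?_ (mem_supp_l hab) ha
        intro x y hxy hx
        rcases (h2 hxy).2.2 with h | h
        · exact absurd (h2 hxy).1.symm (hn _ h _ hx)
        · exact h
    · rintro (⟨h1, h2, h3⟩ | ⟨h1, h2, h3⟩)
      · exact ⟨h1, h2.trans (rs_mono _ Set.subset_union_left), h3⟩
      · exact ⟨h1, h2.trans (rs_mono _ Set.subset_union_right), h3⟩
  · rw [Set.disjoint_left]
    rintro Z ⟨h1, h2, h3⟩ ⟨h1', h2', h3'⟩
    obtain ⟨a, b, hab⟩ := h1.edge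
    exact Set.disjoint_left.1 hd (h2 hab).2.1 (h2' hab).2.1

lemma ext_union (hd : Disjoint S T) (hn : ∀ s ∈ S, ∀ t ∈ T, ¬ M.graph.Adj s t) : Ext M (S ∪ T) ↔ Ext M S ∧ Ext M T := by
  have h1 := rk_union hd hn
  have h2 := mS_union hd hn
  have h3 := kS_union hd hn
  have h4 := bound M _ S rfl
  have h5 := bound M _ T rfl
  unfold Ext
  omega
end additive

lemma ext_empty : Ext M ∅ := by
  have h1 : mS M.graph ∅ = 0 := by
    have := mS_le_card M.graph ∅
    rw [Set.ncard_empty] at this; omega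
  have h2 : rk M ∅ = 0 := by
    have : mk M.hMatrix ∅ = 0 := by ext; simp [mk]
    unfold rk; rw [this, Matrix.rank_zero]
  have h3 : kS M.graph ∅ = 0 := by
    apply kp_zero
    rintro ⟨Z, hZ⟩
    obtain ⟨a, b, hab⟩ := hZ.1.edge
    exact (hZ.2.1 hab).2.1
  unfold Ext; omega

lemma ext_comps : Ext M Set.univ ↔ ∀ c : M.graph.ConnectedComponent, Ext M c.supp := by
  have key : ∀ F : Finset M.graph.ConnectedComponent,
      Ext M {v | M.graph.connectedComponentMk v ∈ F} ↔ ∀ c ∈ F, Ext M c.supp := by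
    intro F
    induction F using Finset.induction_on with
    | empty => simpa using ext_empty M
    | insert c F hc ih =>
      have h1 : {v | M.graph.connectedComponentMk v ∈ insert c F} = c.supp ∪ {v | M.graph.connectedComponentMk v ∈ F} := by
        ext v; simp [ConnectedComponent.mem_supp_iff]
      rw [h1, ext_union, ih]
      · simp
      · rw [Set.disjoint_left]
        intro x hx hx'
        rw [ConnectedComponent.mem_supp_iff] at hx
        rw [Set.mem_setOf_eq, hx] at hx'
        exact hc hx'
      · intro s hs t ht hadj
        rw [ConnectedComponent.mem_supp_iff] at hs
        rw [Set.mem_setOf_eq, ← ConnectedComponent.connectedComponentMk_eq_of_adj hadj, hs] at ht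
        exact hc ht
  have := key Finset.univ
  simpa using this

lemma ext_induce (S : Set V) : Ext (M.induce S) Set.univ ↔ Ext M S := by
  have h1 : rk (M.induce S) Set.univ = rk M S := by rw [rk_induce]; simp
  have h2 := kp_induce M.graph S
  have h3 := mnum_induce M.graph S
  unfold Ext
  simp only [mS, kS, rs_univ]
  rw [h1]
  rw [show (M.induce S).graph = M.graph.induce S from rfl, h2, h3]

lemma ext_univ_iff : (M.hRank : ℤ) = 2 * (matchingNumber M.graph : ℤ) - 2 * (evenCycleCount M.graph : ℤ) ↔
    Ext M Set.univ := by
  unfold Ext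
  simp only [mS, kS, rs_univ, rk_univ, evenCycleCount_eq]
  omega

lemma ext_pstep {S T : Set V} (h : PendantStep M.graph S T) :
    Ext M S ↔ Ext M T ∧ kS M.graph T = kS M.graph S := by
  have h1 := pstep M h
  have h2 := bound M _ T rfl
  unfold Ext
  constructor
  · intro h; omega
  · intro h; omega

lemma ext_reaches {S : Set V} (h : PendantReaches M.graph S) :
    Ext M Set.univ ↔ Ext M S ∧ kS M.graph S = kS M.graph Set.univ := by
  induction h with
  | refl => simp
  | @tail b c h1 h2 ih =>
    rw [ih, ext_pstep M h2]
    constructor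
    · rintro ⟨⟨h3, h4⟩, h5⟩; exact ⟨h3, h4.trans h5⟩
    · rintro ⟨h3, h4⟩
      have h5 := (pstep M h2).2.2.1
      have h6 := kp_mono (rs_mono M.graph (Set.subset_univ b))
      simp only [kS] at *
      exact ⟨⟨h3, by omega⟩, by omega⟩

lemma exists_reduced : ∃ S, PendantReaches M.graph S ∧ NoPendantIn M.graph S := by
  have key : ∀ (n : ℕ) (S : Set V), S.ncard = n → PendantReaches M.graph S →
      ∃ S, PendantReaches M.graph S ∧ NoPendantIn M.graph S := by
    intro n
    induction n using Nat.strong_induction_on with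
    | _ n ih =>
      intro S hn hS
      by_cases h : NoPendantIn M.graph S
      · exact ⟨S, hS, h⟩
      · unfold NoPendantIn at h
        push Not at h
        obtain ⟨u, hu, h⟩ := h
        rw [Set.ncard_eq_one] at h
        obtain ⟨v, hv⟩ := h
        have hvS : v ∈ S := by
          have : v ∈ {w | w ∈ S ∧ M.graph.Adj u w} := by rw [hv]; rfl
          exact this.1
        have hst : PendantStep M.graph S (S \ {u, v}) := ⟨u, v, hu, hvS, hv, rfl⟩
        exact ih _ (hn ▸ (pstep M hst).2.2.2.2) _ rfl (Relation.ReflTransGen.tail hS hst)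
  exact key _ _ rfl Relation.ReflTransGen.refl

end Ext


section Excess
open SimpleGraph

/-- delete one edge -/
abbrev de (H : SimpleGraph V) (a b : V) : SimpleGraph V := H.deleteEdges {s(a, b)}

lemma de_le (H : SimpleGraph V) (a b : V) : de H a b ≤ H := deleteEdges_le _

lemma le_de {H Z : SimpleGraph V} {a b : V} (h : Z ≤ H) (hn : ¬ Z.Adj a b) : Z ≤ de H a b := by
  intro x y hxy
  rw [de, deleteEdges_adj]
  refine ⟨h hxy, fun he => hn ?_⟩
  rw [Set.mem_singleton_iff] at he
  rwa [← mem_edgeSet, ← he, mem_edgeSet]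

lemma le_de_iff {H Z : SimpleGraph V} {a b : V} : Z ≤ de H a b ↔ Z ≤ H ∧ ¬ Z.Adj a b := by
  refine ⟨fun h => ⟨h.trans (de_le _ _ _), fun hh => ?_⟩, fun h => le_de h.1 h.2⟩
  have := h hh
  rw [de, deleteEdges_adj] at this
  exact this.2 rfl

lemma de_reach_split {H : SimpleGraph V} {a b x y : V} (h : H.Reachable x y) :
    (de H a b).Reachable x y ∨ ((de H a b).Reachable x a ∧ (de H a b).Reachable b y) ∨
      ((de H a b).Reachable x b ∧ (de H a b).Reachable a y) := by
  refine reach_ind (fun y => (de H a b).Reachable x y ∨ ((de H a b).Reachable x a ∧ (de H a b).Reachable b y) ∨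
      ((de H a b).Reachable x b ∧ (de H a b).Reachable a y)) ?_ h (Or.inl (Reachable.refl _))
  intro p q hpq hp
  by_cases he : s(p, q) = s(a, b)
  · rw [Sym2.eq_iff] at he
    rcases he with ⟨rfl, rfl⟩ | ⟨rfl, rfl⟩
    · rcases hp with hp | hp | hp
      · exact Or.inr (Or.inl ⟨hp, Reachable.refl _⟩)
      · exact Or.inr (Or.inl ⟨hp.1, Reachable.refl _⟩)
      · exact Or.inl hp.1
    · rcases hp with hp | hp | hp
      · exact Or.inr (Or.inr ⟨hp, Reachable.refl _⟩)
      · exact Or.inl hp.1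
      · exact Or.inr (Or.inr ⟨hp.1, Reachable.refl _⟩)
  · have : (de H a b).Adj p q := by
      rw [de, deleteEdges_adj]; exact ⟨hpq, he⟩
    rcases hp with hp | hp | hp
    · exact Or.inl (hp.trans this.reachable)
    · exact Or.inr (Or.inl ⟨hp.1, hp.2.trans this.reachable⟩)
    · exact Or.inr (Or.inr ⟨hp.1, hp.2.trans this.reachable⟩)

variable [Fintype V]

lemma cc_reach {H : SimpleGraph V} {a b : V} (hr : (de H a b).Reachable a b) :
    Nat.card (de H a b).ConnectedComponent = Nat.card H.ConnectedComponent := by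
  apply Nat.card_congr
  refine Quot.congr (Equiv.refl V) ?_
  intro x y
  refine ⟨fun h => h.mono (de_le _ _ _), fun h => ?_⟩
  rcases de_reach_split (a := a) (b := b) h with h | h | h
  · exact h
  · exact (h.1.trans hr).trans h.2
  · exact (h.1.trans hr.symm).trans h.2

lemma cc_not_reach {H : SimpleGraph V} {a b : V} (hab : H.Adj a b) (hr : ¬ (de H a b).Reachable a b) :
    Nat.card (de H a b).ConnectedComponent = Nat.card H.ConnectedComponent + 1 := by
  have h1 : Nat.card {c : (de H a b).ConnectedComponent // c ≠ (de H a b).connectedComponentMk b} =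
      Nat.card H.ConnectedComponent := by
    let f : (de H a b).ConnectedComponent → H.ConnectedComponent :=
      ConnectedComponent.map (Hom.ofLE (de_le H a b))
    have hf : ∀ x, f ((de H a b).connectedComponentMk x) = H.connectedComponentMk x := fun x => rfl
    apply Nat.card_eq_of_bijective (fun c => f c.1)
    constructor
    · rintro ⟨c, hc⟩ ⟨d, hd⟩ h
      induction c using ConnectedComponent.ind with | _ x
      induction d using ConnectedComponent.ind with | _ y
      simp only [hf] at h
      rw [ConnectedComponent.eq] at h
      rw [ne_eq, ConnectedComponent.eq] at hc hd
      apply Subtype.ext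
      simp only [ConnectedComponent.eq]
      rcases de_reach_split (a := a) (b := b) h with h | h | h
      · exact h
      · exact absurd h.2.symm hd
      · exact absurd h.1 hc
    · intro c
      induction c using ConnectedComponent.ind with | _ x
      by_cases hx : (de H a b).Reachable x b
      · refine ⟨⟨(de H a b).connectedComponentMk a, ?_⟩, ?_⟩
        · rwa [ne_eq, ConnectedComponent.eq]
        · simp only [hf, ConnectedComponent.eq]
          exact hab.reachable.trans (hx.symm.mono (de_le _ _ _))
      · refine ⟨⟨(de H a b).connectedComponentMk x, ?_⟩, ?_⟩
        · rwa [ne_eq, ConnectedComponent.eq]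
        · simp only [hf]
  rw [← h1, Nat.card_eq_fintype_card, Nat.card_eq_fintype_card]
  rw [Fintype.card_subtype_compl]
  have : 0 < Fintype.card (de H a b).ConnectedComponent := Fintype.card_pos_iff.2 ⟨(de H a b).connectedComponentMk a⟩
  rw [Fintype.card_subtype_eq]
  omega

lemma de_edges {H : SimpleGraph V} {a b : V} (hab : H.Adj a b) :
    (de H a b).edgeSet.ncard + 1 = H.edgeSet.ncard := by
  have : (de H a b).edgeSet = H.edgeSet \ {s(a, b)} := edgeSet_deleteEdges _
  rw [this]
  exact Set.ncard_sdiff_singleton_add_one hab (Set.toFinite _)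

noncomputable def exc (H : SimpleGraph V) : ℤ := cyclomatic H - (kp H : ℤ)

/-- edge on a cycle iff endpoints reachable after deletion -/
lemma reach_iff_cyc {H : SimpleGraph V} {a b : V} (hab : H.Adj a b) :
    (de H a b).Reachable a b ↔ ∃ Z, IsCyc Z ∧ Z ≤ H ∧ Z.Adj a b := by
  constructor
  · exact exists_cyc_of_reach hab
  · rintro ⟨Z, hZ, hle, h⟩
    exact (hZ.reach_del h).mono (deleteEdges_mono' hle _)

lemma kp_de_eq {H : SimpleGraph V} {a b : V} (h : ¬ ∃ Z, EC H Z ∧ Z.Adj a b) :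
    kp (de H a b) = kp H := by
  apply le_antisymm (kp_mono (de_le _ _ _))
  apply Set.ncard_le_ncard _ (Set.toFinite _)
  rintro Z ⟨h1, h2, h3⟩
  exact ⟨h1, le_de h2 fun hh => h ⟨Z, ⟨h1, h2, h3⟩, hh⟩, h3⟩

lemma kp_de_succ {H : SimpleGraph V} (hD : DE H) {a b : V} {Z : SimpleGraph V} (hZ : EC H Z) (h : Z.Adj a b) :
    kp (de H a b) + 1 = kp H := by
  have h1 : {Z : SimpleGraph V | IsCyc Z ∧ Z ≤ de H a b ∧ Even Z.support.ncard} =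
    {Z : SimpleGraph V | IsCyc Z ∧ Z ≤ H ∧ Even Z.support.ncard} \ {Z} := by
    ext Y
    constructor
    · rintro ⟨h1, h2, h3⟩
      refine ⟨⟨h1, h2.trans (de_le _ _ _), h3⟩, ?_⟩
      rintro rfl
      exact (le_de_iff.1 h2).2 h
    · rintro ⟨⟨h1, h2, h3⟩, h4⟩
      refine ⟨h1, le_de h2 fun hh => ?_, h3⟩
      exact Set.disjoint_left.1 (hD Y Z ⟨h1, h2, h3⟩ hZ h4) (mem_supp_l hh) (mem_supp_l h)
  unfold kp
  rw [h1]
  exact Set.ncard_sdiff_singleton_add_one hZ (Set.toFinite _)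

lemma exc_bridge {H : SimpleGraph V} {a b : V} (hab : H.Adj a b)
    (h : ¬ ∃ Z, IsCyc Z ∧ Z ≤ H ∧ Z.Adj a b) : exc (de H a b) = exc H := by
  have h1 := cc_not_reach hab (fun hr => h ((reach_iff_cyc hab).1 hr))
  have h2 := de_edges hab
  have h3 := kp_de_eq (H := H) (a := a) (b := b) (fun ⟨Z, hZ, hh⟩ => h ⟨Z, hZ.1, hZ.2.1, hh⟩)
  unfold exc cyclomatic
  rw [h1, h3, ← h2]; push_cast; ring

lemma exc_odd {H : SimpleGraph V} {a b : V} (hab : H.Adj a b)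
    (h : ∃ Z, IsCyc Z ∧ Z ≤ H ∧ Z.Adj a b) (hne : ¬ ∃ Z, EC H Z ∧ Z.Adj a b) :
    exc (de H a b) + 1 = exc H := by
  have h1 := cc_reach ((reach_iff_cyc hab).2 h)
  have h2 := de_edges hab
  have h3 := kp_de_eq hne
  unfold exc cyclomatic
  rw [h1, h3, ← h2]; push_cast; ring

lemma exc_even {H : SimpleGraph V} (hD : DE H) {a b : V} {Z : SimpleGraph V} (hZ : EC H Z) (h : Z.Adj a b) :
    exc (de H a b) = exc H := by
  have hab : H.Adj a b := hZ.2.1 h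
  have h1 := cc_reach ((reach_iff_cyc hab).2 ⟨Z, hZ.1, hZ.2.1, h⟩)
  have h2 := de_edges hab
  have h3 := kp_de_succ hD hZ h
  unfold exc cyclomatic
  rw [h1, ← h3, ← h2]; push_cast; ring

lemma exc_de_le {H : SimpleGraph V} (hD : DE H) {a b : V} (hab : H.Adj a b) :
    exc (de H a b) ≤ exc H := by
  by_cases h : ∃ Z, IsCyc Z ∧ Z ≤ H ∧ Z.Adj a b
  · by_cases h' : ∃ Z, EC H Z ∧ Z.Adj a b
    · obtain ⟨Z, hZ, hh⟩ := h'
      exact (exc_even hD hZ hh).le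
    · have := exc_odd hab h h'; omega
  · exact (exc_bridge hab h).le

lemma exc_mono : ∀ (n : ℕ) {H K : SimpleGraph V}, K.edgeSet.ncard = n → DE K → H ≤ K → exc H ≤ exc K := by
  intro n
  induction n with
  | zero =>
    intro H K hn hD hle
    have : K = ⊥ := by
      rw [Set.ncard_eq_zero (Set.toFinite _)] at hn
      rwa [← edgeSet_eq_empty]
    subst this
    rw [le_bot_iff.1 hle]
  | succ n ih =>
    intro H K hn hD hle
    by_cases he : H = K
    · rw [he]
    · have : ∃ a b, K.Adj a b ∧ ¬ H.Adj a b := by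
        by_contra hc
        push Not at hc
        exact he (le_antisymm hle fun a b => hc a b)
      obtain ⟨a, b, hab, hnab⟩ := this
      have h1 := de_edges hab
      have h2 := ih (H := H) (K := de K a b) (by omega) (hD.mono (de_le _ _ _)) (le_de hle hnab)
      exact h2.trans (exc_de_le hD hab)

/-- an odd cycle has an edge on no even cycle -/
lemma odd_edge {H : SimpleGraph V} (hD : DE H) {Γ : SimpleGraph V} (hΓ : OC H Γ) :
    ∃ a b, Γ.Adj a b ∧ ¬ ∃ Z, EC H Z ∧ Z.Adj a b := by
  by_contra hc
  push Not at hc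
  obtain ⟨a, b, hab⟩ := hΓ.1.edge
  obtain ⟨Z, hZ, hZab⟩ := hc a b hab
  have h1 : ∀ x ∈ Γ.support, x ∈ Z.support := by
    refine hΓ.1.ind (· ∈ Z.support) ?_ (mem_supp_l hab) (mem_supp_l hZab)
    intro x y hxy hx
    obtain ⟨Z', hZ', h'⟩ := hc x y hxy
    by_cases he : Z' = Z
    · subst he; exact mem_supp_r h'
    · exact absurd hx (Set.disjoint_left.1 (hD _ _ hZ' hZ he) (mem_supp_l h'))
  have h2 : Γ ≤ Z := by
    intro x y hxy
    obtain ⟨Z', hZ', h'⟩ := hc x y hxy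
    by_cases he : Z' = Z
    · subst he; exact h'
    · exact absurd (h1 x (mem_supp_l hxy)) (Set.disjoint_left.1 (hD _ _ hZ' hZ he) (mem_supp_l h'))
  have := cyc_le_eq hΓ.1 hZ.1 h2
  subst this
  have := hΓ.2.2
  rw [← Nat.not_even_iff_odd] at this
  exact this hZ.2.2

lemma exc_main : ∀ (n : ℕ) (H : SimpleGraph V), H.edgeSet.ncard = n → DE H →
    ((∃ Z, OC H Z) → 1 ≤ exc H) ∧ ((¬ ∃ Z, OC H Z) → exc H = 0) := by
  intro n
  induction n with
  | zero =>
    intro H hn hD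
    have : H = ⊥ := by
      rw [Set.ncard_eq_zero (Set.toFinite _)] at hn
      rwa [← edgeSet_eq_empty]
    subst this
    constructor
    · rintro ⟨Z, hZ⟩
      obtain ⟨a, b, hab⟩ := hZ.1.edge
      exact absurd (hZ.2.1 hab) (by simp)
    · intro _
      have h1 : kp (⊥ : SimpleGraph V) = 0 := by
        apply kp_zero
        rintro ⟨Z, hZ⟩
        obtain ⟨a, b, hab⟩ := hZ.1.edge
        exact absurd (hZ.2.1 hab) (by simp)
      have h2 : Nat.card (⊥ : SimpleGraph V).ConnectedComponent = Fintype.card V := by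
        rw [Fintype.card_eq_nat_card]
        symm
        apply Nat.card_eq_of_bijective (fun v => (⊥ : SimpleGraph V).connectedComponentMk v)
        constructor
        · intro x y hxy
          have := ConnectedComponent.eq.1 hxy
          rwa [reachable_bot] at this
        · intro c
          induction c using ConnectedComponent.ind with | _ x
          exact ⟨x, rfl⟩
      unfold exc cyclomatic
      rw [h1, h2, hn]; simp
  | succ n ih =>
    intro H hn hD
    have hpos : ∀ K : SimpleGraph V, K.edgeSet.ncard = n → DE K → 0 ≤ exc K := by
      intro K hK hDK
      by_cases h : ∃ Z, OC K Z
      · have := (ih K hK hDK).1 h; omega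
      · exact ((ih K hK hDK).2 h).ge
    constructor
    · rintro ⟨Γ, hΓ⟩
      obtain ⟨a, b, hab, hno⟩ := odd_edge hD hΓ
      have h0 := hΓ.2.1 hab
      have h1 := exc_odd h0 ⟨Γ, hΓ.1, hΓ.2.1, hab⟩ hno
      have h2 := de_edges h0
      have h3 := hpos (de H a b) (by omega) (hD.mono (de_le _ _ _))
      omega
    · intro hno
      have : H.edgeSet.Nonempty := by
        rw [← Set.ncard_pos (Set.toFinite _)]; omega
      obtain ⟨e, he⟩ := this
      induction e using Sym2.ind with | _ a b
      rw [mem_edgeSet] at he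
      have h2 := de_edges he
      have h3 := (ih (de H a b) (by omega) (hD.mono (de_le _ _ _))).2
        (fun ⟨Z, hZ⟩ => hno ⟨Z, hZ.1, hZ.2.1.trans (de_le _ _ _), hZ.2.2⟩)
      by_cases h : ∃ Z, IsCyc Z ∧ Z ≤ H ∧ Z.Adj a b
      · obtain ⟨Z, h1, h2, h4⟩ := h
        have hev : EC H Z := ⟨h1, h2, by
          rw [← Nat.not_odd_iff_even]; exact fun ho => hno ⟨Z, h1, h2, ho⟩⟩
        rw [← exc_even hD hev h4]; exact h3
      · rw [← exc_bridge he h]; exact h3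

lemma cyc_eq_kp {H : SimpleGraph V} (hD : DE H) (h : ¬ ∃ Z, OC H Z) : cyclomatic H = kp H := by
  have := (exc_main _ H rfl hD).2 h
  unfold exc at this; omega

def Unic (G : SimpleGraph V) : Prop := ∀ H ≤ G, ∀ a b, (∃ Γ, OC H Γ ∧ Γ.Adj a b) →
  (¬ ∃ Z, EC H Z ∧ Z.Adj a b) → ∀ Γ', OC H Γ' → Γ'.Adj a b

lemma unic_of_exc {G : SimpleGraph V} (hD : DE G) (h : exc G = 1) : Unic G := by
  rintro H hle a b ⟨Γ, hΓ, hab⟩ hno Γ' hΓ'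
  by_contra hc
  have hDH := hD.mono hle
  have h1 := exc_odd (hΓ.2.1 hab) ⟨Γ, hΓ.1, hΓ.2.1, hab⟩ hno
  have h2 := (exc_main _ (de H a b) rfl (hDH.mono (de_le _ _ _))).1 ⟨Γ', hΓ'.1, le_de hΓ'.2.1 hc, hΓ'.2.2⟩
  have h3 := exc_mono _ rfl hD hle
  omega

lemma Unic.mono {G H : SimpleGraph V} (h : Unic G) (hle : H ≤ G) : Unic H :=
  fun K hK => h K (hK.trans hle)

lemma map_comap_of_le_map {W : Type*} (φ : W ↪ V) {H : SimpleGraph W} {Z : SimpleGraph V} (h : Z ≤ H.map φ) :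
    (Z.comap φ).map φ = Z ∧ Z.comap φ ≤ H := by
  have h1 : Z ≤ rs (H.map φ) (Set.range φ) := by
    intro a b hab
    have := h hab
    refine ⟨this, ?_⟩
    rw [map_adj] at this
    obtain ⟨u, v, _, rfl, rfl⟩ := this
    exact ⟨⟨u, rfl⟩, ⟨v, rfl⟩⟩
  refine ⟨map_comap_of_le φ h1, ?_⟩
  intro a b hab
  have := h hab
  rwa [map_adj_apply] at this

lemma Unic.comap {W : Type*} (φ : W ↪ V) {G : SimpleGraph V} (h : Unic G) : Unic (G.comap φ) := by
  rintro H hle a b ⟨Γ, hΓ, hab⟩ hno Γ' hΓ'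
  have h1 : H.map φ ≤ G := map_le_iff_le_comap φ _ _ |>.2 hle
  have h2 : ∀ Z, OC H Z → OC (H.map φ) (Z.map φ) := fun Z hZ =>
    ⟨(isCyc_map φ).2 hZ.1, map_monotone φ hZ.2.1, by rw [map_ncard]; exact hZ.2.2⟩
  have := h (H.map φ) h1 (φ a) (φ b) ⟨Γ.map φ, h2 _ hΓ, by rwa [map_adj_apply]⟩ ?_ (Γ'.map φ) (h2 _ hΓ')
  · rwa [map_adj_apply] at this
  · rintro ⟨Z, hZ, hh⟩
    obtain ⟨e1, e2⟩ := map_comap_of_le_map φ hZ.2.1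
    refine hno ⟨Z.comap φ, ⟨?_, e2, ?_⟩, hh⟩
    · rw [← isCyc_map φ, e1]; exact hZ.1
    · rw [← map_ncard φ, e1]; exact hZ.2.2

end Excess


section Sig
open SimpleGraph

lemma I_zpow (n : ℤ) : Complex.I ^ n = -1 ↔ n % 4 = 2 := by
  have h1 : Complex.I ^ n = Complex.I ^ (n % 4) := by
    conv_lhs => rw [← Int.emod_add_mul_ediv n 4]
    rw [zpow_add₀ Complex.I_ne_zero, zpow_mul]
    have : Complex.I ^ (4 : ℤ) = 1 := by
      rw [show (4 : ℤ) = ((4 : ℕ) : ℤ) from rfl, zpow_natCast, Complex.I_pow_four]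
    rw [this, one_zpow, mul_one]
  rw [h1]
  have h2 : 0 ≤ n % 4 := Int.emod_nonneg _ (by norm_num)
  have h3 : n % 4 < 4 := Int.emod_lt_of_pos _ (by norm_num)
  have hI : Complex.I ≠ -1 := by
    intro h; have := congrArg Complex.re h; simp at this
  generalize n % 4 = m at *
  interval_cases m
  · simp; norm_num
  · simpa using hI
  · have : Complex.I ^ (2 : ℤ) = -1 := by
      have := zpow_natCast Complex.I 2
      rw [Complex.I_sq] at this
      exact_mod_cast this
    simp [this]
  · have : Complex.I ^ (3 : ℤ) = -Complex.I := by
      rw [show (3 : ℤ) = ((3 : ℕ) : ℤ) from rfl, zpow_natCast, Complex.I_pow_three]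
    rw [this]
    simp only [neg_inj]
    constructor
    · intro h; have := congrArg Complex.re h; simp at this
    · intro h; omega

lemma neg_one_pow_I (t : ℕ) : ((-1 : ℂ)) ^ t = Complex.I ^ (2 * (t : ℤ)) := by
  have : Complex.I ^ (2 : ℤ) = -1 := (I_zpow 2).2 rfl
  rw [zpow_mul, this, zpow_natCast]

variable [Fintype V] [DecidableEq V] (M : MixedGraph V)

def sgz {a b : V} (p : M.graph.Walk a b) : ℤ :=
  (p.darts.countP fun d => M.arc d.toProd.1 d.toProd.2 : ℤ) -
    (p.darts.countP fun d => M.arc d.toProd.2 d.toProd.1 : ℤ)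

lemma walkSig_eq {a : V} (p : M.graph.Walk a a) : walkSignature M p = (sgz M p).natAbs := rfl

lemma hol_eq {a b : V} (p : M.graph.Walk a b) : hol M.hMatrix p = Complex.I ^ (sgz M p) ∧
    holr M.hMatrix p = Complex.I ^ (-sgz M p) := by
  induction p with
  | nil => simp [hol, holr, sgz]
  | @cons u v w h p ih =>
    have key : sgz M (Walk.cons h p) = (if M.arc u v then 1 else if M.arc v u then -1 else 0) + sgz M p := by
      simp only [sgz, Walk.darts_cons, List.countP_cons]
      have h' := M.arc_antisymm
      by_cases h1 : M.arc u v
      · have := h' _ _ h1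
        simp [h1, this]; ring
      · by_cases h2 : M.arc v u
        · simp [h1, h2]; ring
        · simp [h1, h2]
    have k1 : M.hMatrix u v = Complex.I ^ ((if M.arc u v then 1 else if M.arc v u then -1 else 0 : ℤ)) := by
      simp only [MixedGraph.hMatrix]
      split_ifs <;> simp
    have k2 : M.hMatrix v u = Complex.I ^ (-(if M.arc u v then 1 else if M.arc v u then -1 else 0 : ℤ)) := by
      rw [hM_conj, k1]
      split_ifs <;> simp
    constructor
    · rw [hol, ih.1, key, zpow_add₀ Complex.I_ne_zero, k1]
    · rw [holr, ih.2, key, neg_add, zpow_add₀ Complex.I_ne_zero, k2]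

lemma hol_append {G : SimpleGraph V} (A : Matrix V V ℂ) {a b c : V} (p : G.Walk a b) (q : G.Walk b c) :
    hol A (p.append q) = hol A p * hol A q := by
  induction p with
  | nil => simp [hol]
  | cons h p ih => rw [Walk.cons_append, hol, hol, ih]; ring

lemma hol_reverse {G : SimpleGraph V} (A : Matrix V V ℂ) {a b : V} (p : G.Walk a b) :
    hol A p.reverse = holr A p := by
  induction p with
  | nil => simp [hol, holr]
  | cons h p ih => rw [Walk.reverse_cons, hol_append, ih, holr, hol, hol]; ring

lemma oddcyc_rank {u : V} (w : M.graph.Walk u u) (hw : w.IsCycle) (ho : Odd w.length) :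
    ∃ δ : ℂ, (δ = 0 ↔ Odd (walkSignature M w)) ∧ ∀ R : Matrix V V ℂ,
      (∀ v ∈ w.support, v ≠ u → ∀ j, R v j = 0 ∧ R j v = 0) →
      (R + pm M.hMatrix w).rank + 1 = (R + Matrix.single u u δ).rank + w.length := by
  cases w with
  | nil => simp at hw
  | @cons _ v _ h p =>
    rw [Walk.cons_isCycle_iff] at hw
    rw [Walk.length_cons] at ho
    obtain ⟨t, ht⟩ : ∃ t, p.length = 2 * t := by
      obtain ⟨k, hk⟩ := ho; exact ⟨k, by omega⟩
    refine ⟨(-1) ^ t * (M.hMatrix u v * hol M.hMatrix p) + (-1) ^ t * (M.hMatrix v u * holr M.hMatrix p), ?_, ?_⟩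
    · rw [show M.hMatrix u v * hol M.hMatrix p = hol M.hMatrix (Walk.cons h p) from rfl,
        show M.hMatrix v u * holr M.hMatrix p = holr M.hMatrix (Walk.cons h p) from rfl,
        (hol_eq M _).1, (hol_eq M _).2, walkSig_eq]
      generalize sgz M (Walk.cons h p) = s
      rw [← mul_add]
      have h1 : ((-1 : ℂ)) ^ t ≠ 0 := pow_ne_zero _ (by norm_num)
      rw [mul_eq_zero, or_iff_right h1]
      have h2 : Complex.I ^ s + Complex.I ^ (-s) = Complex.I ^ (-s) * (Complex.I ^ (2 * s) + 1) := by
        rw [mul_add, ← zpow_add₀ Complex.I_ne_zero]; ring_nf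
      rw [h2, mul_eq_zero, or_iff_right (zpow_ne_zero _ Complex.I_ne_zero), add_eq_zero_iff_eq_neg, I_zpow,
        Int.natAbs_odd, Int.odd_iff]
      omega
    · intro R hR
      have := rank_contract M.hMatrix M.graph (fun i j h => hM_adj M h) t p hw.1 ht u (fun _ => rfl)
        (M.hMatrix u v) (M.hMatrix v u) R (fun x hx hxu => hR x (by simp [hx]) hxu)
      rw [show R + pm M.hMatrix (Walk.cons h p) = R + ed u v (M.hMatrix u v) (M.hMatrix v u) + pm M.hMatrix p by
        rw [pm, add_assoc], this, ed, ← Matrix.single_add, Walk.length_cons]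
      omega

lemma evcyc_rank {u : V} (w : M.graph.Walk u u) (hw : w.IsCycle) (ho : Even w.length) :
    ∃ (b : V) (z z' : ℂ), b ≠ u ∧ (z = 0 ↔ walkSignature M w % 4 = w.length % 4) ∧
      (z' = 0 ↔ walkSignature M w % 4 = w.length % 4) ∧ ∀ R : Matrix V V ℂ,
      (∀ v ∈ w.support, v ≠ u → ∀ j, R v j = 0 ∧ R j v = 0) →
      (R + pm M.hMatrix w).rank + 2 = (R + ed u b z z').rank + w.length := by
  cases w with
  | nil => simp at hw
  | @cons _ b _ h p =>
    rw [Walk.cons_isCycle_iff] at hw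
    rw [Walk.length_cons] at ho
    cases p with
    | nil => simp at h
    | @cons _ c _ h' p =>
      rw [Walk.length_cons] at ho
      obtain ⟨t, ht⟩ : ∃ t, p.length = 2 * t := by
        obtain ⟨k, hk⟩ := ho; exact ⟨k - 1, by omega⟩
      set A := M.hMatrix with hA
      have hpath := (Walk.cons_isPath_iff _ _).1 hw.1
      have hkey : ∀ s : ℤ, (1 + (-1 : ℂ) ^ t * Complex.I ^ s = 0 ↔ s.natAbs % 4 = (p.length + 1 + 1) % 4) := by
        intro s
        rw [neg_one_pow_I, ← zpow_add₀ Complex.I_ne_zero, add_comm, add_eq_zero_iff_eq_neg, I_zpow, ht]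
        omega
      have e1 := (hol_eq M (Walk.cons h (Walk.cons h' p))).1
      have e2 := (hol_eq M (Walk.cons h (Walk.cons h' p))).2
      rw [hol, ← hA] at e1
      rw [holr, ← hA] at e2
      have hub := hM_adj M h
      rw [← hA] at hub
      have hn1 := hM_ne M h
      have hn2 := hM_ne M h.symm
      rw [← hA] at hn1 hn2
      refine ⟨b, A u b + (-1) ^ t * holr A (Walk.cons h' p), A b u + (-1) ^ t * hol A (Walk.cons h' p), h.ne', ?_, ?_, ?_⟩
      · rw [walkSig_eq, Walk.length_cons, Walk.length_cons, ← Int.natAbs_neg, ← hkey, ← e2,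
          show 1 + (-1 : ℂ) ^ t * (A b u * holr A (Walk.cons h' p)) =
            A b u * (A u b + (-1 : ℂ) ^ t * holr A (Walk.cons h' p)) by rw [← hub]; ring, mul_eq_zero, or_iff_right hn2]
      · rw [walkSig_eq, Walk.length_cons, Walk.length_cons, ← hkey, ← e1,
          show 1 + (-1 : ℂ) ^ t * (A u b * hol A (Walk.cons h' p)) =
            A u b * (A b u + (-1 : ℂ) ^ t * hol A (Walk.cons h' p)) by rw [← hub]; ring, mul_eq_zero, or_iff_right hn1]
      · intro R hR
        have := rank_contract A M.graph (fun i j h => hM_adj M h) t p hpath.1 ht b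
          (fun hb => absurd hb hpath.2)
          (A b c) (A c b) (R + ed u b (A u b) (A b u)) (fun x hx hxu j => by
            have hxb : x ≠ b := fun hh => hpath.2 (hh ▸ hx)
            have := hR x (by simp [hx]) hxu j
            simp [ed_apply, this, hxb.symm, Ne.symm hxu])
        have e3 : R + pm A (Walk.cons h (Walk.cons h' p)) =
          R + ed u b (A u b) (A b u) + ed b c (A b c) (A c b) + pm A p := by
          rw [pm, pm]; abel
        rw [e3, this]
        have e4 : R + ed u b (A u b) (A b u) + ed b u ((-1) ^ t * (A b c * hol A p)) ((-1) ^ t * (A c b * holr A p)) =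
          R + ed u b (A u b + (-1) ^ t * holr A (Walk.cons h' p)) (A b u + (-1) ^ t * hol A (Walk.cons h' p)) := by
          simp only [ed, hol, holr, Matrix.single_add]; abel
        rw [e4, Walk.length_cons, Walk.length_cons]; omega

/-- matrix of a subgraph -/
noncomputable def zm (Z : SimpleGraph V) : Matrix V V ℂ :=
  Matrix.of fun i j => if Z.Adj i j then M.hMatrix i j else 0

lemma pm_eq_zm {G : SimpleGraph V} {a b : V} (w : G.Walk a b) (hw : w.IsTrail) : pm M.hMatrix w = zm M (wg w) := by
  ext i j
  rw [pm_apply _ _ hw, zm, Matrix.of_apply]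
  simp only [wg_adj]

lemma zm_top : zm M M.graph = M.hMatrix := by
  ext i j
  rw [zm, Matrix.of_apply]
  split_ifs with h
  · rfl
  · exact (hM_zero M h).symm

def OS (Z : SimpleGraph V) : Prop := (zm M Z).rank + 1 = Z.support.ncard
def BS (Z : SimpleGraph V) : Prop := (zm M Z).rank + 2 = Z.support.ncard

lemma rank_single_self (u : V) (δ : ℂ) (h : δ ≠ 0) : (Matrix.single u u δ : Matrix V V ℂ).rank = 1 := by
  rw [← Matrix.diagonal_single, Matrix.rank_diagonal, Fintype.card_subtype]
  rw [Finset.card_eq_one]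
  refine ⟨u, ?_⟩
  ext x
  by_cases hx : x = u
  · subst hx; simp [h]
  · simp [hx]

lemma rank_zero_iff {A : Matrix V V ℂ} : A.rank = 0 ↔ A = 0 := by
  constructor
  · intro h
    unfold Matrix.rank at h
    rw [Submodule.finrank_eq_zero, LinearMap.range_eq_bot] at h
    ext i j
    have := congrFun (LinearMap.congr_fun h (Pi.single j 1)) i
    simpa using this
  · rintro rfl; simp

lemma rank_pos_of_ne {A : Matrix V V ℂ} (h : A ≠ 0) : 1 ≤ A.rank := by
  rw [Nat.one_le_iff_ne_zero]
  intro h0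
  exact h (rank_zero_iff.1 h0)

lemma os_iff {u : V} (w : M.graph.Walk u u) (hw : w.IsCycle) (ho : Odd w.length) :
    OS M (wg w) ↔ Odd (walkSignature M w) := by
  obtain ⟨δ, h1, h2⟩ := oddcyc_rank M w hw ho
  have h3 := h2 0 (by simp)
  rw [zero_add, zero_add, pm_eq_zm M w hw.isTrail] at h3
  unfold OS
  rw [cycle_ncard w hw, h3, ← h1]
  constructor
  · intro h
    by_contra hc
    rw [rank_single_self u δ hc] at h; omega
  · rintro rfl
    simp

lemma bs_iff {u : V} (w : M.graph.Walk u u) (hw : w.IsCycle) (ho : Even w.length) :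
    BS M (wg w) ↔ walkSignature M w % 4 = w.length % 4 := by
  obtain ⟨b, z, z', hb, h1, h1', h2⟩ := evcyc_rank M w hw ho
  have h3 := h2 0 (by simp)
  rw [zero_add, zero_add, pm_eq_zm M w hw.isTrail] at h3
  unfold BS
  rw [cycle_ncard w hw, h3, ← h1]
  constructor
  · intro h
    by_contra hc
    have : (ed u b z z') ≠ 0 := by
      intro h0
      have := congrFun (congrFun h0 u) b
      simp [ed_apply, hb, hc] at this
    have := rank_pos_of_ne this
    omega
  · intro h
    have : z' = 0 := h1'.2 (h1.1 h)
    subst this; subst h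
    simp [ed]

lemma cycleSig_iff {C : M.graph.Subgraph} (hC : IsCycleSubgraph C) (P : ℕ → Prop) :
    CycleSig M C P ↔ ∃ (u : V) (w : M.graph.Walk u u), w.IsCycle ∧ wg w = C.spanningCoe ∧ P (walkSignature M w) := by
  constructor
  · rintro ⟨u, w, h1, h2, h3, h4⟩
    refine ⟨u, w, h1, ?_, h4⟩
    ext x y
    rw [wg_adj, Subgraph.spanningCoe_adj, ← Subgraph.mem_edgeSet, ← h3]; rfl
  · rintro ⟨u, w, h1, h2, h4⟩
    refine ⟨u, w, h1, ?_, ?_, h4⟩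
    · rw [← (isCyc_of_sub hC).2, ← h2]
      ext x
      rw [wg_supp w h1.not_nil]; rfl
    · ext e
      induction e using Sym2.ind with | _ x y
      rw [Subgraph.mem_edgeSet, ← Subgraph.spanningCoe_adj, ← h2, wg_adj]; rfl

lemma cyc_walk {Z : SimpleGraph V} (hZ : IsCyc Z) (hle : Z ≤ M.graph) :
    ∃ (u : V) (w : M.graph.Walk u u), w.IsCycle ∧ wg w = Z := by
  obtain ⟨a, b, hab⟩ := hZ.edge
  exact ⟨a, hZ.exists_walk' hle (mem_supp_l hab)⟩

lemma cycleSig_odd {C : M.graph.Subgraph} (hC : IsCycleSubgraph C) (ho : Odd C.verts.ncard) :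
    CycleSig M C Odd ↔ OS M C.spanningCoe := by
  rw [cycleSig_iff M hC]
  have hs := (isCyc_of_sub hC).2
  constructor
  · rintro ⟨u, w, h1, h2, h3⟩
    rw [← h2, os_iff M w h1]
    · exact h3
    · rw [← cycle_ncard w h1, h2, hs]; exact ho
  · intro h
    obtain ⟨u, w, h1, h2⟩ := cyc_walk M (isCyc_of_sub hC).1 (Subgraph.spanningCoe_le C)
    refine ⟨u, w, h1, h2, ?_⟩
    rw [← h2, os_iff M w h1] at h
    · exact h
    · rw [← cycle_ncard w h1, h2, hs]; exact ho

lemma cycleSig_even {C : M.graph.Subgraph} (hC : IsCycleSubgraph C) (ho : Even C.verts.ncard)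
    (P : ℕ → Prop) (hP : ∀ s, P s ↔ s % 4 = C.verts.ncard % 4) :
    CycleSig M C P ↔ BS M C.spanningCoe := by
  rw [cycleSig_iff M hC]
  have hs := (isCyc_of_sub hC).2
  constructor
  · rintro ⟨u, w, h1, h2, h3⟩
    have h4 : w.length = C.verts.ncard := by rw [← cycle_ncard w h1, h2, hs]
    rw [← h2, bs_iff M w h1 (h4 ▸ ho), h4, ← hP]
    exact h3
  · intro h
    obtain ⟨u, w, h1, h2⟩ := cyc_walk M (isCyc_of_sub hC).1 (Subgraph.spanningCoe_le C)
    have h4 : w.length = C.verts.ncard := by rw [← cycle_ncard w h1, h2, hs]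
    refine ⟨u, w, h1, h2, ?_⟩
    rw [← h2, bs_iff M w h1 (h4 ▸ ho), h4, ← hP] at h
    exact h

/-- gate lemma -/
lemma gate_rank {Γ : SimpleGraph V} (hΓ : OC M.graph Γ) (hos : OS M Γ) {x : V} (hx : x ∈ Γ.support)
    (R : Matrix V V ℂ) (hR : ∀ v ∈ Γ.support, v ≠ x → ∀ j, R v j = 0 ∧ R j v = 0) :
    (R + zm M Γ).rank + 1 = R.rank + Γ.support.ncard := by
  obtain ⟨w, h1, h2⟩ := hΓ.1.exists_walk' hΓ.2.1 hx
  have hl : w.length = Γ.support.ncard := by rw [← cycle_ncard w h1, h2]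
  have ho : Odd w.length := hl ▸ hΓ.2.2
  obtain ⟨δ, h3, h4⟩ := oddcyc_rank M w h1 ho
  rw [← h2, os_iff M w h1 ho, ← h3] at hos
  subst hos
  have := h4 R (fun v hv => hR v (by rw [← h2, wg_supp w h1.not_nil]; exact hv))
  rw [pm_eq_zm M w h1.isTrail, h2, Matrix.single_zero, add_zero, hl] at this
  exact this

/-- infinity lemma -/
lemma inf_rank {C Γ : SimpleGraph V} (hC : EC M.graph C) (hΓ : OC M.graph Γ) {x : V} (hx : x ∈ Γ.support)
    (hx' : x ∈ C.support) (hd : ∀ v, v ∈ C.support → v ∈ Γ.support → v = x) :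
    ((zm M C + zm M Γ).rank + 3 = C.support.ncard + Γ.support.ncard) ↔ OS M Γ ∧ BS M C := by
  obtain ⟨w, h1, h2⟩ := hΓ.1.exists_walk' hΓ.2.1 hx
  have hl : w.length = Γ.support.ncard := by rw [← cycle_ncard w h1, h2]
  have ho : Odd w.length := hl ▸ hΓ.2.2
  obtain ⟨δ, h3, h4⟩ := oddcyc_rank M w h1 ho
  obtain ⟨w', h1', h2'⟩ := hC.1.exists_walk' hC.2.1 hx'
  have hl' : w'.length = C.support.ncard := by rw [← cycle_ncard w' h1', h2']
  have ho' : Even w'.length := hl' ▸ hC.2.2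
  obtain ⟨b, z, z', hb, h3', h3'', h4'⟩ := evcyc_rank M w' h1' ho'
  rw [← h2, ← h2', os_iff M w h1 ho, bs_iff M w' h1' ho', ← h3, ← h3', h2, h2']
  have k1 := h4 (zm M C) (fun v hv hvx j => by
    have hv' : v ∉ C.support := fun hh => hvx (hd v hh (by rw [← h2, wg_supp w h1.not_nil]; exact hv))
    simp only [zm, Matrix.of_apply]
    exact ⟨if_neg fun hh => hv' (mem_supp_l hh), if_neg fun hh => hv' (mem_supp_r hh)⟩)
  have k2 := h4' (Matrix.single x x δ) (fun v hv hvx j => by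
    simp [Matrix.single_apply, Ne.symm hvx])
  rw [pm_eq_zm M w h1.isTrail, h2, hl] at k1
  rw [pm_eq_zm M w' h1'.isTrail, h2', hl', add_comm (Matrix.single x x δ) (zm M C)] at k2
  have k3 : (zm M C + zm M Γ).rank + 3 = C.support.ncard + Γ.support.ncard ↔
    (Matrix.single x x δ + ed x b z z').rank = 0 := by omega
  rw [k3, rank_zero_iff]
  constructor
  · intro h
    have e1 := congrFun (congrFun h x) x
    have e2 := congrFun (congrFun h x) b
    simp [ed_apply, hb, Ne.symm hb, Matrix.single_apply] at e1 e2
    exact ⟨e1, e2⟩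
  · rintro ⟨rfl, e⟩
    have : z' = 0 := h3''.2 (h3'.1 e)
    subst this; subst e
    simp [ed]

end Sig


section Theta
open SimpleGraph
variable [Fintype V] [DecidableEq V] (M : MixedGraph V)

lemma pm_zero_of_notMem {G : SimpleGraph V} {a b : V} (p : G.Walk a b) (A : Matrix V V ℂ) {i : V} (h : i ∉ p.support) (j : V) :
    pm A p i j = 0 ∧ pm A p j i = 0 := by
  constructor
  · exact pm_apply_of_notMem A p i j fun hh => h (p.fst_mem_support_of_mem_edges hh)
  · exact pm_apply_of_notMem A p j i fun hh => h (p.snd_mem_support_of_mem_edges hh)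

lemma n4_rank {a b c d : V} (hab : a ≠ b) (hac : a ≠ c) (had : a ≠ d) (hbc : b ≠ c) (hbd : b ≠ d) (hcd : c ≠ d)
    (α α' k k' β β' l l' γ γ' : ℂ) (hα : α ≠ 0) (hα' : α' ≠ 0) :
    (ed a b α α' + ed a c k k' + ed c b β β' + ed a d l l' + ed d b γ γ').rank = 2 ↔
      (k' * β' / α' + β * k / α = 0 ∧ l' * γ' / α' + γ * l / α = 0 ∧ k' * γ' / α' + β * l / α = 0 ∧
        l' * β' / α' + γ * k / α = 0) := by
  set N := ed a b α α' + ed a c k k' + ed c b β β' + ed a d l l' + ed d b γ γ' with hN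
  have Nap : ∀ i j, N i j = ed a b α α' i j + ed a c k k' i j + ed c b β β' i j + ed a d l l' i j + ed d b γ γ' i j := fun i j => rfl
  simp only [ed_apply] at Nap
  have Nab : N a b = α := by rw [Nap]; simp [hab, hac, had, hbc, hbd, hcd, hab.symm, hac.symm, had.symm, hbc.symm, hbd.symm, hcd.symm]
  have Nba : N b a = α' := by rw [Nap]; simp [hab, hac, had, hbc, hbd, hcd, hab.symm, hac.symm, had.symm, hbc.symm, hbd.symm, hcd.symm]
  have Naa : N a a = 0 := by rw [Nap]; simp [hab, hac, had, hbc, hbd, hcd, hab.symm, hac.symm, had.symm, hbc.symm, hbd.symm, hcd.symm]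
  have Nbb : N b b = 0 := by rw [Nap]; simp [hab, hac, had, hbc, hbd, hcd, hab.symm, hac.symm, had.symm, hbc.symm, hbd.symm, hcd.symm]
  rw [rank_pivot2 N a b (by rw [Nab]; exact hα) (by rw [Nba]; exact hα') Naa Nbb]
  rw [show ∀ n : ℕ, n + 2 = 2 ↔ n = 0 from fun n => by omega, rank_zero_iff]
  have key : ∀ x y, (x = c ∨ x = d) → (y = c ∨ y = d) → N x y = 0 := by
    rintro x y (rfl | rfl) (rfl | rfl) <;> rw [Nap] <;> simp [hab, hac, had, hbc, hbd, hcd, hab.symm, hac.symm, had.symm, hbc.symm, hbd.symm, hcd.symm]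
  have Nca : N c a = k' := by rw [Nap]; simp [hab, hac, had, hbc, hbd, hcd, hab.symm, hac.symm, had.symm, hbc.symm, hbd.symm, hcd.symm]
  have Nac : N a c = k := by rw [Nap]; simp [hab, hac, had, hbc, hbd, hcd, hab.symm, hac.symm, had.symm, hbc.symm, hbd.symm, hcd.symm]
  have Ncb : N c b = β := by rw [Nap]; simp [hab, hac, had, hbc, hbd, hcd, hab.symm, hac.symm, had.symm, hbc.symm, hbd.symm, hcd.symm]
  have Nbc : N b c = β' := by rw [Nap]; simp [hab, hac, had, hbc, hbd, hcd, hab.symm, hac.symm, had.symm, hbc.symm, hbd.symm, hcd.symm]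
  have Nda : N d a = l' := by rw [Nap]; simp [hab, hac, had, hbc, hbd, hcd, hab.symm, hac.symm, had.symm, hbc.symm, hbd.symm, hcd.symm]
  have Nad : N a d = l := by rw [Nap]; simp [hab, hac, had, hbc, hbd, hcd, hab.symm, hac.symm, had.symm, hbc.symm, hbd.symm, hcd.symm]
  have Ndb : N d b = γ := by rw [Nap]; simp [hab, hac, had, hbc, hbd, hcd, hab.symm, hac.symm, had.symm, hbc.symm, hbd.symm, hcd.symm]
  have Nbd : N b d = γ' := by rw [Nap]; simp [hab, hac, had, hbc, hbd, hcd, hab.symm, hac.symm, had.symm, hbc.symm, hbd.symm, hcd.symm]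
  have Nout : ∀ x, x ≠ a → x ≠ b → x ≠ c → x ≠ d → ∀ y, N x y = 0 ∧ N y x = 0 := by
    intro x h1 h2 h3 h4 y
    constructor <;> rw [Nap] <;> simp [h1.symm, h2.symm, h3.symm, h4.symm]
  have sgn : ∀ x y : ℂ, 0 - x - y = 0 ↔ x + y = 0 := by
    intro x y
    rw [show (0 : ℂ) - x - y = -(x + y) by ring, neg_eq_zero]
  have Kc : ∀ x y, (x = c ∨ x = d) → (y = c ∨ y = d) →
     ((N x y - N x a * N b y / N b a - N x b * N a y / N a b = 0) ↔ N x a * N b y / N b a + N x b * N a y / N a b = 0) := by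
    intro x y hx hy
    rw [key x y hx hy, sgn]
  constructor
  · intro h
    have h' : ∀ x y, N x y - N x a * N b y / N b a - N x b * N a y / N a b = 0 := fun x y =>
      congrFun (congrFun h x) y
    have e1 := (Kc c c (Or.inl rfl) (Or.inl rfl)).1 (h' c c)
    have e2 := (Kc d d (Or.inr rfl) (Or.inr rfl)).1 (h' d d)
    have e3 := (Kc c d (Or.inl rfl) (Or.inr rfl)).1 (h' c d)
    have e4 := (Kc d c (Or.inr rfl) (Or.inl rfl)).1 (h' d c)
    rw [Nca, Nbc, Ncb, Nac, Nab, Nba] at e1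
    rw [Nda, Nbd, Ndb, Nad, Nab, Nba] at e2
    rw [Nca, Nbd, Ncb, Nad, Nab, Nba] at e3
    rw [Nda, Nbc, Ndb, Nac, Nab, Nba] at e4
    exact ⟨e1, e2, e3, e4⟩
  · rintro ⟨e1, e2, e3, e4⟩
    ext x y
    rw [Matrix.of_apply, Matrix.zero_apply]
    by_cases hxa : x = a
    · subst hxa; rw [Naa, Nab]; field_simp; ring
    by_cases hxb : x = b
    · subst hxb; rw [Nbb, Nba]; field_simp; ring
    by_cases hya : y = a
    · subst hya; rw [Naa, Nba]; field_simp; ring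
    by_cases hyb : y = b
    · subst hyb; rw [Nbb, Nab]; field_simp; ring
    by_cases hx : x = c ∨ x = d
    · by_cases hy : y = c ∨ y = d
      · rw [Kc x y hx hy, Nab, Nba]
        rcases hx with rfl | rfl <;> rcases hy with rfl | rfl
        · rw [Nca, Nbc, Ncb, Nac]; exact e1
        · rw [Nca, Nbd, Ncb, Nad]; exact e3
        · rw [Nda, Nbc, Ndb, Nac]; exact e4
        · rw [Nda, Nbd, Ndb, Nad]; exact e2
      · push Not at hy
        have := Nout y hya hyb hy.1 hy.2
        rw [(this x).2, (this b).2, (this a).2]; simp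
    · push Not at hx
      have := Nout x hxa hxb hx.1 hx.2
      rw [(this y).1, (this a).1, (this b).1]; simp

lemma path_contract2 {a b : V} (W : M.graph.Walk a b) (hW : W.IsPath) (he : Even W.length) (hab : a ≠ b) :
    ∃ (c : V) (t : ℕ) (K B : ℤ), c ∈ W.support ∧ c ≠ a ∧ c ≠ b ∧ W.length = 2 * t + 2 ∧ K + B = 2 * t + sgz M W ∧
      ∀ R : Matrix V V ℂ, (∀ v ∈ W.support, v ≠ a → v ≠ b → ∀ j, R v j = 0 ∧ R j v = 0) →
        (R + pm M.hMatrix W).rank = (R + ed a c (Complex.I ^ K) (Complex.I ^ (-K)) +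
          ed c b (Complex.I ^ B) (Complex.I ^ (-B))).rank + 2 * t := by
  cases W with
  | nil => exact absurd rfl hab
  | @cons _ c _ h p =>
    cases p with
    | nil => simp at he
    | @cons _ d _ h' p =>
      have hp1 := (Walk.cons_isPath_iff _ _).1 hW
      have hp2 := (Walk.cons_isPath_iff _ _).1 hp1.1
      rw [Walk.length_cons, Walk.length_cons] at he ⊢
      obtain ⟨t, ht⟩ : ∃ t, p.length = 2 * t := by
        obtain ⟨k, hk⟩ := he; exact ⟨k - 1, by omega⟩
      have hcb : c ≠ b := fun hh => hp2.2 (hh ▸ p.end_mem_support)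
      have key := (hol_eq M (Walk.cons h Walk.nil))
      simp only [hol, holr, mul_one] at key
      have key2 := (hol_eq M (Walk.cons h' p))
      have hsum : sgz M (Walk.cons h (Walk.cons h' p)) = sgz M (Walk.cons h Walk.nil) + sgz M (Walk.cons h' p) := by
        simp only [sgz, Walk.darts_cons, List.countP_cons, Walk.darts_nil, List.countP_nil]
        push_cast; ring
      refine ⟨c, t, sgz M (Walk.cons h Walk.nil), 2 * t + sgz M (Walk.cons h' p), by simp, h.ne', hcb, by omega, by rw [hsum]; ring, ?_⟩
      intro R hR
      have := rank_contract M.hMatrix M.graph (fun i j h => hM_adj M h) t p hp2.1 ht c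
          (fun hb => absurd hb hp2.2)
          (M.hMatrix c d) (M.hMatrix d c) (R + ed a c (M.hMatrix a c) (M.hMatrix c a)) (fun x hx hxu j => by
            have hxc : x ≠ c := fun hh => hp2.2 (hh ▸ hx)
            have hxa : x ≠ a := fun hh => hp1.2 (by rw [Walk.support_cons]; exact List.mem_cons_of_mem _ (hh ▸ hx))
            have := hR x (by simp [hx]) hxa hxu j
            simp [ed_apply, this, hxc.symm, Ne.symm hxa])
      have e3 : R + pm M.hMatrix (Walk.cons h (Walk.cons h' p)) =
          R + ed a c (M.hMatrix a c) (M.hMatrix c a) + ed c d (M.hMatrix c d) (M.hMatrix d c) + pm M.hMatrix p := by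
          rw [pm, pm]; abel
      rw [e3, this]
      rw [show M.hMatrix c d * hol M.hMatrix p = hol M.hMatrix (Walk.cons h' p) from rfl,
        show M.hMatrix d c * holr M.hMatrix p = holr M.hMatrix (Walk.cons h' p) from rfl, key.1, key.2, key2.1, key2.2]
      have e5 : ((-1 : ℂ)) ^ t = Complex.I ^ (-(2 * (t : ℤ))) := by
        rw [zpow_neg, ← neg_one_pow_I, ← inv_pow]; norm_num
      rw [neg_add, zpow_add₀ Complex.I_ne_zero, zpow_add₀ Complex.I_ne_zero, ← e5, ← neg_one_pow_I]

lemma sgz_append {a b c : V} (p : M.graph.Walk a b) (q : M.graph.Walk b c) :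
    sgz M (p.append q) = sgz M p + sgz M q := by
  simp only [sgz, Walk.darts_append, List.countP_append]; push_cast; ring

lemma sgz_reverse {a b : V} (p : M.graph.Walk a b) : sgz M p.reverse = - sgz M p := by
  induction p with
  | nil => simp [sgz]
  | @cons u v w h p ih =>
    rw [Walk.reverse_cons, sgz_append, ih]
    have : sgz M (Walk.cons h p) = sgz M (Walk.cons h Walk.nil) + sgz M p := by
      rw [← sgz_append]; rfl
    rw [this]
    simp only [sgz, Walk.darts_cons, List.countP_cons, Walk.darts_nil, List.countP_nil, Dart.symm_mk]
    ring

lemma theta_rank {a b : V} (W₁ W₂ W₃ : M.graph.Walk a b) (h1 : W₁.IsPath) (h2 : W₂.IsPath) (h3 : W₃.IsPath)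
    (o1 : Odd W₁.length) (e2 : Even W₂.length) (e3 : Even W₃.length)
    (d12 : ∀ v, v ∈ W₁.support → v ∈ W₂.support → v = a ∨ v = b)
    (d13 : ∀ v, v ∈ W₁.support → v ∈ W₃.support → v = a ∨ v = b)
    (d23 : ∀ v, v ∈ W₂.support → v ∈ W₃.support → v = a ∨ v = b) :
    (pm M.hMatrix W₁ + pm M.hMatrix W₂ + pm M.hMatrix W₃).rank + 3 = W₁.length + W₂.length + W₃.length ↔
      ((sgz M W₂ - sgz M W₁) % 2 = 1 ∧ (sgz M W₃ - sgz M W₁) % 2 = 1 ∧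
        (sgz M W₂ - sgz M W₃) % 4 = (W₂.length + W₃.length) % 4) := by
  have hab : a ≠ b := by
    rintro rfl
    have := Walk.isPath_iff_eq_nil.1 h1
    subst this
    simp at o1
  obtain ⟨c, t2, K, B, hc, hca, hcb, l2, s2, r2⟩ := path_contract2 M W₂ h2 e2 hab
  obtain ⟨d, t3, L, C, hd, hda, hdb, l3, s3, r3⟩ := path_contract2 M W₃ h3 e3 hab
  have hcd : c ≠ d := by
    rintro rfl
    rcases d23 c hc hd with h | h
    · exact hca h
    · exact hcb h
  -- contract W₁
  obtain ⟨t1, A, l1, s1, r1⟩ : ∃ (t : ℕ) (A : ℤ), W₁.length = 2 * t + 1 ∧ A = 2 * t + sgz M W₁ ∧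
     ∀ R : Matrix V V ℂ, (∀ v ∈ W₁.support, v ≠ a → v ≠ b → ∀ j, R v j = 0 ∧ R j v = 0) →
        (R + pm M.hMatrix W₁).rank = (R + ed a b (Complex.I ^ A) (Complex.I ^ (-A))).rank + 2 * t := by
    cases W₁ with
    | nil => simp at o1
    | @cons _ v _ h p =>
      have hp := (Walk.cons_isPath_iff _ _).1 h1
      rw [Walk.length_cons] at o1 ⊢
      obtain ⟨t, ht⟩ : ∃ t, p.length = 2 * t := by
        obtain ⟨k, hk⟩ := o1; exact ⟨k, by omega⟩
      refine ⟨t, 2 * t + sgz M (Walk.cons h p), by omega, rfl, ?_⟩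
      intro R hR
      have := rank_contract M.hMatrix M.graph (fun i j h => hM_adj M h) t p hp.1 ht a
          (fun hb => absurd hb hp.2)
          (M.hMatrix a v) (M.hMatrix v a) R (fun x hx hxu j => by
            have hxa : x ≠ a := fun hh => hp.2 (hh ▸ hx)
            exact hR x (by simp [hx]) hxa hxu j)
      rw [show R + pm M.hMatrix (Walk.cons h p) = R + ed a v (M.hMatrix a v) (M.hMatrix v a) + pm M.hMatrix p by
        rw [pm, add_assoc], this]
      rw [show M.hMatrix a v * hol M.hMatrix p = hol M.hMatrix (Walk.cons h p) from rfl,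
        show M.hMatrix v a * holr M.hMatrix p = holr M.hMatrix (Walk.cons h p) from rfl, (hol_eq M _).1, (hol_eq M _).2]
      have e5 : ((-1 : ℂ)) ^ t = Complex.I ^ (-(2 * (t : ℤ))) := by
        rw [zpow_neg, ← neg_one_pow_I, ← inv_pow]; norm_num
      rw [neg_add, zpow_add₀ Complex.I_ne_zero, zpow_add₀ Complex.I_ne_zero, ← e5, ← neg_one_pow_I]
  have q1 := r1 (pm M.hMatrix W₂ + pm M.hMatrix W₃) (fun v hv hva hvb j => by
    have k2 : v ∉ W₂.support := fun hh => by rcases d12 v hv hh with h | h <;> contradiction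
    have k3 : v ∉ W₃.support := fun hh => by rcases d13 v hv hh with h | h <;> contradiction
    have := pm_zero_of_notMem W₂ M.hMatrix k2 j
    have := pm_zero_of_notMem W₃ M.hMatrix k3 j
    simp [*])
  have q2 := r2 (pm M.hMatrix W₃ + ed a b (Complex.I ^ A) (Complex.I ^ (-A))) (fun v hv hva hvb j => by
    have k3 : v ∉ W₃.support := fun hh => by rcases d23 v hv hh with h | h <;> contradiction
    have := pm_zero_of_notMem W₃ M.hMatrix k3 j
    simp [*, ed_apply, Ne.symm hva, Ne.symm hvb])
  have q3 := r3 (ed a b (Complex.I ^ A) (Complex.I ^ (-A)) + ed a c (Complex.I ^ K) (Complex.I ^ (-K)) +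
          ed c b (Complex.I ^ B) (Complex.I ^ (-B))) (fun v hv hva hvb j => by
    have hvc : v ≠ c := fun hh => by
      rcases d23 v (hh ▸ hc) hv with h | h <;> contradiction
    simp [ed_apply, Ne.symm hva, Ne.symm hvb, Ne.symm hvc])
  have p1 : pm M.hMatrix W₁ + pm M.hMatrix W₂ + pm M.hMatrix W₃ = pm M.hMatrix W₂ + pm M.hMatrix W₃ + pm M.hMatrix W₁ := by abel
  have p2 : pm M.hMatrix W₂ + pm M.hMatrix W₃ + ed a b (Complex.I ^ A) (Complex.I ^ (-A)) =
    pm M.hMatrix W₃ + ed a b (Complex.I ^ A) (Complex.I ^ (-A)) + pm M.hMatrix W₂ := by abel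
  have p3 : pm M.hMatrix W₃ + ed a b (Complex.I ^ A) (Complex.I ^ (-A)) + ed a c (Complex.I ^ K) (Complex.I ^ (-K)) +
          ed c b (Complex.I ^ B) (Complex.I ^ (-B)) = ed a b (Complex.I ^ A) (Complex.I ^ (-A)) + ed a c (Complex.I ^ K) (Complex.I ^ (-K)) +
          ed c b (Complex.I ^ B) (Complex.I ^ (-B)) + pm M.hMatrix W₃ := by abel
  rw [p1, q1, p2, q2, p3, q3]
  have q4 := n4_rank hab hca.symm hda.symm hcb.symm hdb.symm hcd (Complex.I ^ A) (Complex.I ^ (-A)) (Complex.I ^ K) (Complex.I ^ (-K))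
    (Complex.I ^ B) (Complex.I ^ (-B)) (Complex.I ^ L) (Complex.I ^ (-L)) (Complex.I ^ C) (Complex.I ^ (-C))
    (zpow_ne_zero _ Complex.I_ne_zero) (zpow_ne_zero _ Complex.I_ne_zero)
  have q5 : ∀ X Y Z W : ℤ, (Complex.I ^ (-X) * Complex.I ^ (-Y) / Complex.I ^ (-A) + Complex.I ^ Z * Complex.I ^ W / Complex.I ^ A = 0 ↔
      (X + Y + Z + W - 2 * A) % 4 = 2) := by
    intro X Y Z W
    rw [← I_zpow, ← zpow_add₀ Complex.I_ne_zero, ← zpow_add₀ Complex.I_ne_zero, ← zpow_sub₀ Complex.I_ne_zero, ← zpow_sub₀ Complex.I_ne_zero]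
    have : Complex.I ^ (-X + -Y - -A) + Complex.I ^ (Z + W - A) =
      Complex.I ^ (-X + -Y - -A) * (Complex.I ^ (X + Y + Z + W - 2 * A) + 1) := by
      rw [mul_add, ← zpow_add₀ Complex.I_ne_zero, mul_one, add_comm]
      congr 2; ring
    rw [this, mul_eq_zero, or_iff_right (zpow_ne_zero _ Complex.I_ne_zero), add_eq_zero_iff_eq_neg]
  rw [q5, q5, q5, q5] at q4
  have q6 : ∀ n : ℕ, n + 2 * t3 + 2 * t2 + 2 * t1 + 3 = W₁.length + W₂.length + W₃.length ↔ n = 2 := by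
    intro n; omega
  rw [q6, q4, l2, l3]
  push_cast
  omega

end Theta


section pieces
open SimpleGraph

lemma mt_path {H : SimpleGraph V} {a b : V} (p : H.Walk a b) (hp : p.IsPath) :
    (Odd p.length → Mt H {v | v ∈ p.support}) ∧ (Even p.length → Mt H ({v | v ∈ p.support} \ {a})) := by
  induction p with
  | nil =>
    refine ⟨by simp, fun _ => ?_⟩
    convert mt_empty H using 1
    ext; simp
  | @cons a c b h q ih =>
    rw [Walk.cons_isPath_iff] at hp
    obtain ⟨ih1, ih2⟩ := ih hp.1
    have hc : c ∈ q.support := q.start_mem_support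
    constructor
    · intro ho
      rw [Walk.length_cons, Nat.odd_add_one, Nat.not_odd_iff_even] at ho
      have := (mt_edge h).union (ih2 ho) (by
        rw [Set.disjoint_left]
        rintro x (rfl | rfl) hx
        · exact hp.2 hx.1
        · exact hx.2 rfl)
      convert this using 1
      ext x
      simp only [Walk.support_cons, List.mem_cons, Set.mem_setOf_eq, Set.mem_union, Set.mem_insert_iff, Set.mem_singleton_iff, Set.mem_sdiff]
      by_cases hx : x = c
      · subst hx; simp [hc]
      · simp [hx]
    · intro he
      rw [Walk.length_cons, Nat.even_add_one, Nat.not_even_iff_odd] at he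
      convert ih1 he using 1
      ext x
      simp only [Walk.support_cons, List.mem_cons, Set.mem_setOf_eq, Set.mem_sdiff, Set.mem_singleton_iff]
      by_cases hx : x = a
      · subst hx; simp [hp.2]
      · simp [hx]

lemma mt_odd_cyc [Finite V] {H Z : SimpleGraph V} (hZ : OC H Z) {u : V} (hu : u ∈ Z.support) :
    Mt H (Z.support \ {u}) := by
  obtain ⟨w, hw, hwg⟩ := hZ.1.exists_walk' hZ.2.1 hu
  have hlen := cycle_ncard w hw
  rw [hwg] at hlen
  have hs : ∀ x, x ∈ Z.support ↔ x ∈ w.support := by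
    intro x; rw [← hwg]; exact wg_supp w hw.not_nil x
  cases w with
  | nil => exact absurd hw (by simp)
  | @cons _ c _ h p =>
    rw [Walk.cons_isCycle_iff] at hw
    have ho := hZ.2.2
    rw [hlen, Walk.length_cons, Nat.odd_add_one, Nat.not_odd_iff_even] at ho
    have := (mt_path p.reverse hw.1.reverse).2 (by rwa [Walk.length_reverse])
    convert this using 1
    ext x
    simp only [Set.mem_sdiff, hs, Set.mem_setOf_eq, Walk.support_reverse, List.mem_reverse, Walk.support_cons, List.mem_cons, Set.mem_singleton_iff]
    tauto

lemma mt_even_cyc [Finite V] {H Z : SimpleGraph V} (hZ : EC H Z) {u : V} (hu : u ∈ Z.support) :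
    Mt H Z.support ∧ ∃ x ∈ Z.support, x ≠ u ∧ Mt H (Z.support \ {u, x}) := by
  obtain ⟨w, hw, hwg⟩ := hZ.1.exists_walk' hZ.2.1 hu
  have hlen := cycle_ncard w hw
  rw [hwg] at hlen
  have hs : ∀ x, x ∈ Z.support ↔ x ∈ w.support := by
    intro x; rw [← hwg]; exact wg_supp w hw.not_nil x
  cases w with
  | nil => exact absurd hw (by simp)
  | @cons _ c _ h p =>
    rw [Walk.cons_isCycle_iff] at hw
    have ho := hZ.2.2
    rw [hlen, Walk.length_cons, Nat.even_add_one, Nat.not_even_iff_odd] at ho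
    have hup : u ∈ p.support := p.end_mem_support
    have hs' : ∀ x, x ∈ Z.support ↔ x ∈ p.support := by
      intro x; rw [hs, Walk.support_cons, List.mem_cons]
      constructor
      · rintro (rfl | h)
        · exact hup
        · exact h
      · exact Or.inr
    refine ⟨?_, c, (hs' c).2 p.start_mem_support, h.ne', ?_⟩
    · convert (mt_path p hw.1).1 ho using 1
      ext x; exact hs' x
    · cases p with
      | nil => simp at ho
      | @cons _ d _ h' q =>
        have hq := (Walk.cons_isPath_iff _ _).1 hw.1
        rw [Walk.length_cons, Nat.odd_add_one, Nat.not_odd_iff_even] at ho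
        have := (mt_path q.reverse hq.1.reverse).2 (by rwa [Walk.length_reverse])
        convert this using 1
        ext x
        simp only [Set.mem_sdiff, hs', Set.mem_setOf_eq, Walk.support_reverse, List.mem_reverse, Walk.support_cons, List.mem_cons, Set.mem_singleton_iff, Set.mem_insert_iff]
        by_cases hx : x = c
        · subst hx; simp [hq.2]
        · simp [hx]

def Pc (H : SimpleGraph V) (S : Set V) (k : ℕ) : Prop :=
  ∃ X T : Set V, X ⊆ S ∧ T ⊆ S ∧ Disjoint X T ∧ Mt H T ∧
    (∀ x ∈ X, ∃ Z, EC H Z ∧ Z.support ⊆ S ∧ Z.support ∩ X = {x}) ∧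
    S.ncard + k ≤ T.ncard + 2 * X.ncard

lemma Pc.mono {H K : SimpleGraph V} {S : Set V} {k : ℕ} (h : Pc H S k) (hle : H ≤ K) : Pc K S k := by
  obtain ⟨X, T, h1, h2, h3, h4, h5, h6⟩ := h
  refine ⟨X, T, h1, h2, h3, h4.mono hle, fun x hx => ?_, h6⟩
  obtain ⟨Z, hZ, hz⟩ := h5 x hx
  exact ⟨Z, ⟨hZ.1, hZ.2.1.trans hle, hZ.2.2⟩, hz⟩

lemma Pc.weak {H : SimpleGraph V} {S : Set V} {k l : ℕ} (h : Pc H S k) (hle : l ≤ k) : Pc H S l := by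
  obtain ⟨X, T, h1, h2, h3, h4, h5, h6⟩ := h
  exact ⟨X, T, h1, h2, h3, h4, h5, by omega⟩

lemma pc_of_mt {H : SimpleGraph V} {S : Set V} (h : Mt H S) : Pc H S 0 :=
  ⟨∅, S, by simp, subset_rfl, by simp, h, by simp, by simp⟩

variable [Fintype V]

lemma Pc.union {H : SimpleGraph V} {S T : Set V} {k l : ℕ} (h : Pc H S k) (h' : Pc H T l) (hd : Disjoint S T) :
    Pc H (S ∪ T) (k + l) := by
  obtain ⟨X, A, h1, h2, h3, h4, h5, h6⟩ := h
  obtain ⟨Y, B, g1, g2, g3, g4, g5, g6⟩ := h'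
  have dXB := hd.mono h1 g2
  have dYA := hd.mono h2 g1
  have dAB := hd.mono h2 g2
  have dXY := hd.mono h1 g1
  refine ⟨X ∪ Y, A ∪ B, Set.union_subset_union h1 g1, Set.union_subset_union h2 g2, ?_, h4.union g4 dAB, ?_, ?_⟩
  · rw [Set.disjoint_union_left, Set.disjoint_union_right, Set.disjoint_union_right]
    exact ⟨⟨h3, dXB⟩, ⟨dYA.symm, g3⟩⟩
  · rintro x (hx | hx)
    · obtain ⟨Z, hZ, hs, hi⟩ := h5 x hx
      refine ⟨Z, hZ, hs.trans Set.subset_union_left, ?_⟩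
      rw [Set.inter_union_distrib_left, hi, Set.disjoint_iff_inter_eq_empty.1 (hd.mono hs g1), Set.union_empty]
    · obtain ⟨Z, hZ, hs, hi⟩ := g5 x hx
      refine ⟨Z, hZ, hs.trans Set.subset_union_right, ?_⟩
      rw [Set.inter_union_distrib_left, hi, Set.inter_comm, Set.disjoint_iff_inter_eq_empty.1 (hd.mono h1 hs), Set.empty_union]
  · rw [Set.ncard_union_eq hd, Set.ncard_union_eq dAB, Set.ncard_union_eq dXY]
    omega

lemma Pc.cplus {H C : SimpleGraph V} (hD : DE H) (hC : EC H C) {u : V} (hu : u ∈ C.support) {D : Set V}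
    (hDC : Disjoint D C.support) {k : ℕ} (h : Pc H (D ∪ {u}) k) : Pc H (D ∪ C.support) (k + 1) := by
  obtain ⟨-, x, hx, hxu, hm⟩ := mt_even_cyc hC hu
  obtain ⟨X, T, h1, h2, h3, h4, h5, h6⟩ := h
  have huX : u ∉ X := by
    intro hh
    obtain ⟨Z, hZ, hs, hi⟩ := h5 u hh
    have hZC : Z = C := by
      by_contra hne
      have huZ : u ∈ Z.support ∩ X := by rw [hi]; rfl
      exact Set.disjoint_left.1 (hD Z C hZ hC hne) huZ.1 hu
    subst hZC
    rcases hs hx with h | h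
    · exact Set.disjoint_left.1 hDC h hx
    · exact hxu h
  have hsub : D ∪ {u} ⊆ D ∪ C.support := Set.union_subset_union_right _ (by simpa using hu)
  have hXD : X ⊆ D := fun y hy => (h1 hy).resolve_right (fun e => huX (e ▸ hy))
  have hXC : Disjoint X C.support := hDC.mono_left hXD
  have hxT : x ∉ T := fun hh => (h2 hh).elim (fun e => Set.disjoint_left.1 hDC e hx) hxu
  have hxX : x ∉ X := fun hh => Set.disjoint_left.1 hXC hh hx
  have hTm : Disjoint T (C.support \ {u, x}) := by
    rw [Set.disjoint_left]
    rintro y hy ⟨hy1, hy2⟩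
    rcases h2 hy with h | h
    · exact Set.disjoint_left.1 hDC h hy1
    · exact hy2 (Or.inl h)
  refine ⟨X ∪ {x}, T ∪ (C.support \ {u, x}), ?_, ?_, ?_, h4.union hm hTm, ?_, ?_⟩
  · exact Set.union_subset (h1.trans hsub) (by rintro _ rfl; exact Or.inr hx)
  · exact Set.union_subset (h2.trans hsub) (fun y hy => Or.inr hy.1)
  · rw [Set.disjoint_union_left, Set.disjoint_union_right, Set.disjoint_union_right]
    exact ⟨⟨h3, hXC.mono_right Set.sdiff_subset⟩, ⟨by simpa using hxT, by simp⟩⟩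
  · rintro y (hy | hy)
    · obtain ⟨Z, hZ, hs, hi⟩ := h5 y hy
      refine ⟨Z, hZ, hs.trans hsub, ?_⟩
      rw [Set.inter_union_distrib_left, hi]
      have : Z.support ∩ {x} = ∅ := by
        rw [Set.inter_singleton_eq_empty]
        intro hh
        rcases hs hh with h | h
        · exact Set.disjoint_left.1 hDC h hx
        · exact hxu h
      rw [this, Set.union_empty]
    · rw [Set.mem_singleton_iff] at hy
      subst hy
      refine ⟨C, hC, Set.subset_union_right, ?_⟩
      rw [Set.inter_union_distrib_left, Set.inter_comm, Set.disjoint_iff_inter_eq_empty.1 hXC, Set.empty_union]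
      simpa using hx
  · have e1 : (C.support \ {u, x}).ncard + 2 = C.support.ncard := by
      rw [← Set.ncard_pair hxu.symm]
      exact Set.ncard_sdiff_add_ncard_of_subset (by rintro y (rfl | rfl) <;> assumption)
    have e2 : (D ∪ {u}).ncard = D.ncard + 1 := by
      rw [Set.ncard_union_eq (by simpa using fun h => Set.disjoint_left.1 hDC h hu), Set.ncard_singleton]
    rw [Set.ncard_union_eq hDC, Set.ncard_union_eq hTm, Set.ncard_union_eq (by simpa using hxX), Set.ncard_singleton]
    omega

lemma pc_del [DecidableEq V] {M : MixedGraph V} : ∀ (n : ℕ) (S X : Set V), X.ncard = n → Ext M S → X ⊆ S →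
    (∀ x ∈ X, ∃ Z, EC M.graph Z ∧ Z.support ⊆ S ∧ Z.support ∩ X = {x}) →
    Ext M (S \ X) ∧ mS M.graph S = mS M.graph (S \ X) + n ∧ kS M.graph S = kS M.graph (S \ X) + n := by
  intro n
  induction n with
  | zero =>
    intro S X hn hE _ _
    rw [Set.ncard_eq_zero] at hn
    subst hn
    simpa using hE
  | succ n ih =>
    intro S X hn hE hXS hX
    obtain ⟨x, hx⟩ : X.Nonempty := by
      rw [← Set.ncard_pos]; omega
    obtain ⟨Z, hZ, hs, hi⟩ := hX x hx
    have hxZ : x ∈ Z.support := by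
      have : x ∈ Z.support ∩ X := by rw [hi]; rfl
      exact this.1
    obtain ⟨e1, e2, e3⟩ := ext_del M hE (Z := Z) ⟨hZ.1, le_rs hZ.2.1 hs, hZ.2.2⟩ hxZ
    have hc := Set.ncard_sdiff_singleton_add_one hx
    obtain ⟨f1, f2, f3⟩ := ih (S \ {x}) (X \ {x}) (by omega) e1 (Set.sdiff_subset_sdiff_left hXS) (by
      rintro y ⟨hy, hyx⟩
      obtain ⟨Z', hZ', hs', hi'⟩ := hX y hy
      have hxZ' : x ∉ Z'.support := by
        intro hh
        have : x ∈ Z'.support ∩ X := ⟨hh, hx⟩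
        rw [hi'] at this
        exact hyx this.symm
      refine ⟨Z', hZ', fun z hz => ⟨hs' hz, fun e => hxZ' (e ▸ hz)⟩, ?_⟩
      rw [← hi']
      ext z
      simp only [Set.mem_inter_iff, Set.mem_sdiff, Set.mem_singleton_iff]
      constructor
      · tauto
      · rintro ⟨h1, h2⟩
        exact ⟨h1, h2, fun e => hxZ' (e ▸ h1)⟩)
    have : (S \ {x}) \ (X \ {x}) = S \ X := by
      ext z
      simp only [Set.mem_sdiff, Set.mem_singleton_iff]
      by_cases hz : z = x
      · subst hz; simp [hx]
      · simp [hz]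
    rw [this] at f1 f2 f3
    exact ⟨f1, by omega, by omega⟩

lemma pc_ext [DecidableEq V] {M : MixedGraph V} {S : Set V} (hE : Ext M S) (h : Pc M.graph S 1) : False := by
  obtain ⟨X, T, h1, h2, h3, h4, h5, h6⟩ := h
  obtain ⟨-, e, -⟩ := pc_del _ S X rfl hE h1 h5
  have hT : Mt (rs M.graph (S \ X)) T := mt_rs.2 ⟨h4, fun t ht => ⟨h2 ht, fun hx => Set.disjoint_left.1 h3 hx ht⟩⟩
  have := mnum_ge hT
  have := mS_le_card M.graph S
  unfold mS at *
  omega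

end pieces


section branch
open SimpleGraph

def Con (H : SimpleGraph V) (D : Set V) : Prop := ∀ a ∈ D, ∀ b ∈ D, (rs H D).Reachable a b

def IsCmp (H : SimpleGraph V) (Y D : Set V) : Prop :=
  D ⊆ Y ∧ D.Nonempty ∧ Con H D ∧ ∀ d ∈ D, ∀ y ∈ Y, H.Adj d y → y ∈ D

lemma exists_cmp {H : SimpleGraph V} {Y : Set V} {y : V} (hy : y ∈ Y) : ∃ D, IsCmp H Y D ∧ y ∈ D := by
  have key : ∀ z, (rs H Y).Reachable y z → z ∈ Y ∧ (rs H {z | (rs H Y).Reachable y z}).Reachable y z := by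
    intro z hz
    have := reach_ind (Z := rs H Y) (fun z => (rs H Y).Reachable y z ∧ z ∈ Y ∧ (rs H {z | (rs H Y).Reachable y z}).Reachable y z)
      (by
        rintro a b hab ⟨h1, h2, h3⟩
        have hb : (rs H Y).Reachable y b := h1.trans hab.reachable
        refine ⟨hb, hab.2.2, h3.trans ?_⟩
        have : (rs H {z | (rs H Y).Reachable y z}).Adj a b := ⟨hab.1, h1, hb⟩
        exact this.reachable) hz ⟨Reachable.refl _, hy, Reachable.refl _⟩
    exact this.2
  refine ⟨{z | (rs H Y).Reachable y z}, ⟨fun z hz => (key z hz).1, ⟨y, Reachable.refl _⟩, ?_, ?_⟩, Reachable.refl _⟩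
  · intro a ha b hb
    exact (key a ha).2.symm.trans (key b hb).2
  · intro d hd z hz hdz
    have : (rs H Y).Adj d z := ⟨hdz, (key d hd).1, hz⟩
    exact hd.trans this.reachable

lemma cmp_diff {H : SimpleGraph V} {Y D E : Set V} (hD : IsCmp H Y D) (hE : IsCmp H (Y \ D) E) : IsCmp H Y E := by
  refine ⟨hE.1.trans Set.sdiff_subset, hE.2.1, hE.2.2.1, fun e he y hy hey => ?_⟩
  by_cases hyD : y ∈ D
  · exact absurd (hD.2.2.2 y hyD e (hE.1 he).1 hey.symm) (hE.1 he).2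
  · exact hE.2.2.2 e he y ⟨hy, hyD⟩ hey

lemma two_edges {H : SimpleGraph V} {D K : Set V} (hd : Disjoint D K) (hD : Con H D) (hK : Con H K)
    {d d' k k' : V} (h1 : d ∈ D) (h2 : d' ∈ D) (h3 : k ∈ K) (h4 : k' ∈ K) (h5 : H.Adj d k) (h6 : H.Adj d' k')
    (hne : ¬ (d = d' ∧ k = k')) : ∃ Z, IsCyc Z ∧ Z ≤ rs H (D ∪ K) ∧ Z.Adj d k := by
  have hdk : ∀ x ∈ D, x ∉ K := fun x hx => Set.disjoint_left.1 hd hx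
  have hadj : (rs H (D ∪ K)).Adj d k := ⟨h5, Or.inl h1, Or.inr h3⟩
  apply exists_cyc_of_reach hadj
  have l1 : rs H D ≤ de (rs H (D ∪ K)) d k := le_de (rs_mono H Set.subset_union_left) (fun h => hdk _ h.2.2 h3)
  have l2 : rs H K ≤ de (rs H (D ∪ K)) d k := le_de (rs_mono H Set.subset_union_right) (fun h => hdk _ h1 h.2.1)
  have l3 : (de (rs H (D ∪ K)) d k).Adj d' k' := by
    rw [de, deleteEdges_adj]
    refine ⟨⟨h6, Or.inl h2, Or.inr h4⟩, fun he => ?_⟩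
    rw [Set.mem_singleton_iff, Sym2.eq_iff] at he
    rcases he with ⟨rfl, rfl⟩ | ⟨rfl, rfl⟩
    · exact hne ⟨rfl, rfl⟩
    · exact hdk _ h2 h3
  exact ((hD d h1 d' h2).mono l1).trans (l3.reachable.trans ((hK k' h4 k h3).mono l2))

def Tw (H : SimpleGraph V) (S : Set V) (t : V) : Prop :=
  ∃ w₁ w₂, w₁ ≠ w₂ ∧ w₁ ∈ S ∧ w₂ ∈ S ∧ H.Adj t w₁ ∧ H.Adj t w₂

def Brn (H : SimpleGraph V) (B : Set V) (b : V) : Prop :=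
  b ∈ B ∧ (∀ t ∈ B, t ≠ b → Tw H B t) ∧ ∃ w ∈ B, H.Adj b w

def EvCa (H : SimpleGraph V) : Prop := (∀ Z, IsCyc Z → Z ≤ H → Even Z.support.ncard) ∧ DE H

/-- no cycle crosses between `Y` and `K` -/
def NoX (H : SimpleGraph V) (Y K : Set V) : Prop :=
  ∀ Z, IsCyc Z → Z ≤ rs H (Y ∪ K) → ∀ d ∈ Y, ∀ k ∈ K, ¬ Z.Adj d k

lemma cmp_unique {H : SimpleGraph V} {Y K D : Set V} (hYK : Disjoint Y K) (hK : Con H K) (hno : NoX H Y K)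
    (hD : IsCmp H Y D) {d d' k k' : V} (h1 : d ∈ D) (h2 : d' ∈ D) (h3 : k ∈ K) (h4 : k' ∈ K)
    (h5 : H.Adj d k) (h6 : H.Adj d' k') : d = d' ∧ k = k' := by
  by_contra hne
  obtain ⟨Z, hZ, hle, ha⟩ := two_edges (hYK.mono_left hD.1) hD.2.2.1 hK h1 h2 h3 h4 h5 h6 hne
  exact hno Z hZ (hle.trans (rs_mono H (Set.union_subset_union_left _ hD.1))) d (hD.1 h1) k h3 ha

lemma cmp_brn {H : SimpleGraph V} {Y K D : Set V} (hYK : Disjoint Y K) (hK : Con H K) (hno : NoX H Y K)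
    (hT : ∀ t ∈ Y, Tw H (Y ∪ K) t) (hD : IsCmp H Y D) :
    (∃ d, Brn H D d) ∧ (∀ d ∈ D, (∃ k ∈ K, H.Adj d k) → Brn H D d) := by
  have inD : ∀ t ∈ D, ∀ w ∈ Y ∪ K, H.Adj t w → w ∈ D ∨ w ∈ K := by
    rintro t ht w (hw | hw) hadj
    · exact Or.inl (hD.2.2.2 t ht w hw hadj)
    · exact Or.inr hw
  have k1 : ∀ t ∈ D, (¬ ∃ k ∈ K, H.Adj t k) → Tw H D t := by
    intro t ht hn
    obtain ⟨w₁, w₂, hne, m1, m2, a1, a2⟩ := hT t (hD.1 ht)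
    refine ⟨w₁, w₂, hne, ?_, ?_, a1, a2⟩
    · exact (inD t ht w₁ m1 a1).resolve_right (fun h => hn ⟨_, h, a1⟩)
    · exact (inD t ht w₂ m2 a2).resolve_right (fun h => hn ⟨_, h, a2⟩)
  have k2 : ∀ d ∈ D, (∃ k ∈ K, H.Adj d k) → Brn H D d := by
    rintro d hd ⟨k, hk, hdk⟩
    refine ⟨hd, fun t ht hne => k1 t ht ?_, ?_⟩
    · rintro ⟨k', hk', htk⟩
      exact hne (cmp_unique hYK hK hno hD ht hd hk' hk htk hdk).1
    · obtain ⟨w₁, w₂, hne, m1, m2, a1, a2⟩ := hT d (hD.1 hd)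
      by_contra hc
      push Not at hc
      have b1 := (inD d hd w₁ m1 a1).resolve_left (fun h => hc _ h a1)
      have b2 := (inD d hd w₂ m2 a2).resolve_left (fun h => hc _ h a2)
      exact hne (cmp_unique hYK hK hno hD hd hd b1 b2 a1 a2).2
  refine ⟨?_, k2⟩
  by_cases h : ∃ d ∈ D, ∃ k ∈ K, H.Adj d k
  · obtain ⟨d, hd, hk⟩ := h
    exact ⟨d, k2 d hd hk⟩
  · push Not at h
    obtain ⟨d, hd⟩ := hD.2.1
    have := fun t ht => k1 t ht (by push Not; exact h t ht)
    refine ⟨d, hd, fun t ht _ => this t ht, ?_⟩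
    obtain ⟨w₁, w₂, hne, m1, m2, a1, a2⟩ := this d hd
    exact ⟨w₁, m1, a1⟩

variable [Fintype V]

lemma pc_empty (H : SimpleGraph V) : Pc H ∅ 0 := pc_of_mt (mt_empty H)

lemma pc_comps {H : SimpleGraph V} : ∀ (n : ℕ) (Y : Set V), Y.ncard = n →
    (∀ D, IsCmp H Y D → Pc H D 0) → Pc H Y 0 := by
  intro n
  induction n using Nat.strong_induction_on with
  | _ n ih =>
    intro Y hn h
    rcases Y.eq_empty_or_nonempty with rfl | ⟨y, hy⟩
    · exact pc_empty H
    · obtain ⟨D, hD, hyD⟩ := exists_cmp (H := H) hy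
      have hlt : (Y \ D).ncard < n := by
        rw [← hn]
        apply Set.ncard_lt_ncard _ (Set.toFinite _)
        exact ⟨Set.sdiff_subset, fun hh => (hh hy).2 hyD⟩
      have h1 := ih _ hlt (Y \ D) rfl (fun E hE => h E (cmp_diff hD hE))
      have := (h D hD).union h1 Set.disjoint_sdiff_right
      rwa [Set.union_sdiff_cancel hD.1] at this

lemma pc_rest {H : SimpleGraph V} {Y D : Set V} (hD : IsCmp H Y D) (h : ∀ D, IsCmp H Y D → Pc H D 0) :
    Pc H (Y \ D) 0 := pc_comps _ _ rfl (fun E hE => h E (cmp_diff hD hE))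

lemma con_cyc {H C : SimpleGraph V} (hC : IsCyc C) (hle : C ≤ H) : Con H C.support := by
  intro a ha b hb
  exact (hC.conn a b ha hb).mono (le_rs hle subset_rfl)

lemma nox_cyc {H C : SimpleGraph V} (hE : EvCa H) (hC : IsCyc C) (hle : C ≤ H) {Y : Set V} (hd : Disjoint Y C.support) :
    NoX H Y C.support := by
  intro Z hZ hle' d hd' k hk ha
  have hZH := hle'.trans (rs_le _ _)
  have : Z = C := by
    by_contra hne
    exact Set.disjoint_left.1 (hE.2 Z C ⟨hZ, hZH, hE.1 Z hZ hZH⟩ ⟨hC, hle, hE.1 C hC hle⟩ hne) (mem_supp_r ha) hk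
  subst this
  exact Set.disjoint_left.1 hd hd' (mem_supp_l ha)

theorem branch {H : SimpleGraph V} (hE : EvCa H) : ∀ (n : ℕ) (B : Set V) (b : V), B.ncard = n → Brn H B b →
    Pc H B 0 ∧ (∀ z, z ∉ B → H.Adj b z → Pc H (B ∪ {z}) 0) ∧
      (Pc H B 1 ∨ ∀ z, z ∉ B → H.Adj b z → Pc H (B ∪ {z}) 1) := by
  intro n
  induction n using Nat.strong_induction_on with
  | _ n ih =>
  rintro B b hn ⟨hbB, hT, w, hw, hbw⟩
  by_cases hcyc : ∃ C, IsCyc C ∧ C ≤ rs H B ∧ b ∈ C.support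
  · obtain ⟨C, hC, hle, hbC⟩ := hcyc
    have hleH := hle.trans (rs_le _ _)
    have hCB : C.support ⊆ B := supp_of_le_rs hle
    have hEC : EC H C := ⟨hC, hleH, hE.1 C hC hleH⟩
    have hdj : Disjoint (B \ C.support) C.support := Set.disjoint_sdiff_left
    have hun : B \ C.support ∪ C.support = B := Set.sdiff_union_of_subset hCB
    have hcmp : ∀ D, IsCmp H (B \ C.support) D → Pc H D 0 := by
      intro D hD
      obtain ⟨⟨d, hd⟩, -⟩ := cmp_brn hdj (con_cyc hC hleH) (nox_cyc hE hC hleH hdj) (by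
        rw [hun]
        intro t ht
        exact hT t ht.1 (fun e => ht.2 (e ▸ hbC))) hD
      refine (ih D.ncard ?_ D d rfl hd).1
      rw [← hn]
      apply Set.ncard_lt_ncard _ (Set.toFinite _)
      exact ⟨hD.1.trans Set.sdiff_subset, fun hh => (hD.1 (hh hbB)).2 hbC⟩
    have hrest := pc_comps _ _ rfl hcmp
    have hz : ∀ z, z ∉ B → H.Adj b z → Pc H (B ∪ {z}) 1 := by
      intro z hz hadj
      have h1 : Pc H ({z} ∪ {b}) 0 := pc_of_mt (by rw [Set.union_comm]; exact mt_edge hadj)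
      have h2 := Pc.cplus hE.2 hEC hbC (D := {z}) (by simpa using fun h => hz (hCB h)) h1
      have h3 := hrest.union h2 (by
        rw [Set.disjoint_union_right]
        exact ⟨by simpa using fun h => absurd h hz, hdj⟩)
      convert h3 using 1
      rw [Set.union_comm {z}, ← Set.union_assoc, hun]
    refine ⟨?_, fun z h1 h2 => (hz z h1 h2).weak (by omega), Or.inr hz⟩
    have := hrest.union (pc_of_mt (mt_even_cyc hEC hbC).1) hdj
    rwa [hun] at this
  · have hdj : Disjoint (B \ {b}) {b} := Set.disjoint_sdiff_left
    have hun : B \ {b} ∪ {b} = B := Set.sdiff_union_of_subset (by simpa using hbB)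
    have hcon : Con H {b} := by
      rintro a rfl c rfl; exact Reachable.refl _
    have hnox : NoX H (B \ {b}) {b} := by
      intro Z hZ hle d hd k hk ha
      rw [hun] at hle
      rw [Set.mem_singleton_iff] at hk
      subst hk
      exact hcyc ⟨Z, hZ, hle, mem_supp_r ha⟩
    have hTT : ∀ t ∈ B \ {b}, Tw H (B \ {b} ∪ {b}) t := by
      rw [hun]; intro t ht; exact hT t ht.1 ht.2
    have hlt : ∀ D, IsCmp H (B \ {b}) D → D.ncard < n := by
      intro D hD
      rw [← hn]
      apply Set.ncard_lt_ncard _ (Set.toFinite _)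
      exact ⟨hD.1.trans Set.sdiff_subset, fun hh => (hD.1 (hh hbB)).2 rfl⟩
    have hcmp : ∀ D, IsCmp H (B \ {b}) D → Pc H D 0 := by
      intro D hD
      obtain ⟨⟨d, hd⟩, -⟩ := cmp_brn hdj hcon hnox hTT hD
      exact (ih D.ncard (hlt D hD) D d rfl hd).1
    have hwb : w ∈ B \ {b} := ⟨hw, fun e => hbw.ne (Set.mem_singleton_iff.1 e).symm⟩
    obtain ⟨D, hD, hwD⟩ := exists_cmp (H := H) hwb
    have hbr := (cmp_brn hdj hcon hnox hTT hD).2 w hwD ⟨b, rfl, hbw.symm⟩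
    have hbD : b ∉ D := fun h => (hD.1 h).2 rfl
    obtain ⟨q1, q2, q3⟩ := ih D.ncard (hlt D hD) D w rfl hbr
    have hrest := pc_rest hD hcmp
    have join : ∀ k, Pc H (D ∪ {b}) k → Pc H B k := by
      intro k hk
      have := hk.union hrest (by
        rw [Set.disjoint_union_left]
        exact ⟨Set.disjoint_sdiff_right, by simp⟩)
      rw [Nat.add_zero] at this
      convert this using 1
      rw [Set.union_right_comm, Set.union_sdiff_cancel hD.1, hun]
    have joinz : ∀ k z, z ∉ B → H.Adj b z → Pc H (B \ {b}) k → Pc H (B ∪ {z}) k := by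
      intro k z hz hadj hk
      have := hk.union (pc_of_mt (mt_edge hadj)) (by
        rw [Set.disjoint_left]
        rintro x ⟨hx, hxb⟩ (rfl | rfl)
        · exact hxb rfl
        · exact hz hx)
      rw [Nat.add_zero] at this
      convert this using 1
      rw [Set.insert_eq, ← Set.union_assoc, hun]
    refine ⟨join 0 (q2 b hbD hbw.symm), fun z h1 h2 => joinz 0 z h1 h2 (pc_comps _ _ rfl hcmp), ?_⟩
    rcases q3 with q3 | q3
    · right
      intro z h1 h2
      refine joinz 1 z h1 h2 ?_
      have := q3.union hrest Set.disjoint_sdiff_right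
      rwa [Set.union_sdiff_cancel hD.1] at this
    · left
      exact join 1 (q3 b hbD hbw.symm)

/-- the Y-lemma -/
theorem ylem {H C : SimpleGraph V} (hE : EvCa H) (hC : IsCyc C) (hle : C ≤ H) {Y : Set V} (hdj : Disjoint Y C.support)
    (hT : ∀ t ∈ Y, Tw H (Y ∪ C.support) t) :
    Pc H Y 0 ∧ ((∃ y ∈ Y, ∃ c ∈ C.support, H.Adj y c) → Pc H (Y ∪ C.support) 1) := by
  have hEC : EC H C := ⟨hC, hle, hE.1 C hC hle⟩
  have hcmp : ∀ D, IsCmp H Y D → Pc H D 0 := by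
    intro D hD
    obtain ⟨⟨d, hd⟩, -⟩ := cmp_brn hdj (con_cyc hC hle) (nox_cyc hE hC hle hdj) hT hD
    exact (branch hE D.ncard D d rfl hd).1
  refine ⟨pc_comps _ _ rfl hcmp, ?_⟩
  rintro ⟨y, hy, c, hc, hyc⟩
  obtain ⟨D, hD, hyD⟩ := exists_cmp (H := H) hy
  have hbr := (cmp_brn hdj (con_cyc hC hle) (nox_cyc hE hC hle hdj) hT hD).2 y hyD ⟨c, hc, hyc⟩
  have hcD : c ∉ D := fun h => Set.disjoint_left.1 hdj (hD.1 h) hc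
  have h1 := (branch hE D.ncard D y rfl hbr).2.1 c hcD hyc
  have h2 := Pc.cplus hE.2 hEC hc (hdj.mono_left hD.1) h1
  have h3 := h2.union (pc_rest hD hcmp) (by
    rw [Set.disjoint_union_left]
    exact ⟨Set.disjoint_sdiff_right, (hdj.mono_left Set.sdiff_subset).symm⟩)
  convert h3 using 1
  rw [Set.union_right_comm, Set.union_sdiff_cancel hD.1]

end branch


section bic
open SimpleGraph

lemma wg_append {G : SimpleGraph V} {a b c : V} (p : G.Walk a b) (q : G.Walk b c) :
    wg (p.append q) = wg p ⊔ wg q := by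
  ext x y
  rw [sup_adj, wg_adj, wg_adj, wg_adj, Walk.edges_append, List.mem_append]

lemma wg_reverse {G : SimpleGraph V} {a b : V} (p : G.Walk a b) : wg p.reverse = wg p := by
  ext x y
  rw [wg_adj, wg_adj, Walk.edges_reverse, List.mem_reverse]

lemma cyc_two_paths {G : SimpleGraph V} {a b : V} {p q : G.Walk a b} (hp : p.IsPath) (hq : q.IsPath)
    (h : ∀ v, v ∈ p.support → v ∈ q.support → v = a ∨ v = b) (hn : 1 < p.length ∨ 1 < q.length) :
    (p.append q.reverse).IsCycle := by
  refine hp.isCycle_append hq.reverse ?_ (by simpa using hn)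
  intro v h1 h2
  have h1' := List.mem_of_mem_tail h1
  have h2' : v ∈ q.support := by
    have := List.mem_of_mem_tail h2
    simpa using this
  rcases h v h1' h2' with rfl | rfl
  · have := hp.support_nodup
    rw [← Walk.cons_tail_support] at this
    exact (List.nodup_cons.1 this).1 h1
  · have := hq.reverse.support_nodup
    rw [← Walk.cons_tail_support] at this
    exact (List.nodup_cons.1 this).1 h2

structure Th (G : SimpleGraph V) {a b : V} (W₁ W₂ W₃ : G.Walk a b) : Prop where
  p1 : W₁.IsPath
  p2 : W₂.IsPath
  p3 : W₃.IsPath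
  o1 : Odd W₁.length
  e2 : Even W₂.length
  e3 : Even W₃.length
  d12 : ∀ v, v ∈ W₁.support → v ∈ W₂.support → v = a ∨ v = b
  d13 : ∀ v, v ∈ W₁.support → v ∈ W₃.support → v = a ∨ v = b
  d23 : ∀ v, v ∈ W₂.support → v ∈ W₃.support → v = a ∨ v = b
  ver : ∀ v : V, v ∈ W₁.support ∨ v ∈ W₂.support ∨ v ∈ W₃.support
  edg : ∀ e ∈ G.edgeSet, e ∈ W₁.edges ∨ e ∈ W₂.edges ∨ e ∈ W₃.edges

variable {G : SimpleGraph V} {a b : V} {W₁ W₂ W₃ : G.Walk a b} 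

lemma Th.ne (h : Th G W₁ W₂ W₃) : a ≠ b := by
  rintro rfl
  have := Walk.isPath_iff_eq_nil.1 h.p1
  have h1 := h.o1
  rw [this] at h1
  simp at h1

lemma even_len {p : G.Walk a b} (hab : a ≠ b) (he : Even p.length) : 1 < p.length := by
  have : p.length ≠ 0 := fun h => hab (Walk.eq_of_length_eq_zero h)
  obtain ⟨k, hk⟩ := he
  omega

lemma Th.swap (h : Th G W₁ W₂ W₃) : Th G W₁ W₃ W₂ where
  p1 := h.p1
  p2 := h.p3
  p3 := h.p2
  o1 := h.o1
  e2 := h.e3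
  e3 := h.e2
  d12 := h.d13
  d13 := h.d12
  d23 := fun v h1 h2 => h.d23 v h2 h1
  ver := fun v => by have := h.ver v; tauto
  edg := fun e he => by have := h.edg e he; tauto

lemma Th.c12 (h : Th G W₁ W₂ W₃) : (W₂.append W₁.reverse).IsCycle :=
  cyc_two_paths h.p2 h.p1 (fun v h1 h2 => h.d12 v h2 h1) (Or.inl (even_len h.ne h.e2))

lemma Th.c23 (h : Th G W₁ W₂ W₃) : (W₂.append W₃.reverse).IsCycle :=
  cyc_two_paths h.p2 h.p3 h.d23 (Or.inl (even_len h.ne h.e2))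

lemma Th.l12 (h : Th G W₁ W₂ W₃) : Odd (W₂.append W₁.reverse).length := by
  rw [Walk.length_append, Walk.length_reverse]; exact h.e2.add_odd h.o1

lemma Th.l23 (h : Th G W₁ W₂ W₃) : Even (W₂.append W₃.reverse).length := by
  rw [Walk.length_append, Walk.length_reverse]; exact h.e2.add h.e3

lemma Th.oc (h : Th G W₁ W₂ W₃) : OC G (wg (W₂.append W₁.reverse)) :=
  ⟨isCyc_wg _ h.c12, wg_le _, by rw [cycle_ncard _ h.c12]; exact h.l12⟩

lemma Th.ec (h : Th G W₁ W₂ W₃) : EC G (wg (W₂.append W₃.reverse)) :=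
  ⟨isCyc_wg _ h.c23, wg_le _, by rw [cycle_ncard _ h.c23]; exact h.l23⟩

/-- edges of two of the paths are disjoint -/
lemma paths_edge_disj {p q : G.Walk a b} (hp : p.IsPath)
    (h : ∀ v, v ∈ p.support → v ∈ q.support → v = a ∨ v = b) (hn : 1 < p.length) {x y : V}
    (h1 : s(x, y) ∈ p.edges) (h2 : s(x, y) ∈ q.edges) : False := by
  have hx := h x (p.fst_mem_support_of_mem_edges h1) (q.fst_mem_support_of_mem_edges h2)
  have hy := h y (p.snd_mem_support_of_mem_edges h1) (q.snd_mem_support_of_mem_edges h2)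
  have hxy := (p.adj_of_mem_edges h1).ne
  have : s(a, b) ∈ p.edges := by
    rcases hx with rfl | rfl <;> rcases hy with rfl | rfl
    · exact absurd rfl hxy
    · exact h1
    · rw [Sym2.eq_swap]; exact h1
    · exact absurd rfl hxy
  have := hp.length_eq_one_of_mem_edges this
  omega

lemma Th.even (h : Th G W₁ W₂ W₃) (hD : DE G) {Z : SimpleGraph V} (hZ : EC G Z) : Z = wg (W₂.append W₃.reverse) := by
  by_contra hne
  have hd := hD _ _ hZ h.ec hne
  have hle : Z ≤ wg (W₂.append W₁.reverse) := by
    intro x y hxy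
    rw [wg_append, wg_reverse, sup_adj, wg_adj, wg_adj]
    have hC : ¬ (wg (W₂.append W₃.reverse)).Adj x y := fun hc =>
      Set.disjoint_left.1 hd (mem_supp_l hxy) (mem_supp_l hc)
    rw [wg_append, wg_reverse, sup_adj, wg_adj, wg_adj] at hC
    have := h.edg s(x, y) (hZ.2.1 hxy)
    tauto
  have := cyc_le_eq hZ.1 h.oc.1 hle
  have h1 := h.oc.2.2
  rw [← this] at h1
  exact (Nat.not_even_iff_odd.2 h1) hZ.2.2

lemma Th.odd (h : Th G W₁ W₂ W₃) (hD : DE G) (hU : Unic G) {Z : SimpleGraph V} (hZ : OC G Z) :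
    Z = wg (W₂.append W₁.reverse) ∨ Z = wg (W₃.append W₁.reverse) := by
  have h1 : wg W₁ ≤ Z := by
    intro x y hxy
    refine hU G le_rfl x y ⟨_, h.oc, ?_⟩ ?_ Z hZ
    · rw [wg_append, wg_reverse, sup_adj]; exact Or.inr hxy
    · rintro ⟨Y, hY, hYa⟩
      rw [h.even hD hY, wg_append, wg_reverse, sup_adj, wg_adj, wg_adj] at hYa
      rw [wg_adj] at hxy
      rcases hYa with hh | hh
      · exact paths_edge_disj h.p2 (fun v h1 h2 => h.d12 v h2 h1) (even_len h.ne h.e2) hh hxy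
      · exact paths_edge_disj h.p3 (fun v h1 h2 => h.d13 v h2 h1) (even_len h.ne h.e3) hh hxy
  by_cases h2 : wg W₂ ≤ Z
  · left
    symm
    apply cyc_le_eq h.oc.1 hZ.1
    rw [wg_append, wg_reverse]
    exact sup_le h2 h1
  by_cases h3 : wg W₃ ≤ Z
  · right
    symm
    apply cyc_le_eq h.swap.oc.1 hZ.1
    rw [wg_append, wg_reverse]
    exact sup_le h3 h1
  exfalso
  obtain ⟨x, y, hxy, hn⟩ : ∃ x y, (wg W₂).Adj x y ∧ ¬ Z.Adj x y := by
    by_contra hc; push Not at hc; exact h2 (fun x y => hc x y)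
  obtain ⟨x', y', hxy', hn'⟩ : ∃ x y, (wg W₃).Adj x y ∧ ¬ Z.Adj x y := by
    by_contra hc; push Not at hc; exact h3 (fun x y => hc x y)
  refine hn' (hU (de G x y) (de_le _ _ _) x' y' ⟨wg (W₃.append W₁.reverse), ⟨h.swap.oc.1, le_de h.swap.oc.2.1 ?_, h.swap.oc.2.2⟩, ?_⟩ ?_ Z
    ⟨hZ.1, le_de hZ.2.1 hn, hZ.2.2⟩)
  · rw [wg_append, wg_reverse, sup_adj, wg_adj, wg_adj]
    rw [wg_adj] at hxy
    rintro (hh | hh)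
    · exact paths_edge_disj h.p2 h.d23 (even_len h.ne h.e2) hxy hh
    · exact paths_edge_disj h.p2 (fun v h1 h2 => h.d12 v h2 h1) (even_len h.ne h.e2) hxy hh
  · rw [wg_append, sup_adj]; exact Or.inl hxy'
  · rintro ⟨Y, hY, -⟩
    have := h.even hD ⟨hY.1, hY.2.1.trans (de_le _ _ _), hY.2.2⟩
    refine (le_de_iff.1 hY.2.1).2 ?_
    rw [this, wg_append, sup_adj]; exact Or.inl hxy

variable [Fintype V]

lemma full_match {G : SimpleGraph V} (h : Mt G Set.univ) : 2 * mS G Set.univ = Nat.card V := by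
  have h1 := mnum_ge (h.rs (Set.subset_univ _))
  have h2 := mS_le_card G Set.univ
  rw [Set.ncard_univ] at *
  unfold mS at *
  omega

lemma near_match {G : SimpleGraph V} {u : V} (h : Mt G (Set.univ \ {u})) : 2 * mS G Set.univ + 1 = Nat.card V := by
  have h1 := mnum_ge (h.rs (Set.subset_univ _))
  have h2 := mS_le_card G Set.univ
  have h3 := Set.ncard_sdiff_singleton_add_one (Set.mem_univ u)
  have h4 := mt_even h
  obtain ⟨k, hk⟩ := h4
  rw [Set.ncard_univ] at *
  unfold mS at *
  omega

variable [DecidableEq V] {M : MixedGraph V}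

lemma ext_full (h : Mt M.graph Set.univ) (hk : kp M.graph = 1) : Ext M Set.univ ↔ M.hMatrix.rank + 2 = Nat.card V := by
  have h1 := full_match h
  unfold Ext
  rw [rk_univ, h1, kS, rs_univ, hk]
  rfl

lemma ext_even_cyc (hZ : IsCyc M.graph) (hs : M.graph.support = Set.univ) (he : Even (Nat.card V)) :
    Ext M Set.univ ↔ BS M M.graph := by
  have hec : EC M.graph M.graph := ⟨hZ, le_rfl, by rw [hs, Set.ncard_univ]; exact he⟩
  obtain ⟨a, b, hab⟩ := hZ.edge
  have hm := (mt_even_cyc hec (mem_supp_l hab)).1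
  rw [hs] at hm
  rw [ext_full hm (kp_one hec (fun Z hz => cyc_le_eq hz.1 hZ hz.2.1)), BS, hs, zm_top, Set.ncard_univ]

lemma ext_odd_cyc (hZ : IsCyc M.graph) (hs : M.graph.support = Set.univ) (he : Odd (Nat.card V)) :
    Ext M Set.univ ↔ OS M M.graph := by
  have hec : OC M.graph M.graph := ⟨hZ, le_rfl, by rw [hs, Set.ncard_univ]; exact he⟩
  obtain ⟨a, b, hab⟩ := hZ.edge
  have hm := mt_odd_cyc hec (mem_supp_l hab)
  rw [hs] at hm
  have hk : kp M.graph = 0 := kp_zero (by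
    rintro ⟨Z, hz⟩
    have := cyc_le_eq hz.1 hZ hz.2.1
    subst this
    exact (Nat.not_even_iff_odd.2 hec.2.2) hz.2.2)
  have h1 := near_match hm
  unfold Ext OS
  rw [rk_univ, kS, rs_univ, hk, hs, zm_top, Set.ncard_univ]
  unfold MixedGraph.hRank
  omega

lemma x1_even {C Γ : SimpleGraph V} (hD : DE M.graph) (hC : EC M.graph C) (hΓ : OC M.graph Γ) 
    (hG : M.graph = C ⊔ Γ) {Z : SimpleGraph V} (hZ : EC M.graph Z) : Z = C := by
  by_contra hne
  have hd := hD _ _ hZ hC hne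
  have hle : Z ≤ Γ := by
    intro x y hxy
    have := hZ.2.1 hxy
    rw [hG, sup_adj] at this
    exact this.resolve_left (fun h => Set.disjoint_left.1 hd (mem_supp_l hxy) (mem_supp_l h))
  have := cyc_le_eq hZ.1 hΓ.1 hle
  subst this
  exact (Nat.not_even_iff_odd.2 hΓ.2.2) hZ.2.2

lemma x1_odd {C Γ : SimpleGraph V} (hD : DE M.graph) (hU : Unic M.graph) (hC : EC M.graph C) (hΓ : OC M.graph Γ) 
    {x : V} (hx : C.support ∩ Γ.support = {x})
    (hG : M.graph = C ⊔ Γ) {Z : SimpleGraph V} (hZ : OC M.graph Z) : Z = Γ := by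
  symm
  apply cyc_le_eq hΓ.1 hZ.1
  intro a b hab
  refine hU _ le_rfl a b ⟨Γ, hΓ, hab⟩ ?_ Z hZ
  rintro ⟨Y, hY, hYa⟩
  rw [x1_even hD hC hΓ hG hY] at hYa
  have h1 : a ∈ C.support ∩ Γ.support := ⟨mem_supp_l hYa, mem_supp_l hab⟩
  have h2 : b ∈ C.support ∩ Γ.support := ⟨mem_supp_r hYa, mem_supp_r hab⟩
  rw [hx, Set.mem_singleton_iff] at h1 h2
  exact hab.ne (h1.trans h2.symm)

lemma x1_ext {C Γ : SimpleGraph V} (hD : DE M.graph) (hC : EC M.graph C) (hΓ : OC M.graph Γ) 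
    {x : V} (hx : C.support ∩ Γ.support = {x})
    (hG : M.graph = C ⊔ Γ) (hV : C.support ∪ Γ.support = Set.univ) : Ext M Set.univ ↔ OS M Γ ∧ BS M C := by
  have hxm : x ∈ C.support ∩ Γ.support := by rw [hx]; rfl
  have hd : ∀ v, v ∈ C.support → v ∈ Γ.support → v = x := by
    intro v h1 h2
    have : v ∈ C.support ∩ Γ.support := ⟨h1, h2⟩
    rwa [hx] at this
  have hm : Mt M.graph Set.univ := by
    have := (mt_even_cyc hC hxm.1).1.union (mt_odd_cyc hΓ hxm.2) (by
      rw [Set.disjoint_left]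
      rintro v h1 ⟨h2, h3⟩
      exact h3 (hd v h1 h2))
    convert this using 1
    rw [← hV]
    ext v
    simp only [Set.mem_union, Set.mem_sdiff, Set.mem_singleton_iff]
    by_cases hv : v = x
    · subst hv; simp [hxm.1]
    · simp [hv]
  rw [ext_full hm (kp_one hC (fun Z hz => x1_even hD hC hΓ hG hz)), ← inf_rank M hC hΓ hxm.2 hxm.1 hd]
  have hz : M.hMatrix = zm M C + zm M Γ := by
    rw [← zm_top]
    ext i j
    simp only [zm, Matrix.of_apply, Matrix.add_apply]
    by_cases h1 : C.Adj i j
    · have h2 : ¬ Γ.Adj i j := fun h2 => h2.ne ((hd _ (mem_supp_l h1) (mem_supp_l h2)).trans (hd _ (mem_supp_r h1) (mem_supp_r h2)).symm)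
      have h3 : M.graph.Adj i j := by rw [hG]; exact Or.inl h1
      simp [h1, h2, h3]
    · have h3 : M.graph.Adj i j ↔ Γ.Adj i j := by rw [hG, sup_adj]; tauto
      simp [h1, h3]
  rw [hz]
  have hc := Set.ncard_union_add_ncard_inter C.support Γ.support
  rw [hV, hx, Set.ncard_singleton, Set.ncard_univ] at hc
  omega

lemma th_ext {a b : V} {W₁ W₂ W₃ : M.graph.Walk a b} (h : Th M.graph W₁ W₂ W₃) (hD : DE M.graph) :
    Ext M Set.univ ↔ OS M (wg (W₂.append W₁.reverse)) ∧ OS M (wg (W₃.append W₁.reverse)) ∧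
      BS M (wg (W₂.append W₃.reverse)) := by
  have hab := h.ne
  have hC := h.ec
  -- matching of the interior of W₁
  have hA : Mt M.graph ({v | v ∈ W₁.support} \ {a, b}) := by
    have hp := h.p1
    have ho := h.o1
    generalize W₁ = W at hp ho
    cases W with
    | nil => simp at ho
    | @cons _ c _ hh p =>
      rw [Walk.cons_isPath_iff] at hp
      rw [Walk.length_cons, Nat.odd_add_one, Nat.not_odd_iff_even] at ho
      have := (mt_path p.reverse hp.1.reverse).2 (by rwa [Walk.length_reverse])
      convert this using 1
      ext x
      simp only [Set.mem_sdiff, Set.mem_setOf_eq, Walk.support_reverse, List.mem_reverse, Walk.support_cons, List.mem_cons, Set.mem_singleton_iff, Set.mem_insert_iff]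
      by_cases hx : x = a
      · subst hx; simp [hp.2]
      · simp [hx]
  have hsC : ∀ v, v ∈ (wg (W₂.append W₃.reverse)).support ↔ v ∈ W₂.support ∨ v ∈ W₃.support := by
    intro v
    rw [wg_supp _ h.c23.not_nil, Walk.mem_support_append_iff, Walk.support_reverse, List.mem_reverse]
  have hdj : Disjoint (wg (W₂.append W₃.reverse)).support ({v | v ∈ W₁.support} \ {a, b}) := by
    rw [Set.disjoint_left]
    rintro v hv ⟨h1, h2⟩
    apply h2
    rcases (hsC v).1 hv with hv | hv
    · exact h.d12 v h1 hv
    · exact h.d13 v h1 hv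
  have hun : (wg (W₂.append W₃.reverse)).support ∪ ({v | v ∈ W₁.support} \ {a, b}) = Set.univ := by
    rw [Set.eq_univ_iff_forall]
    intro v
    by_cases hv : v ∈ (wg (W₂.append W₃.reverse)).support
    · exact Or.inl hv
    · right
      rw [hsC] at hv
      push Not at hv
      refine ⟨by have := h.ver v; simp only [Set.mem_setOf_eq]; tauto, ?_⟩
      rintro (rfl | rfl)
      · exact hv.1 W₂.start_mem_support
      · exact hv.1 W₂.end_mem_support
  have hm : Mt M.graph Set.univ := by
    rw [← hun]
    exact (mt_even_cyc hC ((hsC a).2 (Or.inl W₂.start_mem_support))).1.union hA hdj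
  have hcard : Nat.card V + 1 = W₁.length + W₂.length + W₃.length := by
    rw [← Set.ncard_univ, ← hun, Set.ncard_union_eq hdj, cycle_ncard _ h.c23, Walk.length_append, Walk.length_reverse]
    have e1 : ({v | v ∈ W₁.support} \ {a, b} : Set V).ncard + 2 = {v | v ∈ W₁.support}.ncard := by
      rw [← Set.ncard_pair hab]
      exact Set.ncard_sdiff_add_ncard_of_subset (by rintro y (rfl | rfl) <;> simp)
    have e2 : {v | v ∈ W₁.support}.ncard = W₁.length + 1 := by
      rw [← Walk.length_support, ← List.toFinset_card_of_nodup h.p1.support_nodup, ← Set.ncard_coe_finset]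
      congr 1; ext; simp
    omega
  rw [ext_full hm (kp_one hC (fun Z hz => h.even hD hz))]
  have hz : M.hMatrix = pm M.hMatrix W₁ + pm M.hMatrix W₂ + pm M.hMatrix W₃ := by
    ext i j
    rw [Matrix.add_apply, Matrix.add_apply, pm_apply _ _ h.p1.isTrail, pm_apply _ _ h.p2.isTrail, pm_apply _ _ h.p3.isTrail]
    have k12 : s(i,j) ∈ W₂.edges → s(i,j) ∉ W₁.edges := fun h1 h2 =>
      paths_edge_disj h.p2 (fun v h1 h2 => h.d12 v h2 h1) (even_len h.ne h.e2) h1 h2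
    have k13 : s(i,j) ∈ W₃.edges → s(i,j) ∉ W₁.edges := fun h1 h2 =>
      paths_edge_disj h.p3 (fun v h1 h2 => h.d13 v h2 h1) (even_len h.ne h.e3) h1 h2
    have k23 : s(i,j) ∈ W₂.edges → s(i,j) ∉ W₃.edges := fun h1 h2 =>
      paths_edge_disj h.p2 h.d23 (even_len h.ne h.e2) h1 h2
    by_cases hadj : M.graph.Adj i j
    · rcases h.edg s(i, j) hadj with hh | hh | hh
      · have := mt k12; have := mt k13
        simp_all
      · have := k12 hh; have := k23 hh
        simp_all
      · have := k13 hh; have := mt k23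
        simp_all
    · rw [hM_zero M hadj]; simp
  have key := theta_rank M W₁ W₂ W₃ h.p1 h.p2 h.p3 h.o1 h.e2 h.e3 h.d12 h.d13 h.d23
  rw [← hz] at key
  rw [os_iff M _ h.c12 h.l12, os_iff M _ h.swap.c12 h.swap.l12, bs_iff M _ h.c23 h.l23, walkSig_eq, walkSig_eq, walkSig_eq]
  simp only [sgz_append, sgz_reverse, Walk.length_append, Walk.length_reverse, Nat.odd_iff]
  have : M.hMatrix.rank + 2 = Nat.card V ↔ M.hMatrix.rank + 3 = W₁.length + W₂.length + W₃.length := by omega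
  rw [this, key]
  obtain ⟨k2, hk2⟩ := h.e2
  obtain ⟨k3, hk3⟩ := h.e3
  obtain ⟨k1, hk1⟩ := h.o1
  generalize sgz M W₁ = A
  generalize sgz M W₂ = B
  generalize sgz M W₃ = D
  constructor
  · rintro ⟨h1, h2, h3⟩; refine ⟨by omega, by omega, by omega⟩
  · rintro ⟨h1, h2, h3⟩; refine ⟨by omega, by omega, by omega⟩

end bic

section T13
open SimpleGraph
variable [Fintype V] [DecidableEq V] {M : MixedGraph V}

lemma top_sc (G : SimpleGraph V) : (⊤ : G.Subgraph).spanningCoe = G := by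
  ext a b; simp

lemma cycleMG_iff : IsCycleMG M ↔ IsCyc M.graph ∧ M.graph.support = Set.univ := by
  constructor
  · intro h
    have := isCyc_of_sub h
    rw [top_sc] at this
    exact ⟨this.1, by simpa using this.2⟩
  · rintro ⟨h, hs⟩
    have h1 := sub_of_isCyc h le_rfl
    have h2 : sgOf M.graph le_rfl = (⊤ : M.graph.Subgraph) := by
      ext a b
      · simp [sgOf, hs]
      · simp [sgOf]
    rw [h2] at h1
    exact h1

lemma ext_single (h : Nat.card V = 1) : Ext M Set.univ := by
  have hs : Subsingleton V := (Nat.card_eq_one_iff_unique.1 h).1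
  have hb : M.graph = ⊥ := by
    ext a b
    simp only [bot_adj, iff_false]
    intro hab
    exact hab.ne (Subsingleton.elim _ _)
  have h1 : mS M.graph Set.univ = 0 := by
    have := mS_le_card M.graph (Set.univ : Set V)
    rw [Set.ncard_univ] at this
    omega
  have h2 : kS M.graph Set.univ = 0 := by
    unfold kS
    apply kp_zero
    rintro ⟨Z, hZ⟩
    obtain ⟨a, b, hab⟩ := hZ.1.edge
    exact hab.ne (Subsingleton.elim _ _)
  have h3 : rk M Set.univ = 0 := by
    have : rk M (Set.univ : Set V) = M.hMatrix.rank := by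
      rw [rk_univ]; rfl
    rw [this, rank_zero_iff]
    ext i j
    apply hM_zero
    rw [hb]; simp
  unfold Ext
  omega

lemma good_iff (hc : IsCyc M.graph) (hs : M.graph.support = Set.univ) (he : Even (Nat.card V)) :
    Ext M Set.univ ↔ CycleSig M ⊤ (fun s => s % 4 = (Nat.card V) % 4) := by
  rw [ext_even_cyc hc hs he]
  rw [cycleSig_even M (cycleMG_iff.2 ⟨hc, hs⟩) (by simpa [Set.ncard_univ] using he) _
    (fun s => by simp [Set.ncard_univ]), top_sc]

lemma oddc_iff (hc : IsCyc M.graph) (hs : M.graph.support = Set.univ) (he : Odd (Nat.card V)) :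
    Ext M Set.univ ↔ CycleSig M ⊤ Odd := by
  rw [ext_odd_cyc hc hs he]
  rw [cycleSig_odd M (cycleMG_iff.2 ⟨hc, hs⟩) (by simpa [Set.ncard_univ] using he), top_sc]

lemma ext_of_good (h : GoodOtherComp M) : Ext M Set.univ := by
  rcases h with ⟨h1, h2, h3⟩ | h
  · obtain ⟨hc, hs⟩ := cycleMG_iff.1 h1
    exact (good_iff hc hs h2).2 h3
  · exact ext_single h

lemma ext_of_oddc (h : IsCycleMG M ∧ Odd (Nat.card V) ∧ CycleSig M ⊤ Odd) : Ext M Set.univ := by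
  obtain ⟨h1, h2, h3⟩ := h
  obtain ⟨hc, hs⟩ := cycleMG_iff.1 h1
  exact (oddc_iff hc hs h2).2 h3

lemma ec_of_sub {G : SimpleGraph V} {C : G.Subgraph} (h : IsCycleSubgraph C)
    (he : Even C.verts.ncard) : EC G C.spanningCoe :=
  ⟨(isCyc_of_sub h).1, C.spanningCoe_le, by rw [(isCyc_of_sub h).2]; exact he⟩

lemma oc_of_sub {G : SimpleGraph V} {C : G.Subgraph} (h : IsCycleSubgraph C)
    (he : Odd C.verts.ncard) : OC G C.spanningCoe :=
  ⟨(isCyc_of_sub h).1, C.spanningCoe_le, by rw [(isCyc_of_sub h).2]; exact he⟩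

lemma oddSig_iff : OddCyclesSig M Odd ↔ ∀ Z, OC M.graph Z → OS M Z := by
  constructor
  · intro h Z hZ
    have h1 := sub_of_isCyc hZ.1 hZ.2.1
    have h2 := h _ h1 hZ.2.2
    rw [cycleSig_odd M h1 hZ.2.2, spanningCoe_sgOf] at h2
    exact h2
  · intro h C hC ho
    rw [cycleSig_odd M hC ho]
    exact h _ (oc_of_sub hC ho)

lemma evenSig_iff {P : ℕ → ℕ → Prop} (hP : ∀ Z, EC M.graph Z → ∀ s, P Z.support.ncard s ↔
    s % 4 = Z.support.ncard % 4) :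
    EvenCyclesSig M P ↔ ∀ Z, EC M.graph Z → BS M Z := by
  constructor
  · intro h Z hZ
    have h1 := sub_of_isCyc hZ.1 hZ.2.1
    have h2 := h _ h1 hZ.2.2
    have h3 := (cycleSig_even M h1 hZ.2.2 _ (hP Z hZ)).1 h2
    rwa [spanningCoe_sgOf] at h3
  · intro h C hC ho
    have := hP _ (ec_of_sub hC ho)
    rw [(isCyc_of_sub hC).2] at this
    rw [cycleSig_even M hC ho _ this]
    exact h _ (ec_of_sub hC ho)

lemma ext_of_x1 (hD : DE M.graph) (h : MemX1 M) : Ext M Set.univ := by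
  obtain ⟨p, q, hp, hq, ⟨C₁, C₂, h1, h2, e1, e2, h3, h4⟩, ho, he⟩ := h
  rw [oddSig_iff] at ho
  rw [evenSig_iff (fun Z hZ s => Iff.rfl)] at he
  obtain ⟨x, hx⟩ := Set.ncard_eq_one.1 h3
  have hC := ec_of_sub h1 (e1 ▸ hp)
  have hΓ := oc_of_sub h2 (e2 ▸ hq)
  refine (x1_ext hD hC hΓ (x := x) ?_ ?_ ?_).2 ⟨ho _ hΓ, he _ hC⟩
  · rw [(isCyc_of_sub h1).2, (isCyc_of_sub h2).2, hx]
  · ext a b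
    have : (C₁ ⊔ C₂).Adj a b ↔ M.graph.Adj a b := by rw [h4]; simp
    rw [← this]; simp
  · rw [(isCyc_of_sub h1).2, (isCyc_of_sub h2).2]
    have := congrArg Subgraph.verts h4
    simpa using this

lemma x1_of_ext (hD : DE M.graph) (hU : Unic M.graph) {C Γ : SimpleGraph V} (hC : EC M.graph C)
    (hΓ : OC M.graph Γ) {x : V} (hx : C.support ∩ Γ.support = {x}) (hG : M.graph = C ⊔ Γ)
    (hV : C.support ∪ Γ.support = Set.univ) (hE : Ext M Set.univ) : MemX1 M := by
  obtain ⟨h1, h2⟩ := (x1_ext hD hC hΓ hx hG hV).1 hE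
  refine ⟨_, _, hC.2.2, hΓ.2.2, ⟨sgOf C hC.2.1, sgOf Γ hΓ.2.1, sub_of_isCyc hC.1 _,
    sub_of_isCyc hΓ.1 _, rfl, rfl, ?_, ?_⟩, ?_, ?_⟩
  · show (C.support ∩ Γ.support).ncard = 1
    rw [hx]; simp
  · ext a b
    · have : a ∈ C.support ∪ Γ.support := by rw [hV]; trivial
      simpa [sgOf] using this
    · have : M.graph.Adj a b ↔ (C ⊔ Γ).Adj a b := by rw [← hG]
      simp only [Subgraph.sup_adj, sgOf, Subgraph.top_adj]
      rw [this]; simp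
  · rw [oddSig_iff]
    intro Z hZ
    rw [x1_odd hD hU hC hΓ hx hG hZ]; exact h1
  · rw [evenSig_iff (fun Z hZ s => Iff.rfl)]
    intro Z hZ
    rw [x1_even hD hC hΓ hG hZ]; exact h2

lemma x2P {l q n : ℕ} (hl : Odd l) (hq : Odd q) (hn : n + 2 = q + l) (s : ℕ) :
    (q + l + s) % 4 = 2 ↔ s % 4 = n % 4 := by
  obtain ⟨a, rfl⟩ := hl
  obtain ⟨b, rfl⟩ := hq
  omega

lemma th_ncard {a b : V} {W₁ W₂ W₃ : M.graph.Walk a b} (h : Th M.graph W₁ W₂ W₃) :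
    (wg (W₂.append W₃.reverse)).support.ncard = W₂.length + W₃.length := by
  rw [cycle_ncard _ h.c23]; simp

lemma ext_of_x2 (hD : DE M.graph) (h : MemX2 M) : Ext M Set.univ := by
  obtain ⟨p, l, q, hp, hl, hq, ⟨h1, h2, h3, -, -, -, a, b, W₁, W₂, W₃, p1, p2, p3, l1, l2, l3,
    hv, he, d12, d13, d23⟩, so, se⟩ := h
  have T : Th M.graph W₁ W₂ W₃ := by
    refine ⟨p1, p2, p3, ?_, ?_, ?_, ?_, ?_, ?_, hv, he⟩
    · rw [l1]; obtain ⟨k, rfl⟩ := hp; exact ⟨k - 1, by omega⟩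
    · rw [l2]; obtain ⟨k, rfl⟩ := hl; exact ⟨k, by omega⟩
    · rw [l3]; obtain ⟨k, rfl⟩ := hq; exact ⟨k, by omega⟩
    · intro v x y
      have : v ∈ ({a, b} : Set V) := d12 ▸ (⟨x, y⟩ : _ ∧ _)
      simpa using this
    · intro v x y
      have : v ∈ ({a, b} : Set V) := d13 ▸ (⟨x, y⟩ : _ ∧ _)
      simpa using this
    · intro v x y
      have : v ∈ ({a, b} : Set V) := d23 ▸ (⟨x, y⟩ : _ ∧ _)
      simpa using this
  rw [th_ext T hD]
  rw [oddSig_iff] at so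
  rw [evenSig_iff (fun Z hZ s => x2P hl hq (by
    rw [T.even hD hZ, th_ncard T]; omega) s)] at se
  exact ⟨so _ T.oc, so _ (Th.swap T).oc, se _ T.ec⟩

lemma x2_of_ext (hD : DE M.graph) (hU : Unic M.graph) {a b : V} {W₁ W₂ W₃ : M.graph.Walk a b}
    (T : Th M.graph W₁ W₂ W₃) (hE : Ext M Set.univ) : MemX2 M := by
  obtain ⟨h1, h2, h3⟩ := (th_ext T hD).1 hE
  have hne := T.ne
  have g2 : 2 ≤ W₂.length := by
    have : W₂.length ≠ 0 := fun h => hne (Walk.eq_of_length_eq_zero h)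
    obtain ⟨k, hk⟩ := T.e2; omega
  have g3 : 2 ≤ W₃.length := by
    have : W₃.length ≠ 0 := fun h => hne (Walk.eq_of_length_eq_zero h)
    obtain ⟨k, hk⟩ := T.e3; omega
  have g1 : 1 ≤ W₁.length := by
    obtain ⟨k, hk⟩ := T.o1; omega
  refine ⟨W₁.length + 1, W₂.length + 1, W₃.length + 1, T.o1.add_one, T.e2.add_one, T.e3.add_one,
    ⟨by omega, by omega, by omega, by omega, by omega, by omega, a, b, W₁, W₂, W₃, T.p1, T.p2, T.p3,
      by omega, by omega, by omega, T.ver, T.edg, ?_, ?_, ?_⟩, ?_, ?_⟩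
  · ext v
    constructor
    · rintro ⟨x, y⟩; simpa using T.d12 v x y
    · rintro (rfl | rfl) <;> simp
  · ext v
    constructor
    · rintro ⟨x, y⟩; simpa using T.d13 v x y
    · rintro (rfl | rfl) <;> simp
  · ext v
    constructor
    · rintro ⟨x, y⟩; simpa using T.d23 v x y
    · rintro (rfl | rfl) <;> simp
  · rw [oddSig_iff]
    intro Z hZ
    rcases T.odd hD hU hZ with rfl | rfl
    · exact h1
    · exact h2
  · rw [evenSig_iff (fun Z hZ s => x2P T.e2.add_one T.e3.add_one (by
      rw [T.even hD hZ, th_ncard T]; omega) s)]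
    intro Z hZ
    rw [T.even hD hZ]; exact h3

end T13

section T14
open SimpleGraph
variable [Fintype V]

lemma chordless {H C : SimpleGraph V} (hE : EvCa H) (hC : IsCyc C) (hle : C ≤ H) {a b : V}
    (ha : a ∈ C.support) (hb : b ∈ C.support) (hab : H.Adj a b) : C.Adj a b := by
  by_contra hn
  have h1 : (H.deleteEdges {s(a, b)}).Reachable a b :=
    (hC.conn a b ha hb).mono (le_de hle hn)
  obtain ⟨Z, hZ, hZle, hZa⟩ := exists_cyc_of_reach hab h1
  have hne : Z ≠ C := by rintro rfl; exact hn hZa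
  have := hE.2 Z C ⟨hZ, hZle, hE.1 Z hZ hZle⟩ ⟨hC, hle, hE.1 C hC hle⟩ hne
  exact Set.disjoint_left.1 this (mem_supp_l hZa) ha

lemma tw_univ [Nontrivial V] {G : SimpleGraph V} (hc : G.Connected) (hn : NoPendantVerts G) (t : V) :
    Tw G Set.univ t := by
  obtain ⟨w, hw⟩ := hc.preconnected.exists_adj_of_nontrivial t
  have h1 : {w | G.Adj t w}.ncard ≠ 0 := by
    rw [Ne, Set.ncard_eq_zero (Set.toFinite _)]
    exact Set.nonempty_iff_ne_empty.1 ⟨w, hw⟩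
  have h2 := hn t
  have h3 : 1 < {w | G.Adj t w}.ncard := by omega
  obtain ⟨a, ha, b, hb, hab⟩ := (Set.one_lt_ncard (Set.toFinite _)).1 h3
  exact ⟨a, b, hab, trivial, trivial, ha, hb⟩

/-- an edge leaving a nonempty proper set in a connected graph -/
lemma cross_edge {G : SimpleGraph V} (hc : G.Connected) {S : Set V} (h1 : S.Nonempty) (h2 : Sᶜ.Nonempty) :
    ∃ y ∈ Sᶜ, ∃ c ∈ S, G.Adj y c := by
  obtain ⟨c, hc1⟩ := h1
  obtain ⟨y, hy⟩ := h2
  by_contra hcon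
  push Not at hcon
  have := reach_ind (Z := G) (fun v => v ∈ S) (fun a b hab ha => by
    by_contra hb
    exact hcon b hb a ha hab.symm) (hc.preconnected c y) hc1
  exact hy this

lemma isAcyclic_of {G : SimpleGraph V} (h : ∀ Z, IsCyc Z → ¬ Z ≤ G) : G.IsAcyclic := by
  intro v w hw
  exact h _ (isCyc_wg w hw) (wg_le w)

lemma exists_cyc [Nontrivial V] {G : SimpleGraph V} (hc : G.Connected) (hn : NoPendantVerts G) :
    ∃ Z, IsCyc Z ∧ Z ≤ G := by
  by_contra hcon
  push Not at hcon
  have ht : G.IsTree := ⟨hc, isAcyclic_of hcon⟩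
  obtain ⟨v, hv⟩ := ht.exists_vert_degree_one_of_nontrivial
  apply hn v
  rw [← hv, ← card_neighborFinset_eq_degree, ← Set.ncard_coe_finset]
  congr 1
  ext; simp

variable [DecidableEq V] {M : MixedGraph V}

lemma case_I (hc : M.graph.Connected) (hn : NoPendantVerts M.graph) (hE : Ext M Set.univ)
    (ho : ¬ ∃ Z, OC M.graph Z) : GoodOtherComp M := by
  have hD : DE M.graph := by have := ext_DE M hE; rwa [rs_univ] at this
  rcases subsingleton_or_nontrivial V with hs | hs
  · right
    rw [Nat.card_eq_one_iff_unique]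
    exact ⟨hs, hc.nonempty⟩
  · left
    obtain ⟨C, hC, hle⟩ := exists_cyc hc hn
    have hEv : EvCa M.graph := ⟨fun Z hZ hle => by
      by_contra h
      exact ho ⟨Z, hZ, hle, Nat.not_even_iff_odd.1 h⟩, hD⟩
    have hV : C.support = Set.univ := by
      by_contra hne
      obtain ⟨a, b, hab⟩ := hC.edge
      have h2 : C.supportᶜ.Nonempty := Set.nonempty_compl.2 hne
      have h3 := cross_edge hc ⟨a, mem_supp_l hab⟩ h2
      have h4 := (ylem hEv hC hle (Y := C.supportᶜ) disjoint_compl_left (fun t _ => by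
        rw [Set.compl_union_self]; exact tw_univ hc hn t)).2 h3
      rw [Set.compl_union_self] at h4
      exact pc_ext hE h4
    have hG : M.graph = C := by
      ext a b
      exact ⟨fun h => chordless hEv hC hle (by rw [hV]; trivial) (by rw [hV]; trivial) h, fun h => hle h⟩
    rw [← hG] at hC hV
    have hev : Even (Nat.card V) := by
      have := hEv.1 _ hC le_rfl
      rwa [hV, Set.ncard_univ] at this
    exact ⟨cycleMG_iff.2 ⟨hC, hV⟩, hev, (good_iff hC hV hev).1 hE⟩

end T14

section T15
open SimpleGraph
variable [Fintype V] [DecidableEq V] {M : MixedGraph V}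

lemma not_os_rank {Γ : SimpleGraph V} (hΓ : OC M.graph Γ) (h : ¬ OS M Γ) :
    (zm M Γ).rank = Γ.support.ncard := by
  obtain ⟨a, b, hab⟩ := hΓ.1.edge
  obtain ⟨w, hw, rfl⟩ := hΓ.1.exists_walk' hΓ.2.1 (mem_supp_l hab)
  have ho : Odd w.length := by have := hΓ.2.2; rwa [cycle_ncard w hw] at this
  obtain ⟨δ, h1, h2⟩ := oddcyc_rank M w hw ho
  have h3 := h2 0 (by simp)
  rw [zero_add, zero_add, pm_eq_zm M w hw.isTrail] at h3
  rw [os_iff M w hw ho, ← h1] at h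
  rw [rank_single_self _ _ h] at h3
  rw [cycle_ncard w hw]
  omega

/-- matching bound across a single gate vertex -/
lemma m_upper (G : SimpleGraph V) {A : Set V} (hA : Even A.ncard) {x : V} (hxA : x ∉ A)
    (hg : ∀ a ∈ A, ∀ b, b ∉ A → G.Adj a b → b = x) : 2 * mS G Set.univ ≤ 2 * mS G Aᶜ + A.ncard := by
  obtain ⟨T, ⟨f, hf⟩, hT⟩ := mnum_ex (rs G Set.univ)
  have hf' : ∀ v ∈ T, f v ∈ T ∧ G.Adj v (f v) ∧ f (f v) = v := by
    intro v hv
    obtain ⟨h1, h2, h3⟩ := hf v hv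
    exact ⟨h1, h2.1, h3⟩
  rw [mS, ← hT]
  by_cases hx : x ∈ T ∧ f x ∈ A
  · have h1 : Mt (rs G Aᶜ) (T \ (A ∪ {x})) := by
      apply Mt.rs
      · refine ⟨f, ?_⟩
        rintro v ⟨hv, hv'⟩
        simp only [Set.mem_union, Set.mem_singleton_iff, not_or] at hv'
        obtain ⟨k1, k2, k3⟩ := hf' v hv
        refine ⟨⟨k1, ?_⟩, k2, k3⟩
        rintro (hh | hh)
        · exact hv'.2 (hg _ hh _ hv'.1 k2.symm)
        · have : f v = x := hh
          rw [this] at k3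
          exact hv'.1 (k3 ▸ hx.2)
      · rintro v ⟨hv, hv'⟩ h
        exact hv' (Or.inl h)
    have h2 : Mt G ((T ∩ A) \ {f x}) := by
      refine ⟨f, ?_⟩
      rintro v ⟨⟨hv, hvA⟩, hv'⟩
      obtain ⟨k1, k2, k3⟩ := hf' v hv
      refine ⟨⟨⟨k1, ?_⟩, ?_⟩, k2, k3⟩
      · by_contra hh
        have := hg _ hvA _ hh k2
        rw [this] at k3
        exact hv' k3.symm
      · intro hh
        have hh : f v = f x := hh
        have : v = x := by rw [← k3, hh, (hf' x hx.1).2.2]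
        exact hxA (this ▸ hvA)
    have e1 := mnum_ge h1
    have e2 := mt_even h2
    have e3 : ((T ∩ A) \ {f x}).ncard + 1 = (T ∩ A).ncard :=
      Set.ncard_sdiff_singleton_add_one ⟨(hf' x hx.1).1, hx.2⟩ (Set.toFinite _)
    have e4 : (T ∩ A).ncard ≤ A.ncard := Set.ncard_le_ncard Set.inter_subset_right (Set.toFinite _)
    have e5 : T.ncard ≤ (T \ (A ∪ {x})).ncard + ((T ∩ A).ncard + 1) := by
      have : T ⊆ (T \ (A ∪ {x})) ∪ ((T ∩ A) ∪ {x}) := by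
        intro v hv
        by_cases h1 : v ∈ A <;> by_cases h2 : v = x <;> simp [h1, h2, hv]
      refine (Set.ncard_le_ncard this (Set.toFinite _)).trans ?_
      refine (Set.ncard_union_le _ _).trans ?_
      have := Set.ncard_union_le (T ∩ A) {x}
      rw [Set.ncard_singleton] at this
      omega
    simp only [mS]
    obtain ⟨i, hi⟩ := e2
    obtain ⟨j, hj⟩ := hA
    omega
  · have h1 : Mt (rs G Aᶜ) (T \ A) := by
      apply Mt.rs
      · refine ⟨f, ?_⟩
        rintro v ⟨hv, hv'⟩
        obtain ⟨k1, k2, k3⟩ := hf' v hv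
        refine ⟨⟨k1, fun hh => ?_⟩, k2, k3⟩
        have := hg _ hh _ hv' k2.symm
        subst this
        exact hx ⟨hv, hh⟩
      · rintro v ⟨hv, hv'⟩; exact hv'
    have e1 := mnum_ge h1
    have e5 : T.ncard ≤ (T \ A).ncard + A.ncard := by
      have := Set.ncard_inter_add_ncard_sdiff_eq_ncard T A (Set.toFinite _)
      have h4 : (T ∩ A).ncard ≤ A.ncard := Set.ncard_le_ncard Set.inter_subset_right (Set.toFinite _)
      omega
    simp only [mS]
    omega

lemma g0_ext {Γ : SimpleGraph V} (hΓ : OC M.graph Γ) {x : V} (hx : x ∈ Γ.support)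
    (hin : ∀ a ∈ Γ.support, ∀ b ∈ Γ.support, M.graph.Adj a b → Γ.Adj a b)
    (hout : ∀ a ∈ Γ.support, ∀ b, b ∉ Γ.support → M.graph.Adj a b → a = x)
    (hos : OS M Γ) (hec : ∀ Z, EC M.graph Z → Z.support ⊆ Γ.supportᶜ ∪ {x}) :
    Ext M Set.univ ↔ Ext M (Γ.supportᶜ ∪ {x}) := by
  have hA : (Γ.support \ {x})ᶜ = Γ.supportᶜ ∪ {x} := by
    ext v; simp only [Set.mem_compl_iff, Set.mem_sdiff, Set.mem_singleton_iff, Set.mem_union]; tauto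
  have hcard : (Γ.support \ {x}).ncard + 1 = Γ.support.ncard :=
    Set.ncard_sdiff_singleton_add_one hx (Set.toFinite _)
  have hm1 := m_upper M.graph (A := Γ.support \ {x}) (by
    have := hΓ.2.2
    rw [← hcard] at this
    by_contra h
    exact (Nat.not_even_iff_odd.2 this) (Nat.not_even_iff_odd.1 h).add_one) (x := x) (by simp) (by
    rintro a ⟨ha, ha'⟩ b hb hab
    by_contra hbx
    have hb' : b ∉ Γ.support := fun h => hb ⟨h, hbx⟩
    exact ha' (hout a ha b hb' hab))
  rw [hA] at hm1
  have hm2 : 2 * mS M.graph (Γ.supportᶜ ∪ {x}) + (Γ.support \ {x}).ncard ≤ 2 * mS M.graph Set.univ := by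
    obtain ⟨T, hT, hT'⟩ := mnum_ex (rs M.graph (Γ.supportᶜ ∪ {x}))
    have hd : Disjoint T (Γ.support \ {x}) := by
      rw [Set.disjoint_left]
      intro v hv
      have := hT.sub hv
      rw [← hA] at this
      exact this
    have := mnum_ge (((hT.mono (rs_le _ _)).union (mt_odd_cyc hΓ hx) hd).rs (Set.subset_univ _))
    rw [Set.ncard_union_eq hd, hT'] at this
    exact this
  have hk : kS M.graph Set.univ = kS M.graph (Γ.supportᶜ ∪ {x}) := by
    apply le_antisymm _ (kp_mono (rs_mono _ (Set.subset_univ _)))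
    unfold kp
    apply Set.ncard_le_ncard _ (Set.toFinite _)
    intro Z hZ
    have hZ' : EC M.graph Z := ⟨hZ.1, hZ.2.1.trans (rs_le _ _), hZ.2.2⟩
    exact ⟨hZ.1, le_rs hZ'.2.1 (hec Z hZ'), hZ.2.2⟩
  have hr : rk M Set.univ + 1 = rk M (Γ.supportᶜ ∪ {x}) + Γ.support.ncard := by
    rw [rk, rk, ← gate_rank M hΓ hos hx]
    · congr 2
      ext i j
      simp only [mk, zm, Matrix.of_apply, Matrix.add_apply, Set.mem_univ, and_self, if_true]
      rw [← hA]
      by_cases h1 : Γ.Adj i j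
      · rw [if_pos h1, if_neg, zero_add]
        rintro ⟨h2, h3⟩
        have e1 : i = x := by by_contra h; exact h2 ⟨mem_supp_l h1, h⟩
        have e2 : j = x := by by_contra h; exact h3 ⟨mem_supp_r h1, h⟩
        exact h1.ne (e1.trans e2.symm)
      · rw [if_neg h1, add_zero]
        split_ifs with h2
        · rfl
        · apply hM_zero
          intro hij
          apply h2
          constructor
          · rintro ⟨h3, h4⟩
            by_cases h5 : j ∈ Γ.support
            · exact h1 (hin _ h3 _ h5 hij)
            · exact h4 (hout _ h3 _ h5 hij)
          · rintro ⟨h3, h4⟩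
            by_cases h5 : i ∈ Γ.support
            · exact h1 (hin _ h5 _ h3 hij)
            · exact h4 (hout _ h3 _ h5 hij.symm)
    · intro v hv hvx j
      have : v ∉ Γ.supportᶜ ∪ {x} := by rw [← hA]; exact fun h => h ⟨hv, hvx⟩
      simp only [mk, Matrix.of_apply]
      rw [if_neg (fun h => this h.1), if_neg (fun h => this h.2)]
      exact ⟨rfl, rfl⟩
  unfold Ext
  omega

end T15

section T16
open SimpleGraph
variable [Fintype V]

structure IsoOdd (G Γ : SimpleGraph V) : Prop where
  oc : OC G Γ
  dis : ∀ C, EC G C → Disjoint Γ.support C.support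
  uni : ∀ Z, OC G Z → Z = Γ

lemma isoOdd_of {G Γ : SimpleGraph V} (hU : Unic G) (oc : OC G Γ)
    (dis : ∀ C, EC G C → Disjoint Γ.support C.support) : IsoOdd G Γ := by
  refine ⟨oc, dis, fun Z hZ => ?_⟩
  refine (cyc_le_eq oc.1 hZ.1 ?_).symm
  intro a b hab
  refine hU G le_rfl a b ⟨Γ, oc, hab⟩ ?_ Z hZ
  rintro ⟨C, hC, hC'⟩
  exact Set.disjoint_left.1 (dis C hC) (mem_supp_l hab) (mem_supp_l hC')

variable {G Γ : SimpleGraph V}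

lemma IsoOdd.nocyc (h : IsoOdd G Γ) {Z : SimpleGraph V} (hZ : IsCyc Z) (hle : Z ≤ G) {u y : V}
    (hu : u ∈ Γ.support) (huy : Z.Adj u y) : Γ.Adj u y := by
  rcases Nat.even_or_odd Z.support.ncard with he | ho
  · exact absurd (mem_supp_l huy) (Set.disjoint_left.1 (h.dis Z ⟨hZ, hle, he⟩) hu)
  · rw [← h.uni Z ⟨hZ, hle, ho⟩]; exact huy

lemma IsoOdd.hin (h : IsoOdd G Γ) {a b : V} (ha : a ∈ Γ.support) (hb : b ∈ Γ.support)
    (hab : G.Adj a b) : Γ.Adj a b := by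
  by_contra hn
  obtain ⟨Z, hZ, hZle, hZa⟩ := exists_cyc_of_reach hab
    ((h.oc.1.conn a b ha hb).mono (le_de h.oc.2.1 hn))
  exact hn (h.nocyc hZ hZle ha hZa)

lemma IsoOdd.evca (h : IsoOdd G Γ) (hD : DE G) {a b : V} (hab : Γ.Adj a b) : EvCa (de G a b) := by
  refine ⟨fun Z hZ hle => ?_, hD.mono (de_le _ _ _)⟩
  by_contra ho
  have := h.uni Z ⟨hZ, hle.trans (de_le _ _ _), Nat.not_even_iff_odd.1 ho⟩
  exact (le_de_iff.1 hle).2 (this ▸ hab)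

lemma IsoOdd.nox (h : IsoOdd G Γ) : NoX G Γ.supportᶜ Γ.support := by
  intro Z hZ hle d hd k hk hdk
  exact hd (mem_supp_r (h.nocyc hZ (hle.trans (rs_le _ _)) hk hdk.symm))

lemma de_adj_of_not {a b d w : V} (h : G.Adj d w) (ha : d ≠ a) (hb : d ≠ b) : (de G a b).Adj d w := by
  simp only [de, deleteEdges_adj, Set.mem_singleton_iff, Sym2.eq_iff]
  tauto

lemma IsoOdd.branch (h : IsoOdd G Γ) (hD : DE G) {D : Set V} (hDs : D ⊆ Γ.supportᶜ) {d : V}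
    (hB : Brn G D d) : Pc G D 0 ∧ (∀ z ∈ Γ.support, G.Adj d z → Pc G (D ∪ {z}) 0) ∧
      (Pc G D 1 ∨ ∀ z ∈ Γ.support, G.Adj d z → Pc G (D ∪ {z}) 1) := by
  obtain ⟨a, b, hab⟩ := h.oc.1.edge
  have key : ∀ t ∈ D, ∀ w, G.Adj t w → (de G a b).Adj t w := by
    intro t ht w hw
    refine de_adj_of_not hw ?_ ?_
    · rintro rfl; exact hDs ht (mem_supp_l hab)
    · rintro rfl; exact hDs ht (mem_supp_r hab)
  have hB' : Brn (de G a b) D d := by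
    obtain ⟨h1, h2, w, hw, hw'⟩ := hB
    refine ⟨h1, fun t ht htd => ?_, w, hw, key d h1 w hw'⟩
    obtain ⟨w1, w2, hne, m1, m2, a1, a2⟩ := h2 t ht htd
    exact ⟨w1, w2, hne, m1, m2, key t ht _ a1, key t ht _ a2⟩
  obtain ⟨p1, p2, p3⟩ := MixedPaper.branch (h.evca hD hab) _ D d rfl hB'
  have hz : ∀ z ∈ Γ.support, z ∉ D := fun z hz hzD => hDs hzD hz
  refine ⟨p1.mono (de_le _ _ _), fun z hzΓ hdz => (p2 z (hz z hzΓ) (key d hB.1 z hdz)).mono (de_le _ _ _), ?_⟩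
  rcases p3 with p3 | p3
  · exact Or.inl (p3.mono (de_le _ _ _))
  · exact Or.inr fun z hzΓ hdz => (p3 z (hz z hzΓ) (key d hB.1 z hdz)).mono (de_le _ _ _)

/-- all components of the complement of Γ have defect at most zero -/
lemma IsoOdd.cmp (h : IsoOdd G Γ) (hD : DE G) (hT : ∀ t, Tw G Set.univ t) {D : Set V}
    (hC : IsCmp G Γ.supportᶜ D) : Pc G D 0 ∧ ∀ d ∈ D, (∃ k ∈ Γ.support, G.Adj d k) → Brn G D d := by
  obtain ⟨⟨d, hd⟩, h2⟩ := cmp_brn (Y := Γ.supportᶜ) (K := Γ.support) disjoint_compl_left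
    (con_cyc h.oc.1 h.oc.2.1) h.nox (fun t _ => by rw [Set.compl_union_self]; exact hT t) hC
  exact ⟨(h.branch hD hC.1 hd).1, h2⟩

lemma cmp_disj {H : SimpleGraph V} {Y D D' : Set V} (h : IsCmp H Y D) (h' : IsCmp H Y D')
    {v : V} (hv : v ∈ D) (hv' : v ∈ D') : D' ⊆ D := by
  intro w hw
  have := reach_ind (Z := rs H D') (fun v => v ∈ D) (fun a b hab ha =>
    h.2.2.2 a ha b (h'.1 hab.2.2) hab.1) (h'.2.2.1 v hv' w hw) hv
  exact this

lemma IsoOdd.plus (h : IsoOdd G Γ) (hD : DE G) (hT : ∀ t, Tw G Set.univ t) {D : Set V}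
    (hC : IsCmp G Γ.supportᶜ D) {u : V} (hu : u ∈ Γ.support)
    (hp : Pc G (D ∪ {u}) 1) : Pc G Set.univ 1 := by
  have h1 := pc_rest hC (fun D' hD' => (h.cmp hD hT hD').1)
  have h2 := pc_of_mt (mt_odd_cyc h.oc hu)
  have hDs : ∀ v ∈ D, v ∉ Γ.support := hC.1
  have h3 := (hp.union h2 (by
    rw [Set.disjoint_left]
    rintro v (hv | hv) ⟨k1, k2⟩
    · exact hDs v hv k1
    · exact k2 hv)).union h1 (by
    rw [Set.disjoint_left]
    rintro v ((hv | hv) | ⟨k1, k2⟩) ⟨k3, k4⟩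
    · exact k4 hv
    · have hv : v = u := hv
      exact k3 (hv ▸ hu)
    · exact k3 k1)
  have e : D ∪ {u} ∪ Γ.support \ {u} ∪ Γ.supportᶜ \ D = Set.univ := by
    rw [Set.eq_univ_iff_forall]
    intro v
    simp only [Set.mem_union, Set.mem_sdiff, Set.mem_singleton_iff, Set.mem_compl_iff]
    tauto
  rw [e] at h3
  exact h3

lemma IsoOdd.plus2 (h : IsoOdd G Γ) (hD : DE G) (hT : ∀ t, Tw G Set.univ t) {D D' : Set V}
    (hC : IsCmp G Γ.supportᶜ D) (hC' : IsCmp G Γ.supportᶜ D') (hdj : Disjoint D D') {u : V}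
    (hu : u ∈ Γ.support) (hp : Pc G D 1) (hp' : Pc G (D' ∪ {u}) 0) : Pc G Set.univ 1 := by
  have hC2 : IsCmp G (Γ.supportᶜ \ D) D' := by
    refine ⟨fun v hv => ⟨hC'.1 hv, fun hvD => Set.disjoint_left.1 hdj hvD hv⟩, hC'.2.1, hC'.2.2.1,
      fun d hd y hy => hC'.2.2.2 d hd y hy.1⟩
  have h1 := pc_rest hC2 (fun D'' hD'' => (h.cmp hD hT (cmp_diff hC hD'')).1)
  have h2 := pc_of_mt (mt_odd_cyc h.oc hu)
  have hDs : ∀ v ∈ D, v ∉ Γ.support := hC.1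
  have hDs' : ∀ v ∈ D', v ∉ Γ.support := hC'.1
  have h3 := ((hp.union hp' (by
    rw [Set.disjoint_left]
    rintro v hv (k | k)
    · exact Set.disjoint_left.1 hdj hv k
    · have k : v = u := k
      exact hDs v hv (k ▸ hu))).union h2 (by
    rw [Set.disjoint_left]
    rintro v (hv | hv | hv) ⟨k1, k2⟩
    · exact hDs v hv k1
    · exact hDs' v hv k1
    · exact k2 hv)).union h1 (by
    rw [Set.disjoint_left]
    rintro v ((hv | hv | hv) | ⟨k1, k2⟩) ⟨⟨k3, k5⟩, k4⟩
    · exact k5 hv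
    · exact k4 hv
    · have hv : v = u := hv
      exact k3 (hv ▸ hu)
    · exact k3 k1)
  have e : D ∪ (D' ∪ {u}) ∪ Γ.support \ {u} ∪ (Γ.supportᶜ \ D) \ D' = Set.univ := by
    rw [Set.eq_univ_iff_forall]
    intro v
    simp only [Set.mem_union, Set.mem_sdiff, Set.mem_singleton_iff, Set.mem_compl_iff]
    tauto
  rw [e] at h3
  exact h3

/-- at most one edge leaves Γ -/
lemma IsoOdd.one_edge [DecidableEq V] {M : MixedGraph V} (h : IsoOdd M.graph Γ)
    (hE : Ext M Set.univ) (hT : ∀ t, Tw M.graph Set.univ t) {y u y' u' : V} (hu : u ∈ Γ.support)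
    (hu' : u' ∈ Γ.support) (hy : y ∉ Γ.support) (hy' : y' ∉ Γ.support) (hyu : M.graph.Adj y u)
    (hyu' : M.graph.Adj y' u') : y = y' ∧ u = u' := by
  have hD : DE M.graph := by have := ext_DE M hE; rwa [rs_univ] at this
  obtain ⟨D, hC, hyD⟩ := exists_cmp (H := M.graph) (Y := Γ.supportᶜ) hy
  obtain ⟨D', hC', hyD'⟩ := exists_cmp (H := M.graph) (Y := Γ.supportᶜ) hy'
  by_cases hm : y' ∈ D
  · exact cmp_unique (Y := Γ.supportᶜ) (K := Γ.support) disjoint_compl_left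
      (con_cyc h.oc.1 h.oc.2.1) h.nox hC hyD hm hu hu' hyu hyu'
  · exfalso
    have hdj : Disjoint D D' := by
      rw [Set.disjoint_left]
      intro v h1 h2
      exact hm (cmp_disj hC hC' h1 h2 hyD')
    obtain ⟨p1, p2, p3⟩ := h.branch hD hC.1 ((h.cmp hD hT hC).2 y hyD ⟨u, hu, hyu⟩)
    obtain ⟨q1, q2, q3⟩ := h.branch hD hC'.1 ((h.cmp hD hT hC').2 y' hyD' ⟨u', hu', hyu'⟩)
    rcases p3 with p3 | p3
    · exact pc_ext hE (h.plus2 hD hT hC hC' hdj hu' p3 (q2 u' hu' hyu'))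
    · exact pc_ext hE (h.plus hD hT hC hu (p3 u hu hyu))

end T16

section T17
open SimpleGraph
variable [Fintype V] [DecidableEq V] {M : MixedGraph V} {Γ : SimpleGraph V}

lemma pc_no_ec {G : SimpleGraph V} {S : Set V} (h : Pc G S 1) (hno : ∀ Z, EC G Z → ¬ Z.support ⊆ S) :
    False := by
  obtain ⟨X, T, hX, hT, hd, hm, hZ, hc⟩ := h
  have : X = ∅ := by
    rw [Set.eq_empty_iff_forall_notMem]
    intro x hx
    obtain ⟨Z, h1, h2, -⟩ := hZ x hx
    exact hno Z h1 h2
  rw [this, Set.ncard_empty] at hc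
  have := Set.ncard_le_ncard hT (Set.toFinite _)
  omega

lemma IsoOdd.rkΓ (h : IsoOdd M.graph Γ) (ho : ¬ OS M Γ) : rk M Γ.support = Γ.support.ncard := by
  rw [← not_os_rank h.oc ho, rk]
  congr 1
  ext i j
  simp only [MixedPaper.mk, zm, Matrix.of_apply]
  by_cases h1 : Γ.Adj i j
  · rw [if_pos h1, if_pos ⟨mem_supp_l h1, mem_supp_r h1⟩]
  · rw [if_neg h1]
    split_ifs with h2
    · exact hM_zero M (fun h3 => h1 (h.hin h2.1 h2.2 h3))
    · rfl

lemma IsoOdd.forest (h : IsoOdd M.graph Γ) (hD : DE M.graph) (ho : ¬ OS M Γ) {y u : V}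
    (hy : y ∉ Γ.support) (hu : u ∈ Γ.support) (hyu : M.graph.Adj y u)
    (hout : ∀ a ∈ Γ.support, ∀ b, b ∉ Γ.support → M.graph.Adj a b → b = y) :
    ∀ (n : ℕ) (T : Set V), T.ncard = n → T ⊆ Γ.supportᶜ → Mt M.graph T →
      (∀ Z, EC M.graph Z → ¬ Z.support ⊆ T) → Γ.support.ncard + T.ncard ≤ rk M (Γ.support ∪ T) := by
  intro n
  induction n using Nat.strong_induction_on with
  | _ n ih =>
  intro T hTn hTs hm hno
  by_cases hyT : y ∈ T
  · obtain ⟨f, hf⟩ := hm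
    have hnb : ¬ Brn M.graph T y := by
      intro hB
      obtain ⟨-, -, p⟩ := h.branch hD hTs hB
      rcases p with p | p
      · exact pc_no_ec p hno
      · refine pc_no_ec (p u hu hyu) (fun Z hZ hs => hno Z hZ (fun v hv => ?_))
        rcases hs hv with hh | hh
        · exact hh
        · have hh : v = u := hh
          exact absurd hv (Set.disjoint_left.1 (h.dis Z hZ) (hh ▸ hu))
    have hex : ∃ t ∈ T, t ≠ y ∧ ¬ Tw M.graph T t := by
      by_contra hcon
      push Not at hcon
      exact hnb ⟨hyT, hcon, f y, (hf y hyT).1, (hf y hyT).2.1⟩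
    obtain ⟨t, ht, hty, hnt⟩ := hex
    obtain ⟨k1, k2, k3⟩ := hf t ht
    have hst : PendantStep M.graph (Γ.support ∪ T) (Γ.support ∪ (T \ {t, f t})) := by
      refine ⟨t, f t, Or.inr ht, Or.inr k1, ?_, ?_⟩
      · ext w
        constructor
        · rintro ⟨hw | hw, hw'⟩
          · exact absurd (hout w hw t (hTs ht) hw'.symm) hty
          · by_contra hne
            exact hnt ⟨w, f t, hne, hw, k1, hw', k2⟩
        · rintro rfl
          exact ⟨Or.inr k1, k2⟩
      · ext v
        have h1 : t ∉ Γ.support := hTs ht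
        have h2 : f t ∉ Γ.support := hTs k1
        simp only [Set.mem_union, Set.mem_sdiff, Set.mem_insert_iff, Set.mem_singleton_iff]
        constructor
        · rintro (hv | hv)
          · refine ⟨Or.inl hv, ?_⟩
            rintro (rfl | rfl)
            · exact h1 hv
            · exact h2 hv
          · exact ⟨Or.inr hv.1, hv.2⟩
        · rintro ⟨hv | hv, hv'⟩
          · exact Or.inl hv
          · exact Or.inr ⟨hv, hv'⟩
    have hp := (pstep M hst).1
    have hcard : (T \ {t, f t}).ncard + 2 = T.ncard := by
      have := Set.ncard_sdiff_add_ncard_of_subset (s := {t, f t}) (t := T) (by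
        rintro v (rfl | rfl)
        · exact ht
        · exact k1) (Set.toFinite _)
      rwa [Set.ncard_pair k2.ne] at this
    have := ih _ (by omega) (T \ {t, f t}) rfl (Set.sdiff_subset.trans hTs) ⟨f, by
      rintro v ⟨hv, hv'⟩
      obtain ⟨j1, j2, j3⟩ := hf v hv
      refine ⟨⟨j1, ?_⟩, j2, j3⟩
      rintro (hh | hh)
      · apply hv'; right
        show v = f t
        rw [← j3, hh]
      · have hh : f v = f t := hh
        apply hv'; left
        rw [← j3, hh, k3]⟩ (fun Z hZ hs => hno Z hZ (hs.trans Set.sdiff_subset))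
    omega
  · have hd : Disjoint Γ.support T := by
      rw [Set.disjoint_left]; intro v h1 h2; exact hTs h2 h1
    rw [rk_union hd (fun s hs t ht hst => hyT (hout s hs t (hTs ht) hst ▸ ht)), h.rkΓ ho]
    have := rk_ge_of_mt M hm (by
      rintro ⟨Z, hZ⟩
      exact hno Z ⟨hZ.1, hZ.2.1.trans (rs_le _ _), hZ.2.2⟩ (supp_of_le_rs hZ.2.1))
    omega

lemma IsoOdd.claim (h : IsoOdd M.graph Γ) (hD : DE M.graph) (ho : ¬ OS M Γ) {y u : V}
    (hy : y ∉ Γ.support) (hu : u ∈ Γ.support) (hyu : M.graph.Adj y u)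
    (hout : ∀ a ∈ Γ.support, ∀ b, b ∉ Γ.support → M.graph.Adj a b → b = y) :
    ∀ (n : ℕ) (D : Set V), D.ncard = n → D ⊆ Γ.supportᶜ →
      Γ.support.ncard + 2 * mS M.graph D ≤ rk M (Γ.support ∪ D) + 2 * kS M.graph D := by
  intro n
  induction n using Nat.strong_induction_on with
  | _ n ih =>
  intro D hDn hDs
  by_cases hex : ∃ Z, EC (rs M.graph D) Z
  · obtain ⟨Z, hZ⟩ := hex
    obtain ⟨a, b, hab⟩ := hZ.1.edge
    have ha := mem_supp_l hab
    have haD : a ∈ D := supp_of_le_rs hZ.2.1 ha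
    have h1 := Set.ncard_sdiff_singleton_add_one haD (Set.toFinite _)
    have h2 := ih _ (by omega) (D \ {a}) rfl (Set.sdiff_subset.trans hDs)
    have h3 := mS_del M.graph D a
    have h4 := kp_lt (rs_mono M.graph (Set.sdiff_subset : D \ {a} ⊆ D)) hZ (not_le_del ha)
    have h5 := rk_mono M (Set.union_subset_union_right Γ.support (Set.sdiff_subset : D \ {a} ⊆ D))
    simp only [kS] at *
    omega
  · obtain ⟨T, hT, hT'⟩ := mnum_ex (rs M.graph D)
    have h1 := hT.sub
    have h2 := h.forest hD ho hy hu hyu hout _ T rfl (h1.trans hDs) (hT.mono (rs_le _ _)) (by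
      intro Z hZ hs
      exact hex ⟨Z, hZ.1, le_rs hZ.2.1 (hs.trans h1), hZ.2.2⟩)
    have h5 := rk_mono M (Set.union_subset_union_right Γ.support h1)
    simp only [mS]
    omega

lemma IsoOdd.os (h : IsoOdd M.graph Γ) (hD : DE M.graph) (hE : Ext M Set.univ) {y u : V}
    (hy : y ∉ Γ.support) (hu : u ∈ Γ.support) (hyu : M.graph.Adj y u)
    (hout : ∀ a ∈ Γ.support, ∀ b, b ∉ Γ.support → M.graph.Adj a b → b = y)
    (hpc : Pc M.graph Γ.supportᶜ 0) : OS M Γ := by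
  by_contra ho
  obtain ⟨X, T, hX, hT, hd, hm, hZ, hc⟩ := hpc
  obtain ⟨e1, e2, e3⟩ := pc_del _ Set.univ X rfl hE (Set.subset_univ _) (fun x hx => by
    obtain ⟨Z, h1, h2, h3⟩ := hZ x hx
    exact ⟨Z, h1, Set.subset_univ _, h3⟩)
  have h1 := h.claim hD ho hy hu hyu hout _ (Γ.supportᶜ \ X) rfl Set.sdiff_subset
  have h2 : Γ.support ∪ Γ.supportᶜ \ X = Set.univ \ X := by
    ext v
    simp only [Set.mem_union, Set.mem_sdiff, Set.mem_compl_iff, Set.mem_univ, true_and]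
    constructor
    · rintro (hv | hv)
      · exact fun hx => hX hx hv
      · exact hv.2
    · intro hv
      by_cases hh : v ∈ Γ.support
      · exact Or.inl hh
      · exact Or.inr ⟨hh, hv⟩
  rw [h2] at h1
  have h3 : kS M.graph (Γ.supportᶜ \ X) ≤ kS M.graph (Set.univ \ X) :=
    kp_mono (rs_mono _ (fun v hv => ⟨trivial, hv.2⟩))
  have h4 : T.ncard ≤ 2 * mS M.graph (Γ.supportᶜ \ X) :=
    mnum_ge (hm.rs (fun v hv => ⟨hT hv, fun hx => Set.disjoint_left.1 hd hx hv⟩))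
  have h5 := mS_le_card M.graph (Set.univ : Set V)
  have h6 : (Set.univ : Set V).ncard = Γ.support.ncard + Γ.supportᶜ.ncard := by
    rw [← Set.union_compl_self Γ.support, Set.ncard_union_eq disjoint_compl_right]
  obtain ⟨k, hk⟩ := h.oc.2.2
  unfold Ext at e1
  omega

end T17

section T18
open SimpleGraph
variable [Fintype V] [DecidableEq V] {M : MixedGraph V}

lemma hRank_inst {W : Type u} (N : MixedGraph W) (i1 i1' : Fintype W) (i2 i2' : DecidableEq W) :
    @MixedGraph.hRank W i1 i2 N = @MixedGraph.hRank W i1' i2' N := by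
  rw [Subsingleton.elim i1 i1', Subsingleton.elim i2 i2']

lemma g0_last (hD : DE M.graph) {S : Set V} (ho : ¬ ∃ Z, OC (rs M.graph S) Z)
    [i1 : Fintype S] [i2 : DecidableEq S] :
    (((M.induce S).hRank : ℤ) = 2 * (matchingNumber (M.induce S).graph : ℤ) -
        2 * cyclomatic (M.induce S).graph) ↔ Ext M S := by
  have h1 : (M.induce S).hRank = rk M S := by
    rw [← hRank_induce M S]
    exact hRank_inst _ _ _ _ _
  have h2 : cyclomatic (M.induce S).graph = kp (M.induce S).graph := by
    refine cyc_eq_kp (DE_transfer (Function.Embedding.subtype (· ∈ S)) hD) ?_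
    rintro ⟨Z, hZ⟩
    have := (OC_map (Function.Embedding.subtype (· ∈ S))).2 hZ
    rw [range_sub] at this
    exact ho ⟨_, this⟩
  have h3 : matchingNumber (M.induce S).graph = mS M.graph S := mnum_induce M.graph S
  have h4 : kp (M.induce S).graph = kS M.graph S := kp_induce M.graph S
  rw [h1, h2, h3, h4]
  unfold Ext
  omega

lemma no_oc_S {G Γ : SimpleGraph V} (hΓ : IsCyc Γ) (hu : ∀ Z, OC G Z → Z = Γ) (x : V) :
    ¬ ∃ Z, OC (rs G (Γ.supportᶜ ∪ {x})) Z := by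
  rintro ⟨Z, hZ, hle, ho⟩
  have := hu Z ⟨hZ, hle.trans (rs_le _ _), ho⟩
  subst this
  obtain ⟨a, b, hab⟩ := hZ.edge
  have h := hle hab
  have h1 : a = x := by
    rcases h.2.1 with h | h
    · exact absurd (mem_supp_l hab) h
    · exact h
  have h2 : b = x := by
    rcases h.2.2 with h | h
    · exact absurd (mem_supp_r hab) h
    · exact h
  exact hab.ne (h1.trans h2.symm)

lemma nbr_eq {Γ : SimpleGraph V} (hΓ : IsCyc Γ) {v : V} (hv : v ∈ Γ.support) :
    {w | Γ.Adj v w}.ncard = 2 := hΓ.ncard_nbr hv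

lemma case_II (hc : M.graph.Connected) (hn : NoPendantVerts M.graph) (hE : Ext M Set.univ)
    {Γ : SimpleGraph V} (h : IsoOdd M.graph Γ) : MemG2 M := by
  have hD : DE M.graph := by have := ext_DE M hE; rwa [rs_univ] at this
  obtain ⟨a, b, hab⟩ := h.oc.1.edge
  haveI : Nontrivial V := ⟨a, b, hab.ne⟩
  have hT : ∀ t, Tw M.graph Set.univ t := tw_univ hc hn
  by_cases hV : Γ.support = Set.univ
  · right; right; right
    have hG : M.graph = Γ := by
      ext a b
      exact ⟨fun hh => h.hin (by rw [hV]; trivial) (by rw [hV]; trivial) hh, fun hh => h.oc.2.1 hh⟩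
    have hC := h.oc.1
    have ho := h.oc.2.2
    rw [← hG] at hC hV
    rw [← hG, hV, Set.ncard_univ] at ho
    exact ⟨cycleMG_iff.2 ⟨hC, hV⟩, ho, (oddc_iff hC hV ho).1 hE⟩
  · left
    obtain ⟨y, hy, u, hu, hyu⟩ := cross_edge hc ⟨a, mem_supp_l hab⟩ (Set.nonempty_compl.2 hV)
    have huni : ∀ a ∈ Γ.support, ∀ b, b ∉ Γ.support → M.graph.Adj a b → b = y ∧ a = u := by
      intro a ha b hb hh
      exact h.one_edge hE hT ha hu hb hy hh.symm hyu
    have hpc : Pc M.graph Γ.supportᶜ 0 := pc_comps _ _ rfl (fun D hC => (h.cmp hD hT hC).1)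
    have hos := h.os hD hE hy hu hyu (fun a ha b hb hh => (huni a ha b hb hh).1) hpc
    have hxc : exc M.graph = 1 := by
      have h1 := exc_odd (h.oc.2.1 hab) ⟨Γ, h.oc.1, h.oc.2.1, hab⟩ (by
        rintro ⟨Z, hZ, hZab⟩
        exact Set.disjoint_left.1 (h.dis Z hZ) (mem_supp_l hab) (mem_supp_l hZab))
      have h2 := cyc_eq_kp (hD.mono (de_le M.graph a b)) (by
        rintro ⟨Z, hZ, hle, ho⟩
        have := h.uni Z ⟨hZ, hle.trans (de_le _ _ _), ho⟩
        exact (le_de_iff.1 hle).2 (this ▸ hab))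
      unfold exc at *
      omega
    refine ⟨hc, ?_, ?_, hn, sgOf Γ h.oc.2.1, u, ⟨sub_of_isCyc h.oc.1 _, hu, ?_, ?_⟩, h.oc.2.2, ?_, ?_⟩
    · unfold exc at hxc; omega
    · intro C₁ C₂ h1 h2 hne
      have k1 := isCyc_of_sub h1
      have k2 := isCyc_of_sub h2
      have hne' : C₁.spanningCoe ≠ C₂.spanningCoe := by
        intro he
        apply hne
        rw [← sgOf_spanningCoe h1, ← sgOf_spanningCoe h2]
        congr
      rcases Nat.even_or_odd C₁.verts.ncard with e1 | e1 <;>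
        rcases Nat.even_or_odd C₂.verts.ncard with e2 | e2
      · have := hD _ _ (ec_of_sub h1 e1) (ec_of_sub h2 e2) hne'
        rwa [k1.2, k2.2] at this
      · have := h.dis _ (ec_of_sub h1 e1)
        rw [← h.uni _ (oc_of_sub h2 e2), k1.2, k2.2] at this
        exact this.symm
      · have := h.dis _ (ec_of_sub h2 e2)
        rw [← h.uni _ (oc_of_sub h1 e1), k1.2, k2.2] at this
        exact this
      · exact absurd ((h.uni _ (oc_of_sub h1 e1)).trans (h.uni _ (oc_of_sub h2 e2)).symm) hne'
    · have : {w | M.graph.Adj u w} = insert y {w | Γ.Adj u w} := by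
        ext w
        simp only [Set.mem_setOf_eq, Set.mem_insert_iff]
        constructor
        · intro hw
          by_cases hwΓ : w ∈ Γ.support
          · exact Or.inr (h.hin hu hwΓ hw)
          · exact Or.inl (huni u hu w hwΓ hw).1
        · rintro (rfl | hw)
          · exact hyu.symm
          · exact h.oc.2.1 hw
      rw [this, Set.ncard_insert_of_notMem (show y ∉ {w | Γ.Adj u w} from fun hh => hy (mem_supp_r hh)) (Set.toFinite _),
        nbr_eq h.oc.1 hu]
    · intro v hv hvu
      have : {w | M.graph.Adj v w} = {w | Γ.Adj v w} := by
        ext w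
        simp only [Set.mem_setOf_eq]
        constructor
        · intro hw
          by_cases hwΓ : w ∈ Γ.support
          · exact (h.hin hv hwΓ hw)
          · exact absurd (huni v hv w hwΓ hw).2 hvu
        · intro hw
          exact h.oc.2.1 hw
      rw [this, nbr_eq h.oc.1 hv]
    · rw [cycleSig_odd M (sub_of_isCyc h.oc.1 _) h.oc.2.2, spanningCoe_sgOf]; exact hos
    · have hS := (g0_ext h.oc hu (fun a ha b hb => h.hin ha hb)
        (fun a ha b hb hh => (huni a ha b hb hh).2) hos (fun Z hZ v hv =>
          Or.inl (fun hvΓ => Set.disjoint_left.1 (h.dis Z hZ) hvΓ hv))).1 hE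
      exact (g0_last hD (S := (sgOf Γ h.oc.2.1).vertsᶜ ∪ {u}) (no_oc_S h.oc.1 h.uni u)).2 hS

lemma ext_of_g0 (hD : DE M.graph) (hU : Unic M.graph) (h : MemG0 M) : Ext M Set.univ := by
  obtain ⟨hc, -, hdis, hn, C, x, ⟨hC, hx, h3, h2⟩, ho, hsig, hr⟩ := h
  have hs := (isCyc_of_sub hC).2
  have hΓ := oc_of_sub hC ho
  set Γ := C.spanningCoe with hΓdef
  have hx' : x ∈ Γ.support := by rw [hs]; exact hx
  have hdis' : ∀ Z, IsCyc Z → Z ≤ M.graph → Z ≠ Γ → Disjoint Z.support Γ.support := by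
    intro Z hZ hle hne
    have := hdis (sgOf Z hle) C (sub_of_isCyc hZ hle) hC (by
      intro he
      apply hne
      rw [hΓdef, ← he, spanningCoe_sgOf])
    rw [hs]; exact this
  have hI : IsoOdd M.graph Γ := by
    refine isoOdd_of hU hΓ (fun Z hZ => ?_)
    refine (hdis' Z hZ.1 hZ.2.1 ?_).symm
    rintro he
    have h1 := hZ.2.2
    rw [he] at h1
    exact (Nat.not_even_iff_odd.2 hΓ.2.2) h1
  have hout : ∀ a ∈ Γ.support, ∀ b, b ∉ Γ.support → M.graph.Adj a b → a = x := by
    intro a ha b hb hab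
    by_contra hax
    have h4 := h2 a (by rw [← hs]; exact ha) hax
    have h5 := nbr_eq hΓ.1 ha
    have h6 : {w | Γ.Adj a w} = {w | M.graph.Adj a w} :=
      Set.eq_of_subset_of_ncard_le (fun w hw => hΓ.2.1 hw) (by omega) (Set.toFinite _)
    have : b ∈ {w | Γ.Adj a w} := by rw [h6]; exact hab
    exact hb (mem_supp_r this)
  rw [cycleSig_odd M hC ho] at hsig
  refine (g0_ext hΓ hx' (fun a ha b hb => hI.hin ha hb) hout hsig (fun Z hZ v hv =>
          Or.inl (fun hvΓ => Set.disjoint_left.1 (hI.dis Z hZ) hvΓ hv))).2 ?_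
  have := (g0_last hD (S := C.vertsᶜ ∪ {x}) (by
    have := no_oc_S hI.oc.1 hI.uni x
    rwa [hs] at this)).1 hr
  rwa [hs]

end T18

section T19
open SimpleGraph
variable [Fintype V] {G Γ C : SimpleGraph V}

lemma gv_adj {u v : V} (w : G.Walk u v) {i : ℕ} (hi : i < w.length) :
    (wg w).Adj (w.getVert i) (w.getVert (i + 1)) := by
  simp only [wg, Subgraph.spanningCoe_adj]
  exact w.toSubgraph_adj_getVert hi

lemma gv_nbr {u : V} {w : G.Walk u u} (hw : w.IsCycle) {i : ℕ} (h1 : 1 ≤ i) (h2 : i < w.length) {b : V}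
    (hb : (wg w).Adj (w.getVert i) b) : b = w.getVert (i - 1) ∨ b = w.getVert (i + 1) := by
  have a1 := gv_adj w h2
  have a2 : (wg w).Adj (w.getVert i) (w.getVert (i - 1)) := by
    have := gv_adj w (i := i - 1) (by omega)
    rw [Nat.sub_add_cancel h1] at this
    exact this.symm
  obtain ⟨w', h3, h4, h5⟩ := (isCyc_wg w hw).nbrs a1
  have hne := hw.getVert_sub_one_ne_getVert_add_one h2.le
  rcases h5 _ a2 with h | h
  · exact absurd h hne
  · rcases h5 _ hb with h' | h'
    · exact Or.inr h'
    · exact Or.inl (h'.trans h.symm)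

lemma exists_start (hle : Γ ≤ G) (hΓ : IsCyc Γ) {u x : V} (hux : Γ.Adj u x) :
    ∃ w : G.Walk u u, w.IsCycle ∧ wg w = Γ ∧ w.getVert 1 = x := by
  obtain ⟨w, hw, he⟩ := hΓ.exists_walk' hle (mem_supp_l hux)
  have hL := hw.three_le_length
  have a1 : Γ.Adj u (w.getVert 1) := by
    have := gv_adj w (i := 0) (by omega)
    rwa [he, Walk.getVert_zero] at this
  have a2 : Γ.Adj u (w.getVert (w.length - 1)) := by
    have := gv_adj w (i := w.length - 1) (by omega)
    rw [he, Nat.sub_add_cancel (by omega), Walk.getVert_length] at this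
    exact this.symm
  have hne : w.getVert (w.length - 1) ≠ w.getVert 1 := by
    intro h
    have := hw.getVert_injOn (by simp; omega) (by simp; omega) h
    omega
  obtain ⟨w', h3, h4, h5⟩ := hΓ.nbrs a1
  have e2 : w.getVert (w.length - 1) = w' := (h5 _ a2).resolve_left hne
  rcases h5 _ hux with h | h
  · exact ⟨w, hw, he, h.symm⟩
  · refine ⟨w.reverse, hw.reverse, by rw [wg_reverse, he], ?_⟩
    rw [Walk.getVert_reverse, e2, h]

structure Ch (G Γ C : SimpleGraph V) (u : V) (w : G.Walk u u) (s : ℕ) : Prop where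
  hw : w.IsCycle
  he : wg w = Γ
  hu : u ∈ C.support
  hs : s < w.length
  deg : ∀ i, 1 ≤ i → i ≤ s → w.getVert i ∉ C.support ∧
    ∀ b, G.Adj (w.getVert i) b → b = w.getVert (i - 1) ∨ b = w.getVert (i + 1)
  ne : ∀ Z, EC G Z → ¬ Z.Adj (w.getVert s) (w.getVert (s + 1))
  bad : w.getVert (s + 1) ∈ C.support ∨ ∃ b, G.Adj (w.getVert (s + 1)) b ∧ ¬ Γ.Adj (w.getVert (s + 1)) b

lemma exists_ch (hD : DE G) (hΓ : OC G Γ) (hC : EC G C) (hm : ¬ Disjoint Γ.support C.support) :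
    ∃ u w s, Ch G Γ C u w s := by
  obtain ⟨u, x, huC, hux, hn⟩ : ∃ u x, u ∈ C.support ∧ Γ.Adj u x ∧ ¬ C.Adj u x := by
    by_contra hcon
    push Not at hcon
    rw [Set.not_disjoint_iff] at hm
    obtain ⟨v, hv1, hv2⟩ := hm
    have hall := hΓ.1.ind (fun v => v ∈ C.support) (fun a b hab ha => mem_supp_r (hcon a b ha hab)) hv1 hv2
    have : Γ ≤ C := fun a b hab => hcon a b (hall a (mem_supp_l hab)) hab
    have := cyc_le_eq hΓ.1 hC.1 this
    rw [this] at hΓ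
    exact (Nat.not_even_iff_odd.2 hΓ.2.2) hC.2.2
  obtain ⟨w, hw, he, hx⟩ := exists_start hΓ.2.1 hΓ.1 hux
  have hL := hw.three_le_length
  let B : ℕ → Prop := fun s => s + 1 ≤ w.length ∧ (w.getVert (s + 1) ∈ C.support ∨
    ∃ b, G.Adj (w.getVert (s + 1)) b ∧ ¬ Γ.Adj (w.getVert (s + 1)) b)
  have hB : ∃ s, B s := ⟨w.length - 1, by omega, Or.inl (by
    rw [Nat.sub_add_cancel (by omega), Walk.getVert_length]; exact huC)⟩
  have hs := Nat.find_spec hB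
  set s := Nat.find hB with hsdef
  have hdeg : ∀ i, 1 ≤ i → i ≤ s → w.getVert i ∉ C.support ∧
    ∀ b, G.Adj (w.getVert i) b → b = w.getVert (i - 1) ∨ b = w.getVert (i + 1) := by
    intro i h1 h2
    have := Nat.find_min hB (m := i - 1) (by omega)
    have h3 : i - 1 + 1 = i := by omega
    simp only [B, h3] at this
    push Not at this
    have h4 := this (by have := hs.1; omega)
    refine ⟨h4.1, fun b hb => ?_⟩
    have h5 := h4.2 b hb
    rw [← he] at h5
    exact gv_nbr hw h1 (by have := hs.1; omega) h5
  refine ⟨u, w, s, hw, he, huC, hs.1, hdeg, ?_, hs.2⟩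
  have key : ∀ i, i ≤ s → ∀ Z, EC G Z → ¬ Z.Adj (w.getVert i) (w.getVert (i + 1)) := by
    intro i
    induction i with
    | zero =>
      intro _ Z hZ hadj
      rw [Walk.getVert_zero, hx] at hadj
      by_cases hZC : Z = C
      · exact hn (hZC ▸ hadj)
      · exact Set.disjoint_left.1 (hD Z C hZ hC hZC) (mem_supp_l hadj) huC
    | succ i ih =>
      intro hi Z hZ hadj
      obtain ⟨y, h3, h4, h5⟩ := hZ.1.nbrs hadj
      rcases (hdeg (i + 1) (by omega) hi).2 y (hZ.2.1 h4) with h | h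
      · rw [Nat.add_sub_cancel] at h
        subst h
        exact ih (by omega) Z hZ h4.symm
      · exact h3 h
  exact key s le_rfl

variable {u : V} {w : G.Walk u u} {s : ℕ}

/-- the thread -/
def Ch.A (_ : Ch G Γ C u w s) : Set V := {v | ∃ i, 1 ≤ i ∧ i ≤ s ∧ w.getVert i = v}

lemma Ch.A_C (h : Ch G Γ C u w s) : Disjoint h.A C.support := by
  rw [Set.disjoint_left]
  rintro v ⟨i, h1, h2, rfl⟩
  exact (h.deg i h1 h2).1

lemma Ch.gs (h : Ch G Γ C u w s) : w.getVert s ∈ h.A ∪ {u} := by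
  rcases Nat.eq_zero_or_pos s with h0 | h0
  · right; rw [h0]; simp
  · left; exact ⟨s, h0, le_rfl, rfl⟩

/-- Edges leaving the thread. -/
lemma Ch.exit (h : Ch G Γ C u w s) {v b : V} (hv : v ∈ h.A) (hvb : G.Adj v b) (hb : b ∉ h.A) (hbu : b ≠ u) :
    v = w.getVert s ∧ b = w.getVert (s + 1) := by
  obtain ⟨i, h1, h2, rfl⟩ := hv
  rcases (h.deg i h1 h2).2 b hvb with e | e
  · exfalso
    rcases Nat.eq_zero_or_pos (i - 1) with h0 | h0
    · rw [h0, Walk.getVert_zero] at e; exact hbu e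
    · exact hb ⟨i - 1, h0, by omega, e.symm⟩
  · rcases Nat.lt_or_ge i s with h3 | h3
    · exact absurd ⟨i + 1, by omega, by omega, e.symm⟩ hb
    · have : i = s := by omega
      subst this
      exact ⟨rfl, e⟩

lemma Ch.gvA (h : Ch G Γ C u w s) {j : ℕ} (h1 : s < j) (h2 : j ≤ w.length) : w.getVert j ∉ h.A := by
  rintro ⟨i, h3, h4, e⟩
  have := h.hw.getVert_injOn (show i ∈ {i | 1 ≤ i ∧ i ≤ w.length} from ⟨h3, by omega⟩)
    (show j ∈ {i | 1 ≤ i ∧ i ≤ w.length} from ⟨by omega, h2⟩) e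
  omega

lemma Ch.lastΓ (h : Ch G Γ C u w s) : Γ.Adj (w.getVert s) (w.getVert (s + 1)) := by
  have := gv_adj w h.hs
  rwa [h.he] at this

lemma Ch.evca (h : Ch G Γ C u w s) (hD : DE G) (hU : Unic G) (hΓ : OC G Γ) :
    EvCa (de G (w.getVert s) (w.getVert (s + 1))) := by
  refine ⟨fun Z hZ hle => ?_, hD.mono (de_le _ _ _)⟩
  by_contra ho
  have h1 := hU G le_rfl _ _ ⟨Γ, hΓ, h.lastΓ⟩ (by rintro ⟨Z, hZ, hZa⟩; exact h.ne Z hZ hZa) Z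
    ⟨hZ, hle.trans (de_le _ _ _), Nat.not_even_iff_odd.1 ho⟩
  exact (le_de_iff.1 hle).2 h1

lemma de_conn (hc : G.Connected) {a b : V} (hab : G.Adj a b) (hZ : ∃ Z, IsCyc Z ∧ Z ≤ G ∧ Z.Adj a b) :
    (de G a b).Connected := by
  have hr := (reach_iff_cyc hab).2 hZ
  haveI := hc.nonempty
  refine ⟨fun x y => ?_⟩
  refine reach_ind (Z := G) (fun v => (de G a b).Reachable x v) ?_ (hc.preconnected x y) (Reachable.refl _)
  intro p q hpq hp
  by_cases hd : (de G a b).Adj p q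
  · exact hp.trans hd.reachable
  · have : s(p, q) = s(a, b) := by
      by_contra hne
      exact hd (by rw [de, deleteEdges_adj]; exact ⟨hpq, hne⟩)
    rcases Sym2.eq_iff.1 this with ⟨rfl, rfl⟩ | ⟨rfl, rfl⟩
    · exact hp.trans hr
    · exact hp.trans hr.symm

lemma Ch.tw (h : Ch G Γ C u w s) (hΓ : OC G Γ) (hT : ∀ t, Tw G Set.univ t) {t : V}
    (ht : t ∈ (C.support ∪ h.A)ᶜ) :
    Tw (de G (w.getVert s) (w.getVert (s + 1))) ((C.support ∪ h.A)ᶜ ∪ C.support) t := by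
  have htC : t ∉ C.support := fun hh => ht (Or.inl hh)
  have htA : t ∉ h.A := fun hh => ht (Or.inr hh)
  have htu : t ≠ u := fun hh => htC (hh ▸ h.hu)
  have htg : t ≠ w.getVert s := by
    rintro rfl
    rcases h.gs with hh | hh
    · exact htA hh
    · exact htu hh
  have hset : ∀ v, v ∉ h.A → v ∈ (C.support ∪ h.A)ᶜ ∪ C.support := by
    intro v hv
    by_cases hvC : v ∈ C.support
    · exact Or.inr hvC
    · left; rintro (hh | hh)
      · exact hvC hh
      · exact hv hh
  by_cases hta : t = w.getVert (s + 1)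
  · subst hta
    have hL : s + 1 ≠ w.length := by
      intro hh
      rw [hh, Walk.getVert_length] at htu
      exact htu rfl
    have hs := h.hs
    obtain ⟨b, hb1, hb2⟩ := h.bad.resolve_left htC
    have a2 : Γ.Adj (w.getVert (s + 1)) (w.getVert (s + 1 + 1)) := by
      have := gv_adj w (i := s + 1) (by omega)
      rwa [h.he] at this
    have hne2 := h.hw.getVert_sub_one_ne_getVert_add_one (i := s + 1) (by omega)
    rw [Nat.add_sub_cancel] at hne2
    have hbg : b ≠ w.getVert s := by
      rintro rfl
      exact hb2 h.lastΓ.symm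
    have hbA : b ∉ h.A := by
      intro hbA
      exact hbg (h.exit hbA hb1.symm htA htu).1
    refine ⟨b, w.getVert (s + 1 + 1), ?_, hset _ hbA, hset _ (h.gvA (by omega) (by omega)), ?_, ?_⟩
    · rintro rfl; exact hb2 a2
    · simp only [de, deleteEdges_adj, Set.mem_singleton_iff, Sym2.eq_iff]
      exact ⟨hb1, by rintro (⟨h1, h2⟩ | ⟨h1, h2⟩); exacts [htg h1, hbg h2]⟩
    · simp only [de, deleteEdges_adj, Set.mem_singleton_iff, Sym2.eq_iff]
      exact ⟨hΓ.2.1 a2, by rintro (⟨h1, h2⟩ | ⟨h1, h2⟩); exacts [htg h1, hne2 h2.symm]⟩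
  · obtain ⟨w1, w2, hne, -, -, h1, h2⟩ := hT t
    have hA : ∀ v, G.Adj t v → v ∉ h.A := fun v hv hvA => hta (h.exit hvA hv.symm htA htu).2
    exact ⟨w1, w2, hne, hset _ (hA _ h1), hset _ (hA _ h2), de_adj_of_not h1 htg hta, de_adj_of_not h2 htg hta⟩

lemma Ch.mtA (h : Ch G Γ C u w s) : (Odd s → Mt G (h.A ∪ {u})) ∧ (Even s → Mt G h.A) := by
  have hp : (w.take s).IsPath := h.hw.isPath_take h.hs
  have hlen : (w.take s).length = s := by rw [Walk.take_length]; have := h.hs; omega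
  have hsupp : {v | v ∈ (w.take s).support} = h.A ∪ {u} := by
    ext v
    simp only [Set.mem_setOf_eq, Set.mem_union, Set.mem_singleton_iff, Walk.mem_support_iff_exists_getVert]
    constructor
    · rintro ⟨n, hn, hn'⟩
      rw [Walk.take_getVert] at hn
      rw [hlen] at hn'
      rcases Nat.eq_zero_or_pos n with h0 | h0
      · right; rw [← hn, h0]; simp
      · left; exact ⟨n, h0, hn', by rw [← hn]; congr 1; omega⟩
    · rintro (⟨i, h1, h2, rfl⟩ | rfl)
      · exact ⟨i, by rw [Walk.take_getVert]; congr 1; omega, by omega⟩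
      · exact ⟨0, by simp, by omega⟩
  have huA : u ∉ h.A := fun hh => Set.disjoint_left.1 h.A_C hh h.hu
  have := mt_path (w.take s) hp
  rw [hsupp, hlen] at this
  refine ⟨this.1, fun he => ?_⟩
  have h2 := this.2 he
  rwa [Set.union_sdiff_cancel_right (by
    rintro v ⟨hv, rfl⟩; exact huA hv)] at h2

end T19

section T20
open SimpleGraph
variable [Fintype V]

lemma tail_split {G : SimpleGraph V} {a b : V} {p : G.Walk a b} {r : G.Walk b a}
    (h : (p.append r).IsCycle) (v : V) (h1 : v ∈ p.support) (h2 : v ∈ r.support) : v = a ∨ v = b := by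
  have hn := h.support_nodup
  rw [Walk.tail_support_append, List.nodup_append'] at hn
  rw [← Walk.cons_tail_support p] at h1
  rw [← Walk.cons_tail_support r] at h2
  rcases List.mem_cons.1 h1 with h1 | h1
  · exact Or.inl h1
  rcases List.mem_cons.1 h2 with h2 | h2
  · exact Or.inr h2
  exact absurd h2 (fun hh => hn.2.2 h1 hh)

lemma Ch.even_arc {G Γ C : SimpleGraph V} {u : V} {w : G.Walk u u} {s : ℕ} (h : Ch G Γ C u w s)
    (hD : DE G) (hC : EC G C)
    {a : V} {W₁ W : G.Walk u a} (h1 : W₁.IsPath) (ho : Odd W₁.length) (hW : W.IsPath)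
    (hl : s(w.getVert s, w.getVert (s + 1)) ∈ W₁.edges) (hWC : wg W ≤ C)
    (hd : ∀ v, v ∈ W₁.support → v ∈ W.support → v = u ∨ v = a) (hone : W₁.length = 1 → s(u, a) ∈ W₁.edges) :
    Even W.length := by
  by_contra hodd
  rw [Nat.not_even_iff_odd] at hodd
  by_cases hlen : 1 < W.length ∨ 1 < W₁.length
  · have hcyc := cyc_two_paths hW h1 (fun v a b => hd v b a) hlen
    have hev : EC G (wg (W.append W₁.reverse)) := by
      refine ⟨isCyc_wg _ hcyc, wg_le _, ?_⟩
      rw [cycle_ncard _ hcyc, Walk.length_append, Walk.length_reverse]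
      exact hodd.add_odd ho
    refine h.ne _ hev ?_
    rw [wg_append, wg_reverse, sup_adj]
    exact Or.inr ((wg_adj _ _ _).2 hl)
  · push Not at hlen
    have e1 : W₁.length = 1 := by have := ho.pos; omega
    have e2 : W.length = 1 := by have := hodd.pos; omega
    have hadj : C.Adj u a := hWC (by
      have := gv_adj W (i := 0) (by omega)
      rw [Walk.getVert_zero, show 0 + 1 = W.length by omega, Walk.getVert_length] at this
      exact this)
    have e3 : W₁.edges.length = 1 := by rw [Walk.length_edges, e1]
    obtain ⟨e, he⟩ := List.length_eq_one_iff.1 e3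
    have h3 := hone e1
    rw [he, List.mem_singleton] at h3 hl
    have h4 : s(w.getVert s, w.getVert (s + 1)) = s(u, a) := hl.trans h3.symm
    apply h.ne C hC
    rwa [← mem_edgeSet, h4, mem_edgeSet]

variable [DecidableEq V] {M : MixedGraph V}

lemma case_III (hc : M.graph.Connected) (hn : NoPendantVerts M.graph) (hE : Ext M Set.univ)
    (hU : Unic M.graph) {Γ C : SimpleGraph V} (hΓ : OC M.graph Γ) (hC : EC M.graph C)
    (hm : ¬ Disjoint Γ.support C.support) : MemG2 M := by
  have hD : DE M.graph := by have := ext_DE M hE; rwa [rs_univ] at this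
  obtain ⟨u, w, s, h⟩ := exists_ch hD hΓ hC hm
  obtain ⟨a0, b0, hab0⟩ := hΓ.1.edge
  haveI : Nontrivial V := ⟨a0, b0, hab0.ne⟩
  have hT : ∀ t, Tw M.graph Set.univ t := tw_univ hc hn
  have hEv := h.evca hD hU hΓ
  have hsl := h.hs
  have hCle : C ≤ de M.graph (w.getVert s) (w.getVert (s + 1)) := le_de hC.2.1 (h.ne C hC)
  have hYC : Disjoint (C.support ∪ h.A)ᶜ C.support := by
    rw [Set.disjoint_left]
    exact fun v hv hv' => hv (Or.inl hv')
  have hyl := ylem hEv hC.1 hCle hYC (fun t ht => h.tw hΓ hT ht)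
  have hYA : Disjoint (C.support ∪ h.A)ᶜ h.A := by
    rw [Set.disjoint_left]
    exact fun v hv hv' => hv (Or.inr hv')
  rcases Nat.even_or_odd s with hse | hso
  swap
  · exfalso
    have p1 := pc_of_mt (h.mtA.1 hso)
    have p2 := p1.cplus hD hC h.hu h.A_C
    have p3 := (hyl.1.mono (de_le _ _ _)).union p2 (by
      rw [Set.union_comm h.A]; exact disjoint_compl_left)
    rw [Set.union_comm h.A, Set.compl_union_self] at p3
    exact pc_ext hE p3
  have hY : (C.support ∪ h.A)ᶜ = ∅ := by
    by_contra hne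
    have hne' := Set.nonempty_iff_ne_empty.2 hne
    obtain ⟨y, hy, c, hcm, hyc⟩ := cross_edge (de_conn hc (hΓ.2.1 h.lastΓ) ⟨Γ, hΓ.1, hΓ.2.1, h.lastΓ⟩)
      (S := C.support ∪ h.A) ⟨u, Or.inl h.hu⟩ hne'
    have hcC : c ∈ C.support := by
      rcases hcm with hh | hh
      · exact hh
      · exfalso
        obtain ⟨e1, e2⟩ := h.exit hh (de_le _ _ _ hyc.symm) (fun hA => hy (Or.inr hA))
          (by rintro rfl; exact hy (Or.inl h.hu))
        subst e1 e2
        exact (le_de_iff.1 (le_refl (de M.graph (w.getVert s) (w.getVert (s + 1))))).2 hyc.symm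
    have p1 := (hyl.2 ⟨y, hy, c, hcC, hyc⟩).mono (de_le _ _ _)
    have p2 := p1.union (pc_of_mt (h.mtA.2 hse)) (by
      rw [Set.disjoint_union_left]; exact ⟨hYA, h.A_C.symm⟩)
    rw [Set.union_assoc, Set.compl_union_self] at p2
    exact pc_ext hE p2
  have hV : C.support ∪ h.A = Set.univ := Set.compl_empty_iff.1 hY
  have haA : w.getVert (s + 1) ∉ h.A := h.gvA (by omega) (by omega)
  have haC : w.getVert (s + 1) ∈ C.support := by
    have : w.getVert (s + 1) ∈ C.support ∪ h.A := by rw [hV]; trivial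
    exact this.resolve_right haA
  -- edges
  have hedA : ∀ p q, M.graph.Adj p q → p ∈ h.A → ∃ i, i ≤ s ∧ s(p, q) = s(w.getVert i, w.getVert (i + 1)) := by
    rintro p q hpq ⟨i, h1, h2, rfl⟩
    rcases (h.deg i h1 h2).2 q hpq with e | e
    · refine ⟨i - 1, by omega, ?_⟩
      rw [Nat.sub_add_cancel h1, e, Sym2.eq_swap]
    · exact ⟨i, h2, by rw [e]⟩
  have hed : ∀ p q, M.graph.Adj p q → C.Adj p q ∨ ∃ i, i ≤ s ∧ s(p, q) = s(w.getVert i, w.getVert (i + 1)) := by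
    intro p q hpq
    by_cases hpA : p ∈ h.A
    · exact Or.inr (hedA p q hpq hpA)
    by_cases hqA : q ∈ h.A
    · right
      obtain ⟨i, hi, e⟩ := hedA q p hpq.symm hqA
      exact ⟨i, hi, by rw [Sym2.eq_swap, e]⟩
    have hC' : ∀ v, v ∉ h.A → v ∈ C.support := fun v hv => by
      have : v ∈ C.support ∪ h.A := by rw [hV]; trivial
      exact this.resolve_right hv
    by_cases hd : (de M.graph (w.getVert s) (w.getVert (s + 1))).Adj p q
    · exact Or.inl (chordless hEv hC.1 hCle (hC' p hpA) (hC' q hqA) hd)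
    · right
      refine ⟨s, le_rfl, ?_⟩
      by_contra hne
      exact hd (by rw [de, deleteEdges_adj]; exact ⟨hpq, hne⟩)
  have hlt : (w.take (s + 1)).length = s + 1 := by rw [Walk.take_length]; omega
  have hW1s : ∀ v, v ∈ (w.take (s + 1)).support ↔ v = u ∨ v = w.getVert (s + 1) ∨ v ∈ h.A := by
    intro v
    rw [Walk.mem_support_iff_exists_getVert, hlt]
    constructor
    · rintro ⟨n, hn1, hn2⟩
      rw [Walk.take_getVert, min_eq_right hn2] at hn1
      rcases Nat.eq_zero_or_pos n with h0 | h0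
      · left; rw [← hn1, h0]; simp
      · rcases Nat.lt_or_ge s n with h3 | h3
        · right; left; rw [← hn1]; congr 1; omega
        · exact Or.inr (Or.inr ⟨n, h0, h3, hn1⟩)
    · rintro (rfl | rfl | ⟨i, h1, h2, rfl⟩)
      · exact ⟨0, by simp, by omega⟩
      · exact ⟨s + 1, by rw [Walk.take_getVert]; simp, le_rfl⟩
      · exact ⟨i, by rw [Walk.take_getVert, min_eq_right (by omega)], by omega⟩
  have hW1e : ∀ i, i ≤ s → s(w.getVert i, w.getVert (i + 1)) ∈ (w.take (s + 1)).edges := by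
    intro i hi
    rw [← wg_adj]
    have := gv_adj (w.take (s + 1)) (i := i) (by omega)
    rwa [Walk.take_getVert, Walk.take_getVert, min_eq_right (by omega), min_eq_right (by omega)] at this
  by_cases hau : w.getVert (s + 1) = u
  · -- infinity graph
    right; left
    have hsL : s + 1 = w.length := by
      have := (h.hw.getVert_endpoint_iff (i := s + 1) (by omega)).1 hau
      omega
    have hΓs : ∀ v, v ∈ Γ.support ↔ v = u ∨ v ∈ h.A := by
      intro v
      have hvw : v ∈ Γ.support ↔ v ∈ w.support := by
        have := wg_supp w h.hw.not_nil v
        rwa [h.he] at this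
      rw [hvw, Walk.mem_support_iff_exists_getVert]
      constructor
      · rintro ⟨n, rfl, hn2⟩
        rcases Nat.eq_zero_or_pos n with h0 | h0
        · left; rw [h0]; simp
        · rcases Nat.lt_or_ge s n with h3 | h3
          · left
            have e : n = s + 1 := by omega
            exact e ▸ hau
          · exact Or.inr ⟨n, h0, h3, rfl⟩
      · rintro (rfl | ⟨i, h1, h2, rfl⟩)
        · exact ⟨0, by simp, by omega⟩
        · exact ⟨i, rfl, by omega⟩
    refine x1_of_ext hD hU hC hΓ (x := u) ?_ ?_ ?_ hE
    · ext v
      simp only [Set.mem_inter_iff, hΓs, Set.mem_singleton_iff]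
      constructor
      · rintro ⟨h1, h2 | h2⟩
        · exact h2
        · exact absurd h1 (Set.disjoint_left.1 h.A_C h2)
      · rintro rfl
        exact ⟨h.hu, Or.inl rfl⟩
    · ext p q
      rw [sup_adj]
      constructor
      · intro hpq
        rcases hed p q hpq with h1 | ⟨i, hi, e⟩
        · exact Or.inl h1
        · right
          rw [← mem_edgeSet, e, mem_edgeSet, ← h.he]
          exact gv_adj w (by omega)
      · rintro (h1 | h1)
        · exact hC.2.1 h1
        · exact hΓ.2.1 h1
    · rw [Set.eq_univ_iff_forall]
      intro v
      have : v ∈ C.support ∪ h.A := by rw [hV]; trivial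
      rcases this with h1 | h1
      · exact Or.inl h1
      · exact Or.inr ((hΓs v).2 (Or.inr h1))
  · -- theta graph
    right; right; left
    have hsL : s + 1 < w.length := by
      rcases Nat.lt_or_ge (s + 1) w.length with h1 | h1
      · exact h1
      · exact absurd (by rw [show s + 1 = w.length by omega, Walk.getVert_length]) hau
    have hp1 : (w.take (s + 1)).IsPath := h.hw.isPath_take hsL
    obtain ⟨q, hq, hqC⟩ := hC.1.exists_walk' hC.2.1 h.hu
    have hqs : ∀ v, v ∈ q.support ↔ v ∈ C.support := fun v => by
      rw [← hqC]; exact (wg_supp q hq.not_nil v).symm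
    have haq := (hqs _).2 haC
    set a := w.getVert (s + 1) with hadef
    have hsplit := q.take_spec haq
    have hq' := hq
    rw [← hsplit] at hq'
    have hqC' := hqC
    rw [← hsplit, wg_append] at hqC'
    have hp2 : (q.takeUntil a haq).IsPath := hq.isPath_takeUntil haq
    have hp3 : (q.dropUntil a haq).IsPath := hq'.isPath_of_append_right (Walk.not_nil_of_ne (Ne.symm hau))
    have hmem : ∀ v, v ∈ C.support ↔ v ∈ (q.takeUntil a haq).support ∨ v ∈ (q.dropUntil a haq).support := by
      intro v
      rw [← hqs v]
      conv_lhs => rw [← hsplit]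
      rw [Walk.mem_support_append_iff]
    have hd : ∀ v, v ∈ (w.take (s + 1)).support → v ∈ C.support → v = u ∨ v = a := by
      intro v h1 h2
      rcases (hW1s v).1 h1 with h1 | h1 | h1
      · exact Or.inl h1
      · exact Or.inr h1
      · exact absurd h2 (Set.disjoint_left.1 h.A_C h1)
    have hodd1 : Odd (w.take (s + 1)).length := by rw [hlt]; exact hse.add_one
    have hone : (w.take (s + 1)).length = 1 → s(u, a) ∈ (w.take (s + 1)).edges := by
      intro h1
      have := hW1e 0 (by omega)
      rw [Walk.getVert_zero, show 0 + 1 = s + 1 by omega] at this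
      exact this
    have T : Th M.graph (w.take (s + 1)) (q.takeUntil a haq) (q.dropUntil a haq).reverse := by
      refine ⟨hp1, hp2, hp3.reverse, hodd1, ?_, ?_, ?_, ?_, ?_, ?_, ?_⟩
      · exact h.even_arc hD hC hp1 hodd1 hp2 (hW1e s le_rfl) (le_sup_left.trans hqC'.le)
          (fun v h1 h2 => hd v h1 ((hmem v).2 (Or.inl h2))) hone
      · exact h.even_arc hD hC hp1 hodd1 hp3.reverse (hW1e s le_rfl) (by
          rw [wg_reverse]; exact le_sup_right.trans hqC'.le)
          (fun v h1 h2 => hd v h1 ((hmem v).2 (Or.inr (by simpa using h2)))) hone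
      · exact fun v h1 h2 => hd v h1 ((hmem v).2 (Or.inl h2))
      · exact fun v h1 h2 => hd v h1 ((hmem v).2 (Or.inr (by simpa using h2)))
      · exact fun v h1 h2 => tail_split hq' v h1 (by simpa using h2)
      · intro v
        have : v ∈ C.support ∪ h.A := by rw [hV]; trivial
        rcases this with h1 | h1
        · rcases (hmem v).1 h1 with h2 | h2
          · exact Or.inr (Or.inl h2)
          · exact Or.inr (Or.inr (by simpa using h2))
        · exact Or.inl ((hW1s v).2 (Or.inr (Or.inr h1)))
      · intro e
        induction e using Sym2.ind with
        | _ x y =>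
          intro hxy
          rcases hed x y hxy with h1 | ⟨i, hi, e⟩
          · right
            rw [← hqC', sup_adj, wg_adj, wg_adj] at h1
            rcases h1 with h1 | h1
            · exact Or.inl h1
            · right; rw [Walk.edges_reverse, List.mem_reverse]; exact h1
          · left; rw [e]; exact hW1e i hi
    exact x2_of_ext hD hU T hE

end T20

section T21
open SimpleGraph

lemma ext_inst {W : Type u} (N : MixedGraph W) (i1 i1' : Fintype W) (i2 i2' : DecidableEq W) (S : Set W)
    (h : @Ext W i1 i2 N S) : @Ext W i1' i2' N S := by
  rw [Subsingleton.elim i1' i1, Subsingleton.elim i2' i2]; exact h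

lemma nbr_induce (G : SimpleGraph V) (S : Set V) (u : S) :
    {w | (G.induce S).Adj u w}.ncard = {w | w ∈ S ∧ G.Adj u w}.ncard := by
  rw [← Set.ncard_image_of_injective _ Subtype.val_injective]
  congr 1
  ext w
  simp only [Set.mem_image, Set.mem_setOf_eq, comap_adj, Function.Embedding.subtype_apply]
  constructor
  · rintro ⟨x, hx, rfl⟩
    exact ⟨x.2, hx⟩
  · rintro ⟨h1, h2⟩
    exact ⟨⟨w, h1⟩, h2, rfl⟩

lemma noPend_induce {G : SimpleGraph V} {S : Set V} (h : NoPendantIn G S) : NoPendantVerts (G.induce S) := by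
  intro u
  rw [nbr_induce]
  exact h u u.2

lemma noPend_comp {G : SimpleGraph V} (h : NoPendantVerts G) (c : G.ConnectedComponent) :
    NoPendantVerts (G.induce c.supp) := by
  intro u
  rw [nbr_induce]
  have : {w | w ∈ c.supp ∧ G.Adj u w} = {w | G.Adj u w} := by
    ext w
    simp only [Set.mem_setOf_eq, and_iff_right_iff_imp]
    intro hw
    have h1 := u.2
    rw [ConnectedComponent.mem_supp_iff] at h1 ⊢
    rw [← h1]
    exact (ConnectedComponent.connectedComponentMk_eq_of_adj hw).symm
  rw [this]
  exact h u

lemma conn_comp {G : SimpleGraph V} (c : G.ConnectedComponent) : (G.induce c.supp).Connected :=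
  c.connected_toSimpleGraph

section
variable [Fintype V] [DecidableEq V] {M : MixedGraph V}

lemma main_comp (hc : M.graph.Connected) (hn : NoPendantVerts M.graph) (hE : Ext M Set.univ)
    (hU : Unic M.graph) (ho : ∃ Z, OC M.graph Z) : MemG2 M := by
  obtain ⟨Γ, hΓ⟩ := ho
  by_cases hd : ∀ C, EC M.graph C → Disjoint Γ.support C.support
  · exact case_II hc hn hE (isoOdd_of hU hΓ hd)
  · push Not at hd
    obtain ⟨C, hC, hm⟩ := hd
    exact case_III hc hn hE hU hΓ hC hm

lemma memG2_oc (h : MemG2 M) : ∃ Z, OC M.graph Z := by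
  rcases h with h | h | h | h
  · obtain ⟨-, -, -, -, C, x, ⟨hC, -⟩, ho, -⟩ := h
    exact ⟨_, oc_of_sub hC ho⟩
  · obtain ⟨p, q, hp, hq, ⟨C₁, C₂, h1, h2, e1, e2, -⟩, -⟩ := h
    exact ⟨_, oc_of_sub h2 (e2 ▸ hq)⟩
  · obtain ⟨p, l, q, hp, hl, hq, ⟨h1, h2, h3, n1, n2, n3, a, b, W₁, W₂, W₃, p1, p2, p3, l1, l2, l3,
      hv, he, d12, d13, d23⟩, so, se⟩ := h
    have hcyc : (W₂.append W₁.reverse).IsCycle := by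
      refine cyc_two_paths p2 p1 ?_ ?_
      · intro v hv2 hv1
        have : v ∈ {v | v ∈ W₁.support ∧ v ∈ W₂.support} := ⟨hv1, hv2⟩
        rw [d12] at this
        simpa using this
      · rw [l1, l2]; omega
    refine ⟨wg (W₂.append W₁.reverse), isCyc_wg _ hcyc, wg_le _, ?_⟩
    rw [cycle_ncard _ hcyc, Walk.length_append, Walk.length_reverse, l1, l2]
    obtain ⟨k, rfl⟩ := hp
    obtain ⟨m, rfl⟩ := hl
    exact ⟨m + k - 1, by omega⟩
  · obtain ⟨h1, h2, -⟩ := h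
    obtain ⟨hc, hs⟩ := cycleMG_iff.1 h1
    exact ⟨M.graph, hc, le_rfl, by rwa [hs, Set.ncard_univ]⟩

lemma ext_of_g2 (hD : DE M.graph) (hU : Unic M.graph) (h : MemG2 M) : Ext M Set.univ := by
  rcases h with h | h | h | h
  · exact ext_of_g0 hD hU h
  · exact ext_of_x1 hD h
  · exact ext_of_x2 hD h
  · exact ext_of_oddc h

lemma oc_up {G : SimpleGraph V} {S : Set V} {Z : SimpleGraph S} (h : OC (G.induce S) Z) :
    OC G (Z.map (Function.Embedding.subtype (· ∈ S))) ∧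
      (Z.map (Function.Embedding.subtype (· ∈ S))).support ⊆ S := by
  have := (OC_map (Function.Embedding.subtype (· ∈ S))).2 h
  rw [range_sub] at this
  exact ⟨⟨this.1, this.2.1.trans (rs_le _ _), this.2.2⟩, supp_of_le_rs this.2.1⟩

lemma oc_share {G : SimpleGraph V} (hD : DE G) (hU : Unic G) {Z Z' : SimpleGraph V} (h : OC G Z) (h' : OC G Z') :
    ∃ v, v ∈ Z.support ∧ v ∈ Z'.support := by
  obtain ⟨a, b, hab, hno⟩ := odd_edge hD h
  exact ⟨a, mem_supp_l hab, mem_supp_l (hU G le_rfl a b ⟨Z, h, hab⟩ hno Z' h')⟩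

/-- The component statement for a reduced graph. -/
lemma reduced_iff (hD : DE M.graph) (hU : Unic M.graph) (hn : NoPendantVerts M.graph) :
    Ext M Set.univ ↔ (M.graph = ⊥ ∨
            ({c : M.graph.ConnectedComponent | MemG2 (M.comp c)}.Subsingleton ∧
              ∀ c : M.graph.ConnectedComponent, ¬ MemG2 (M.comp c) → GoodOtherComp (M.comp c))) := by
  have hDc : ∀ c : M.graph.ConnectedComponent, DE (M.comp c).graph := fun c =>
    DE_transfer (Function.Embedding.subtype (· ∈ c.supp)) hD
  have hUc : ∀ c : M.graph.ConnectedComponent, Unic (M.comp c).graph := fun c =>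
    hU.comap (Function.Embedding.subtype (· ∈ c.supp))
  have hcc : ∀ c : M.graph.ConnectedComponent, (M.comp c).graph.Connected := fun c => conn_comp c
  have hnc : ∀ c : M.graph.ConnectedComponent, NoPendantVerts (M.comp c).graph := fun c => noPend_comp hn c
  have hex : ∀ c : M.graph.ConnectedComponent, Ext M c.supp ↔ Ext (M.comp c) Set.univ := by
    intro c
    rw [← ext_induce M c.supp]
    exact ⟨fun h => ext_inst _ _ _ _ _ _ h, fun h => ext_inst _ _ _ _ _ _ h⟩
  have hsub : {c : M.graph.ConnectedComponent | MemG2 (M.comp c)}.Subsingleton := by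
    intro c hc c' hc'
    obtain ⟨Z, hZ⟩ := memG2_oc hc
    obtain ⟨Z', hZ'⟩ := memG2_oc hc'
    obtain ⟨h1, h2⟩ := oc_up hZ
    obtain ⟨h1', h2'⟩ := oc_up hZ'
    obtain ⟨v, hv, hv'⟩ := oc_share hD hU h1 h1'
    have e1 := h2 hv
    have e2 := h2' hv'
    rw [ConnectedComponent.mem_supp_iff] at e1 e2
    exact e1.symm.trans e2
  rw [ext_comps]
  constructor
  · intro h
    right
    refine ⟨hsub, fun c hc => ?_⟩
    have hE := (hex c).1 (h c)
    refine case_I (hcc c) (hnc c) hE (fun ho => hc ?_)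
    exact main_comp (hcc c) (hnc c) hE (hUc c) ho
  · rintro (hb | ⟨-, h⟩) c
    · rw [hex]
      refine ext_single ?_
      obtain ⟨v, hv⟩ := c.nonempty_supp
      rw [Nat.card_eq_one_iff_unique]
      refine ⟨⟨fun x y => ?_⟩, ⟨v, hv⟩⟩
      have hx := x.2
      have hy := y.2
      rw [ConnectedComponent.mem_supp_iff] at hx hy
      have hr := ConnectedComponent.exact (hx.trans hy.symm)
      apply Subtype.ext
      refine (reach_ind (Z := M.graph) (fun z => z = x.1) (fun a b hab => ?_) hr rfl).symm
      rw [hb] at hab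
      exact absurd hab (by simp)
    · rw [hex]
      by_cases hc : MemG2 (M.comp c)
      · exact ext_of_g2 (hDc c) (hUc c) hc
      · exact ext_of_good (h c hc)
end
end T21

theorem hRank_eq_twice_matching_sub_twice_evenCycles_iff
    {V : Type u} [Fintype V] [DecidableEq V] (M : MixedGraph V)
    (hκ : (evenCycleCount M.graph : ℤ) = cyclomatic M.graph - 1) :
    (M.hRank : ℤ) = 2 * (matchingNumber M.graph : ℤ) - 2 * (evenCycleCount M.graph : ℤ) ↔
      (EvenCyclesVertexDisjoint M.graph ∧
        ∃ S : Set V, PendantReaches M.graph S ∧ NoPendantIn M.graph S ∧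
          evenCycleCount (M.induce S).graph = evenCycleCount M.graph ∧
          ((M.induce S).graph = ⊥ ∨
            ({c : (M.induce S).graph.ConnectedComponent |
                MemG2 ((M.induce S).comp c)}.Subsingleton ∧
              ∀ c : (M.induce S).graph.ConnectedComponent,
                ¬ MemG2 ((M.induce S).comp c) → GoodOtherComp ((M.induce S).comp c)))) := by
  rw [ext_univ_iff, evenDisj_iff]
  have hk : ∀ S : Set V, evenCycleCount (M.induce S).graph = evenCycleCount M.graph ↔
      kS M.graph S = kS M.graph Set.univ := by
    intro S
    rw [evenCycleCount_eq, evenCycleCount_eq, show kp (M.induce S).graph = kp (rs M.graph S) from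
      kp_induce M.graph S]
    simp only [kS, rs_univ]
  have hU : DE M.graph → Unic M.graph := by
    intro hD
    refine unic_of_exc hD ?_
    rw [evenCycleCount_eq] at hκ
    unfold exc
    omega
  have hred : ∀ S : Set V, DE M.graph → NoPendantIn M.graph S → _ := fun S hD hn =>
    reduced_iff (M := M.induce S) (DE_transfer (Function.Embedding.subtype (· ∈ S)) hD)
      ((hU hD).comap (Function.Embedding.subtype (· ∈ S))) (noPend_induce hn)
  constructor
  · intro hE
    have hD : DE M.graph := by have := ext_DE M hE; rwa [rs_univ] at this
    refine ⟨hD, ?_⟩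
    obtain ⟨S, hS, hn⟩ := exists_reduced M
    obtain ⟨h1, h2⟩ := (ext_reaches M hS).1 hE
    refine ⟨S, hS, hn, (hk S).2 h2, ?_⟩
    exact (hred S hD hn).1 ((ext_induce M S).2 h1)
  · rintro ⟨hD, S, hS, hn, h2, h3⟩
    exact (ext_reaches M hS).2 ⟨(ext_induce M S).1 ((hred S hD hn).2 h3), (hk S).1 h2⟩

end MixedPaper
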